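/- arXiv:1710.09780 — 3 statements merged into one kernel-verified Lean document; each statement's English description precedes it below -/
import Mathlib

section
/- There exists a constant c > 0 such that for every sufficiently large n there is an n-point metric space (X, d) of negative type with the property that every embedding of (X, d) into L₁ (equivalently, into ℝ^m equipped with the ℓ¹ norm, for any m) has distortion at least c·(log log n)^{1/6}. -/
section KVsection

open Finset
open scoped BigOperators

set_option linter.unusedSectionVars false
namespace KV

variable {ι : Type*} [Fintype ι] [DecidableEq ι]

noncomputable def sg (b : Bool) : ℝ := if b then 1 else -1

lemma sg_mul_self (b : Bool) : sg b * sg b = 1 := by cases b <;> simp [sg]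
lemma sg_not (b : Bool) : sg (!b) = - sg b := by cases b <;> simp [sg]
lemma abs_sg (b : Bool) : |sg b| = 1 := by cases b <;> simp [sg]

def flip (x : ι → Bool) (i : ι) : ι → Bool := Function.update x i (!(x i))

lemma flip_flip (x : ι → Bool) (i : ι) : flip (flip x i) i = x := by
  funext j; by_cases h : j = i
  · subst h; simp [flip]
  · simp [flip, h]

lemma expect_flip (F : (ι → Bool) → ℝ) (i : ι) : 𝔼 x, F (flip x i) = 𝔼 x, F x := by
  refine Fintype.expect_equiv ⟨fun x => flip x i, fun x => flip x i, fun x => flip_flip x i,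
    fun x => flip_flip x i⟩ _ _ (fun x => rfl)

noncomputable def chi (S : Finset ι) (x : ι → Bool) : ℝ := ∏ i ∈ S, sg (x i)

lemma chi_flip_of_notMem {S : Finset ι} {i : ι} (h : i ∉ S) (x : ι → Bool) :
    chi S (flip x i) = chi S x := by
  refine Finset.prod_congr rfl fun j hj => ?_
  have : j ≠ i := fun e => h (e ▸ hj)
  simp [flip, this]

lemma chi_insert {S : Finset ι} {i : ι} (h : i ∉ S) (x : ι → Bool) :
    chi (insert i S) x = sg (x i) * chi S x := Finset.prod_insert h

lemma chi_flip_of_mem {S : Finset ι} {i : ι} (h : i ∈ S) (x : ι → Bool) :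
    chi S (flip x i) = - chi S x := by
  rw [← Finset.insert_erase h, chi_insert (Finset.notMem_erase i S),
    chi_insert (Finset.notMem_erase i S), chi_flip_of_notMem (Finset.notMem_erase i S)]
  simp [flip, sg_not]

lemma chi_mul_self (S : Finset ι) (x : ι → Bool) : chi S x * chi S x = 1 := by
  rw [chi, ← Finset.prod_mul_distrib]
  exact Finset.prod_eq_one fun i _ => sg_mul_self _

lemma expect_eq_zero_of_flip (F : (ι → Bool) → ℝ) (i : ι) (h : ∀ x, F (flip x i) = - F x) :
    𝔼 x, F x = 0 := by
  have h1 := expect_flip F i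
  simp only [h, Finset.expect_neg_distrib] at h1
  linarith

lemma chi_orth (S T : Finset ι) : 𝔼 x, chi S x * chi T x = if S = T then 1 else 0 := by
  split_ifs with h
  · subst h; simp [chi_mul_self]
  · have : ∃ i, ¬ (i ∈ S ↔ i ∈ T) := by
      by_contra hc; push Not at hc; exact h (Finset.ext hc)
    obtain ⟨i, hi⟩ := this
    apply expect_eq_zero_of_flip _ i
    intro x
    by_cases h1 : i ∈ S
    · have h2 : i ∉ T := by tauto
      rw [chi_flip_of_mem h1, chi_flip_of_notMem h2]; ring
    · have h2 : i ∈ T := by tauto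
      rw [chi_flip_of_notMem h1, chi_flip_of_mem h2]; ring

lemma parseval (c e : Finset ι → ℝ) :
    𝔼 x, (∑ S, c S * chi S x) * (∑ S, e S * chi S x) = ∑ S, c S * e S := by
  calc 𝔼 x, (∑ S, c S * chi S x) * (∑ S, e S * chi S x)
      = 𝔼 x, ∑ S, ∑ T, (c S * e T) * (chi S x * chi T x) := by
        refine Finset.expect_congr rfl fun x _ => ?_
        rw [Finset.sum_mul_sum]
        refine Finset.sum_congr rfl fun S _ => Finset.sum_congr rfl fun T _ => by ring
    _ = ∑ S, ∑ T, (c S * e T) * (if S = T then 1 else 0) := by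
        rw [Finset.expect_sum_comm]
        refine Finset.sum_congr rfl fun S _ => ?_
        rw [Finset.expect_sum_comm]
        refine Finset.sum_congr rfl fun T _ => ?_
        rw [← Finset.mul_expect, chi_orth]
    _ = _ := by simp

noncomputable def ft (f : (ι → Bool) → ℝ) (S : Finset ι) : ℝ := 𝔼 y, f y * chi S y

lemma chi_complete (x y : ι → Bool) :
    ∑ S, chi S x * chi S y = if x = y then (2:ℝ) ^ (Fintype.card ι) else 0 := by
  have : ∑ S, chi S x * chi S y = ∏ i, (1 + sg (x i) * sg (y i)) := by
    rw [Finset.prod_one_add, Finset.powerset_univ]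
    refine Finset.sum_congr rfl fun S _ => ?_
    rw [chi, chi, ← Finset.prod_mul_distrib]
  rw [this]
  split_ifs with h
  · subst h
    simp only [sg_mul_self]
    norm_num
  · obtain ⟨i, hi⟩ := Function.ne_iff.mp h
    apply Finset.prod_eq_zero (Finset.mem_univ i)
    revert hi
    cases x i <;> cases y i <;> simp [sg]

lemma ft_expand (f : (ι → Bool) → ℝ) (x : ι → Bool) : f x = ∑ S, ft f S * chi S x := by
  have : ∑ S, ft f S * chi S x = 𝔼 y, f y * ∑ S, chi S y * chi S x := by
    simp only [ft, Finset.expect_mul, Finset.mul_sum]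
    rw [Finset.expect_sum_comm]
    refine Finset.sum_congr rfl fun S _ => Finset.expect_congr rfl fun y _ => by ring
  rw [this]
  simp only [chi_complete]
  rw [Fintype.expect_eq_sum_div_card]
  simp

/-- hypercontractivity with rho^2 = 1/3 -/
lemma hyper_aux (ρ : ℝ) (hρ : ρ ^ 2 = 1 / 3) (s : Finset ι) : ∀ c : Finset ι → ℝ,
    𝔼 x, (∑ S ∈ s.powerset, ρ ^ (#S) * c S * chi S x) ^ 4 ≤ (∑ S ∈ s.powerset, c S ^ 2) ^ 2 := by
  induction s using Finset.induction_on with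
  | empty =>
    intro c
    simp [chi]
    apply le_of_eq; ring
  | insert i s hi ih =>
    intro c
    set A : (ι → Bool) → ℝ := fun x => ∑ S ∈ s.powerset, ρ ^ (#S) * c S * chi S x with hA
    set B : (ι → Bool) → ℝ := fun x => ∑ S ∈ s.powerset, ρ ^ (#S) * c (insert i S) * chi S x with hB
    set a := ∑ S ∈ s.powerset, c S ^ 2 with ha
    set b := ∑ S ∈ s.powerset, c (insert i S) ^ 2 with hb
    have ha0 : 0 ≤ a := Finset.sum_nonneg fun _ _ => sq_nonneg _
    have hb0 : 0 ≤ b := Finset.sum_nonneg fun _ _ => sq_nonneg _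
    have hAA : 𝔼 x, A x ^ 4 ≤ a ^ 2 := ih c
    have hBB : 𝔼 x, B x ^ 4 ≤ b ^ 2 := ih (fun S => c (insert i S))
    have hAf : ∀ x, A (flip x i) = A x := fun x => by
      refine Finset.sum_congr rfl fun S hS => ?_
      rw [chi_flip_of_notMem (fun h => hi (Finset.mem_powerset.mp hS h))]
    have hBf : ∀ x, B (flip x i) = B x := fun x => by
      refine Finset.sum_congr rfl fun S hS => ?_
      rw [chi_flip_of_notMem (fun h => hi (Finset.mem_powerset.mp hS h))]
    have hdec : ∀ x, ∑ S ∈ (insert i s).powerset, ρ ^ (#S) * c S * chi S x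
        = A x + ρ * sg (x i) * B x := by
      intro x
      rw [Finset.sum_powerset_insert hi]
      congr 1
      rw [hB, Finset.mul_sum]
      refine Finset.sum_congr rfl fun S hS => ?_
      have hiS : i ∉ S := fun h => hi (Finset.mem_powerset.mp hS h)
      rw [chi_insert hiS, Finset.card_insert_of_notMem hiS]
      ring
    have hc : ∑ S ∈ (insert i s).powerset, c S ^ 2 = a + b := Finset.sum_powerset_insert hi _
    rw [hc]
    simp only [hdec]
    have h1 : 𝔼 x, (A x + ρ * sg (x i) * B x) ^ 4
        = 𝔼 x, (A x ^ 4 + 2 * (A x ^ 2 * B x ^ 2) + 1 / 9 * B x ^ 4) := by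
      have h2 := expect_flip (fun x => (A x + ρ * sg (x i) * B x) ^ 4) i
      have h3 : 𝔼 x, (A x + ρ * sg (x i) * B x) ^ 4 =
        𝔼 x, ((A x + ρ * sg (x i) * B x) ^ 4 +
          (A (flip x i) + ρ * sg ((flip x i) i) * B (flip x i)) ^ 4) / 2 := by
        rw [← Finset.expect_div, Finset.expect_add_distrib, h2]; ring
      rw [h3]
      refine Finset.expect_congr rfl fun x _ => ?_
      rw [hAf, hBf]
      have : sg ((flip x i) i) = - sg (x i) := by simp [flip, sg_not]
      rw [this]
      have hs : sg (x i) ^ 2 = 1 := by rw [sq, sg_mul_self]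
      have e1 : (ρ * sg (x i)) ^ 2 = 1 / 3 := by rw [mul_pow, hρ, hs]; ring
      have e2 : (ρ * sg (x i)) ^ 4 = 1 / 9 := by
        rw [show (ρ * sg (x i)) ^ 4 = ((ρ * sg (x i)) ^ 2) ^ 2 by ring, e1]; norm_num
      have : ((A x + ρ * sg (x i) * B x) ^ 4 + (A x + ρ * -sg (x i) * B x) ^ 4) / 2
        = A x ^ 4 + 6 * (ρ * sg (x i)) ^ 2 * A x ^ 2 * B x ^ 2 + (ρ * sg (x i)) ^ 4 * B x ^ 4 := by
        ring
      rw [this, e1, e2]; ring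
    rw [h1, Finset.expect_add_distrib, Finset.expect_add_distrib, ← Finset.mul_expect,
      ← Finset.mul_expect]
    have hcs : 𝔼 x, A x ^ 2 * B x ^ 2 ≤ a * b := by
      have hcs1 : (𝔼 x, A x ^ 2 * B x ^ 2) ^ 2 ≤ (𝔼 x, A x ^ 4) * (𝔼 x, B x ^ 4) := by
        have := Finset.expect_mul_sq_le_sq_mul_sq Finset.univ (fun x => A x ^ 2) (fun x => B x ^ 2)
        simpa only [← pow_mul] using this
      have : (𝔼 x, A x ^ 2 * B x ^ 2) ^ 2 ≤ (a * b) ^ 2 := by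
        refine hcs1.trans ?_
        rw [mul_pow]
        refine mul_le_mul hAA hBB ?_ (by positivity)
        exact Finset.expect_nonneg fun _ _ => by positivity
      exact abs_le_of_sq_le_sq' this (by positivity) |>.2
    have hB4 : 0 ≤ 𝔼 x, B x ^ 4 := Finset.expect_nonneg fun _ _ => by positivity
    nlinarith

lemma hyper (ρ : ℝ) (hρ : ρ ^ 2 = 1 / 3) (c : Finset ι → ℝ) :
    𝔼 x, (∑ S, ρ ^ (#S) * c S * chi S x) ^ 4 ≤ (∑ S, c S ^ 2) ^ 2 := by
  have := hyper_aux ρ hρ (Finset.univ : Finset ι) c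
  simpa only [Finset.powerset_univ] using this

end KV


open Finset
open scoped BigOperators
set_option linter.unusedSectionVars false
namespace KV
variable {ι : Type*} [Fintype ι] [DecidableEq ι]

lemma diff_expand (f : (ι → Bool) → ℝ) (i : ι) (x : ι → Bool) :
    (f x - f (flip x i)) / 2 = ∑ S, (if i ∈ S then ft f S else 0) * chi S x := by
  conv_lhs => rw [ft_expand f x, ft_expand f (flip x i)]
  rw [← Finset.sum_sub_distrib, Finset.sum_div]
  refine Finset.sum_congr rfl fun S _ => ?_
  split_ifs with h
  · rw [chi_flip_of_mem h]; ring
  · rw [chi_flip_of_notMem h]; ring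

lemma expect_sq (f : (ι → Bool) → ℝ) : 𝔼 x, f x ^ 2 = ∑ S, ft f S ^ 2 := by
  have := parseval (ft f) (ft f)
  simp only [← ft_expand, ← sq] at this
  exact this

noncomputable def inf (f : (ι → Bool) → ℝ) (i : ι) : ℝ := 𝔼 x, |f x - f (flip x i)|

lemma inf_nonneg (f : (ι → Bool) → ℝ) (i : ι) : 0 ≤ inf f i :=
  Finset.expect_nonneg fun _ _ => abs_nonneg _

lemma abs_eq_sq (f : (ι → Bool) → ℝ) (hf : ∀ x, f x = 0 ∨ f x = 1) (x y : ι → Bool) :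
    |f x - f y| = (f x - f y) ^ 2 := by
  rcases hf x with h | h <;> rcases hf y with h' | h' <;> simp [h, h']

lemma inf_eq (f : (ι → Bool) → ℝ) (hf : ∀ x, f x = 0 ∨ f x = 1) (i : ι) :
    ∑ S, (if i ∈ S then ft f S else 0) ^ 2 = inf f i / 4 := by
  have := parseval (fun S => if i ∈ S then ft f S else 0) (fun S => if i ∈ S then ft f S else 0)
  simp only [← diff_expand] at this
  simp only [sq]
  rw [← this, inf, Finset.expect_div]
  refine Finset.expect_congr rfl fun x _ => ?_
  rw [abs_eq_sq f hf]; ring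

lemma W_bound (f : (ι → Bool) → ℝ) (hf : ∀ x, f x = 0 ∨ f x = 1) (i : ι) :
    (∑ S, (1 / 3 : ℝ) ^ (#S) * (if i ∈ S then ft f S else 0) ^ 2) ^ 2 ≤ inf f i ^ 3 / 16 := by
  set c : Finset ι → ℝ := fun S => if i ∈ S then ft f S else 0 with hc
  set W := ∑ S, (1 / 3 : ℝ) ^ (#S) * (c S) ^ 2 with hW
  set h : (ι → Bool) → ℝ := fun x => (f x - f (flip x i)) / 2 with hh
  set D : (ι → Bool) → ℝ := fun x => |f x - f (flip x i)| with hD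
  set P : (ι → Bool) → ℝ := fun x => ∑ S, ((1 / 3 : ℝ) ^ (#S) * c S) * chi S x with hP
  have hW0 : 0 ≤ W := Finset.sum_nonneg fun _ _ => by positivity
  have hp0 := inf_nonneg f i
  have hDD : ∀ x, D x ^ 2 = D x := by
    intro x; simp only [hD]
    rcases hf x with h1 | h1 <;> rcases hf (flip x i) with h' | h' <;> simp [h1, h']
  have hhD : ∀ x, h x = h x * D x := by
    intro x; simp only [hD, hh]
    rcases hf x with h1 | h1 <;> rcases hf (flip x i) with h' | h' <;> simp [h1, h']
  have hhsq : 𝔼 x, h x ^ 2 = inf f i / 4 := by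
    rw [inf, Finset.expect_div]
    refine Finset.expect_congr rfl fun x _ => ?_
    rw [abs_eq_sq f hf]; simp only [hh]; ring
  have h1 : W = 𝔼 x, h x * P x := by
    have := parseval c (fun S => (1 / 3 : ℝ) ^ (#S) * c S)
    simp only [hc, ← diff_expand] at this
    rw [this]
    refine Finset.sum_congr rfl fun S _ => by simp only [hc]; ring
  have hρ : (√(1/3:ℝ)) ^ 2 = 1 / 3 := Real.sq_sqrt (by norm_num)
  have h2 : 𝔼 x, P x ^ 4 ≤ W ^ 2 := by
    have := hyper (√(1/3:ℝ)) hρ (fun S => (√(1/3:ℝ)) ^ (#S) * c S)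
    have e : ∀ S : Finset ι, (√(1/3:ℝ)) ^ (#S) * (√(1/3:ℝ)) ^ (#S) = (1/3 : ℝ) ^ (#S) := by
      intro S; rw [← mul_pow, ← sq, hρ]
    simp only [← mul_assoc, e, mul_pow] at this
    have e2 : ∀ S : Finset ι, ((√(1/3:ℝ)) ^ (#S)) ^ 2 = (1/3 : ℝ) ^ (#S) := by
      intro S; rw [sq, e]
    simp only [e2] at this
    exact this
  have h3 : W ^ 2 ≤ (inf f i / 4) * 𝔼 x, D x * P x ^ 2 := by
    have := Finset.expect_mul_sq_le_sq_mul_sq Finset.univ h (fun x => D x * P x)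
    rw [hhsq] at this
    simp only [← mul_assoc, ← hhD, mul_pow, hDD] at this
    rw [← h1] at this
    exact this
  have h4 : (𝔼 x, D x * P x ^ 2) ^ 2 ≤ inf f i * W ^ 2 := by
    have := Finset.expect_mul_sq_le_sq_mul_sq Finset.univ D (fun x => P x ^ 2)
    simp only [hDD, ← pow_mul] at this
    refine this.trans (mul_le_mul_of_nonneg_left h2 hp0)
  have h5 : 0 ≤ 𝔼 x, D x * P x ^ 2 := Finset.expect_nonneg fun x _ => by
    have : 0 ≤ D x := abs_nonneg _
    positivity
  have h6 : (W ^ 2) ^ 2 ≤ (inf f i ^ 3 / 16) * W ^ 2 := by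
    calc (W ^ 2) ^ 2 ≤ ((inf f i / 4) * 𝔼 x, D x * P x ^ 2) ^ 2 := by
          apply pow_le_pow_left₀ (by positivity) h3
      _ = (inf f i / 4) ^ 2 * (𝔼 x, D x * P x ^ 2) ^ 2 := by ring
      _ ≤ (inf f i / 4) ^ 2 * (inf f i * W ^ 2) := by gcongr
      _ = _ := by ring
  rcases eq_or_lt_of_le hW0 with h0 | h0
  · rw [← h0]; have : 0 ≤ inf f i ^ 3 := by positivity
    linarith
  · have : 0 < W ^ 2 := by positivity
    rw [sq (W ^ 2)] at h6
    exact le_of_mul_le_mul_right h6 this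

lemma sum_ite_card (w : Finset ι → ℝ) (c : Finset ι → ℝ) :
    ∑ i, ∑ S, w S * (if i ∈ S then c S else 0) ^ 2 = ∑ S, (#S : ℝ) * (w S * c S ^ 2) := by
  rw [Finset.sum_comm]
  refine Finset.sum_congr rfl fun S _ => ?_
  have : ∀ i, w S * (if i ∈ S then c S else 0) ^ 2 = if i ∈ S then w S * c S ^ 2 else 0 := by
    intro i; split_ifs <;> simp
  simp only [this]
  simp

/-- KKL for functions all of whose influences are at most I / M. -/
lemma kkl (k M : ℕ) (hk : 1 ≤ k) (hM : k ^ 3 * 9 ^ k ≤ M) (f : (ι → Bool) → ℝ)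
    (hf : ∀ x, f x = 0 ∨ f x = 1) (hinf : ∀ i, (M : ℝ) * inf f i ≤ ∑ j, inf f j) :
    (k : ℝ) / 2 * (𝔼 x, 𝔼 y, |f x - f y|) ≤ ∑ i, inf f i := by
  set I := ∑ i, inf f i with hI
  have hI0 : 0 ≤ I := Finset.sum_nonneg fun i _ => inf_nonneg f i
  have hk0 : (0:ℝ) < k := by exact_mod_cast hk
  set v := (𝔼 x, f x ^ 2) - (𝔼 x, f x) ^ 2 with hv
  have hvar : 𝔼 x, 𝔼 y, |f x - f y| = 2 * v := by
    have : ∀ x y, |f x - f y| = f x ^ 2 + f y ^ 2 - (2 * f x) * f y := by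
      intro x y; rw [abs_eq_sq f hf]; ring
    simp only [this, Finset.expect_sub_distrib, Finset.expect_add_distrib, ← Finset.mul_expect,
      ← Finset.expect_mul, Fintype.expect_const]
    rw [hv]; ring
  rw [hvar]
  have hvv : v = ∑ S ∈ Finset.univ.erase ∅, ft f S ^ 2 := by
    rw [hv, expect_sq, ← Finset.add_sum_erase _ _ (Finset.mem_univ (∅ : Finset ι))]
    simp [ft, chi]
  have hff : ∀ x, f x ^ 2 = f x := fun x => by rcases hf x with h | h <;> simp [h]
  have hv1 : v ≤ 1 / 4 := by
    rw [hv]; simp only [hff]; nlinarith [sq_nonneg ((𝔼 x, f x) - 1/2)]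
  by_cases hIk : (k : ℝ) ≤ I
  · nlinarith
  push Not at hIk
  have hMpos : (0:ℝ) < M := by
    have : 0 < k ^ 3 * 9 ^ k := by positivity
    exact_mod_cast lt_of_lt_of_le this hM
  have hM' : (k:ℝ) ^ 3 * 9 ^ k ≤ M := by exact_mod_cast hM
  have hWi : ∀ i, ∑ S, (1 / 3 : ℝ) ^ (#S) * (if i ∈ S then ft f S else 0) ^ 2
      ≤ inf f i / (4 * k * 3 ^ k) := by
    intro i
    have h1 := W_bound f hf i
    have hp := inf_nonneg f i
    have h2 : inf f i * (k ^ 2 * 9 ^ k) ≤ 1 := by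
      have h3 := hinf i
      have : inf f i * (k ^ 3 * 9 ^ k) ≤ k := by nlinarith
      have e : inf f i * (k ^ 3 * 9 ^ k) = (inf f i * (k ^ 2 * 9 ^ k)) * k := by ring
      rw [e] at this
      by_contra hcon
      push Not at hcon
      nlinarith
    refine abs_le_of_sq_le_sq' (h1.trans ?_) (by positivity) |>.2
    rw [div_pow, show (4 * (k:ℝ) * 3 ^ k) ^ 2 = 16 * (k ^ 2 * 9 ^ k) by
      rw [show (9:ℝ) = 3 ^ 2 by norm_num, ← pow_mul, mul_comm 2 k, pow_mul]; ring]
    rw [div_le_div_iff₀ (by norm_num) (by positivity)]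
    have : inf f i ^ 2 * (inf f i * (k ^ 2 * 9 ^ k)) ≤ inf f i ^ 2 * 1 := by gcongr
    nlinarith
  have hsumW : ∑ S, (#S : ℝ) * ((1 / 3 : ℝ) ^ (#S) * ft f S ^ 2) ≤ I / (4 * k * 3 ^ k) := by
    rw [← sum_ite_card, hI, Finset.sum_div]
    exact Finset.sum_le_sum fun i _ => hWi i
  have hsumI : ∑ S, (#S : ℝ) * (1 * ft f S ^ 2) = I / 4 := by
    rw [← sum_ite_card, hI, Finset.sum_div]
    refine Finset.sum_congr rfl fun i _ => ?_
    rw [← inf_eq f hf]; simp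
  have hfin : v ≤ 3 ^ k * (I / (4 * k * 3 ^ k)) + (1 / k) * (I / 4) := by
    calc v ≤ ∑ S ∈ Finset.univ.erase ∅, (3 ^ k * ((#S : ℝ) * ((1 / 3 : ℝ) ^ (#S) * ft f S ^ 2))
              + (1 / k) * ((#S : ℝ) * (1 * ft f S ^ 2))) := by
          rw [hvv]
          refine Finset.sum_le_sum fun S hS => ?_
          have hS1 : 1 ≤ #S := Finset.card_pos.mpr
            (Finset.nonempty_iff_ne_empty.mpr (Finset.ne_of_mem_erase hS))
          have hS1' : (1:ℝ) ≤ #S := by exact_mod_cast hS1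
          have : (1:ℝ) ≤ 3 ^ k * ((#S : ℝ) * (1 / 3 : ℝ) ^ (#S)) + (1 / k) * (#S : ℝ) := by
            rcases le_total (#S) k with h | h
            · have e : (1:ℝ) ≤ 3 ^ k * (1 / 3 : ℝ) ^ (#S) := by
                rw [one_div, inv_pow, ← div_eq_mul_inv, one_le_div (by positivity)]
                exact pow_le_pow_right₀ (by norm_num) h
              have e2 : 0 ≤ (1 / (k:ℝ)) * (#S : ℝ) := by positivity
              nlinarith
            · have e : (1:ℝ) ≤ (1 / (k:ℝ)) * (#S : ℝ) := by
                rw [one_div, inv_mul_eq_div, one_le_div hk0]; exact_mod_cast h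
              have e2 : (0:ℝ) ≤ 3 ^ k * ((#S : ℝ) * (1 / 3 : ℝ) ^ (#S)) := by positivity
              linarith
          have := mul_le_mul_of_nonneg_right this (sq_nonneg (ft f S))
          linarith
      _ ≤ ∑ S, (3 ^ k * ((#S : ℝ) * ((1 / 3 : ℝ) ^ (#S) * ft f S ^ 2))
              + (1 / k) * ((#S : ℝ) * (1 * ft f S ^ 2))) :=
          Finset.sum_le_sum_of_subset_of_nonneg (Finset.erase_subset _ _)
            (fun _ _ _ => by positivity)
      _ ≤ _ := by
          rw [Finset.sum_add_distrib, ← Finset.mul_sum, ← Finset.mul_sum, hsumI]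
          gcongr
  have e : 3 ^ k * (I / (4 * k * 3 ^ k)) + (1 / k) * (I / 4) = I / (2 * k) := by
    field_simp; ring
  rw [e] at hfin
  rw [le_div_iff₀ (by positivity)] at hfin
  linarith

/-- cut decomposition -/
lemma integral_cut (a b : ℝ) :
    MeasureTheory.Integrable (fun t : ℝ => |(if t < a then (1:ℝ) else 0) - (if t < b then 1 else 0)|)
      ∧ ∫ t : ℝ, |(if t < a then (1:ℝ) else 0) - (if t < b then 1 else 0)| = |a - b| := by
  have : (fun t : ℝ => |(if t < a then (1:ℝ) else 0) - (if t < b then 1 else 0)|)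
      = Set.indicator (Set.Ico (min a b) (max a b)) (fun _ => (1:ℝ)) := by
    funext t
    simp only [Set.indicator, Set.mem_Ico, min_le_iff, lt_max_iff]
    by_cases h1 : t < a <;> by_cases h2 : t < b <;> simp [h1, h2]
  rw [this]
  constructor
  · rw [MeasureTheory.integrable_indicator_iff measurableSet_Ico]
    exact MeasureTheory.integrableOn_const (by simp)
  · rw [MeasureTheory.integral_indicator measurableSet_Ico]
    simp [max_sub_min_eq_abs']
end KV


open Finset
open scoped BigOperators
set_option linter.unusedSectionVars false
namespace KV

lemma pow_step (a b : ℝ) (n : ℕ) (ha : 0 ≤ a) (hb : 0 ≤ b) (hab : 1 ≤ a + b) (ha1 : a ≤ 1)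
    (hb1 : b ≤ 1) : a ^ (n+2) + b ^ (n+2) + (1 - a) * (1 - b) ≤ 1 + (a + b - 1) ^ (n+2) := by
  induction n with
  | zero =>
    have h1 := mul_nonneg (sub_nonneg.2 ha1) (sub_nonneg.2 hb1)
    have e : 1 + (a + b - 1) ^ (0+2) = a ^ (0+2) + b ^ (0+2) + 2 * ((1 - a) * (1 - b)) := by ring
    rw [e]; linarith
  | succ n ih =>
    have h1 : (a + b - 1) ^ (n+2) ≤ a ^ (n+2) := pow_le_pow_left₀ (by linarith) (by linarith) _
    have h2 : (a + b - 1) ^ (n+2) ≤ b ^ (n+2) := pow_le_pow_left₀ (by linarith) (by linarith) _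
    have e : ∀ u : ℝ, u ^ (n + 1 + 2) = u ^ (n+2) - (1 - u) * u ^ (n+2) := by intro u; ring
    rw [e a, e b, e (a + b - 1)]
    nlinarith [mul_le_mul_of_nonneg_left h1 (sub_nonneg.2 ha1),
      mul_le_mul_of_nonneg_left h2 (sub_nonneg.2 hb1)]

lemma pow_tri (a b c : ℝ) (ha : 0 ≤ a) (hb : 0 ≤ b) (ha1 : a ≤ 1) (hb1 : b ≤ 1)
    (hc : a + b - 1 ≤ c) : a ^ 40 + b ^ 40 + (1 - a) * (1 - b) ≤ 1 + c ^ 40 := by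
  by_cases h : 1 ≤ a + b
  · have h1 : a ^ 40 + b ^ 40 + (1 - a) * (1 - b) ≤ 1 + (a + b - 1) ^ 40 :=
      pow_step a b 38 ha hb h ha1 hb1
    have h2 : (a + b - 1) ^ 40 ≤ c ^ 40 := pow_le_pow_left₀ (by linarith) hc _
    exact h1.trans (by gcongr)
  · push Not at h
    have h0 : 0 ≤ c ^ 40 := by positivity
    have h1 : a ^ 40 ≤ a := by
      calc a ^ 40 ≤ a ^ 1 := pow_le_pow_of_le_one ha ha1 (by norm_num)
        _ = a := pow_one a
    have h2 : b ^ 40 ≤ b * b := by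
      calc b ^ 40 ≤ b ^ 2 := pow_le_pow_of_le_one hb hb1 (by norm_num)
        _ = b * b := sq b
    nlinarith

lemma pow_lip (b c α : ℝ) (hb : |b| ≤ 1) (hα : |b - c| ≤ α) :
    b ^ 40 ≤ c ^ 40 + 40 * α * b ^ 38 := by
  have hα0 : 0 ≤ α := (abs_nonneg _).trans hα
  by_cases h : |b| ≤ |c|
  · have h1 : b ^ 40 ≤ c ^ 40 := by
      rw [← Even.pow_abs (by decide : Even 40) b, ← Even.pow_abs (by decide : Even 40) c]
      exact pow_le_pow_left₀ (abs_nonneg _) h _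
    have : 0 ≤ 40 * α * b ^ 38 := by
      have : 0 ≤ b ^ 38 := Even.pow_nonneg (by decide) b
      positivity
    linarith
  · push Not at h
    have h1 := abs_pow_sub_pow_le b c 40
    rw [max_eq_left h.le] at h1
    have h2 := (le_abs_self _).trans h1
    have h3 : |b| ^ 39 ≤ b ^ 38 := by
      rw [← Even.pow_abs (by decide : Even 38) b]
      exact pow_le_pow_of_le_one (abs_nonneg _) hb (by norm_num)
    have h4 : |b - c| * 40 * |b| ^ 39 ≤ α * 40 * b ^ 38 := by
      gcongr
    have h5 : b ^ 40 - c ^ 40 ≤ |b - c| * 40 * |b| ^ 39 := by exact_mod_cast h2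
    linarith

lemma tail_bound {γ : Type*} (s : Finset γ) (q : γ → ℝ) (a κ δ : ℝ) (hq : ∀ g ∈ s, 0 ≤ q g)
    (ha0 : 0 ≤ a) (ha1 : a ≤ 1) (hqa : ∀ g ∈ s, q g ≤ a ^ 2) (hs : ∑ g ∈ s, q g ≤ 1 + κ - a ^ 2)
    (hκ0 : 0 ≤ κ) (hκ : κ ≤ 1 / 5) (hδ : (3 * κ) ^ 19 ≤ δ) :
    ∑ g ∈ s, q g ^ 19 ≤ (1 - a) ^ 2 / 80 + δ := by
  have hqB : ∀ g ∈ s, q g ≤ 1 + κ - a ^ 2 := fun g hg =>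
    (Finset.single_le_sum hq hg).trans hs
  have hB : 1 + κ - a ^ 2 ≤ 2 * (1 - a) + κ := by nlinarith
  have hδ0 : 0 ≤ δ := le_trans (by positivity) hδ
  by_cases h : κ ≤ 1 - a
  · have h1 : ∀ g ∈ s, q g ^ 19 ≤ q g * (3 * (1 - a) * (3/5) ^ 17) := by
      intro g hg
      have e1 : q g ≤ 3 / 5 := by have := hqa g hg; have := hqB g hg; linarith
      have e2 : q g ≤ 3 * (1 - a) := by have := hqB g hg; linarith
      have e3 := hq g hg
      calc q g ^ 19 = q g * (q g * q g ^ 17) := by ring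
        _ ≤ _ := by gcongr
    have h0 : 0 ≤ 1 - a := by linarith
    calc ∑ g ∈ s, q g ^ 19 ≤ ∑ g ∈ s, q g * (3 * (1 - a) * (3/5) ^ 17) := Finset.sum_le_sum h1
      _ = (∑ g ∈ s, q g) * (3 * (1 - a) * (3/5) ^ 17) := by rw [Finset.sum_mul]
      _ ≤ (3 * (1 - a)) * (3 * (1 - a) * (3/5) ^ 17) := by
          gcongr; linarith
      _ = (1 - a) ^ 2 * (9 * (3/5) ^ 17) := by ring
      _ ≤ (1 - a) ^ 2 * (1 / 80) := by gcongr; norm_num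
      _ ≤ _ := by linarith
  · push Not at h
    have h1 : ∀ g ∈ s, q g ^ 19 ≤ q g * (3 * κ) ^ 18 := by
      intro g hg
      have e2 : q g ≤ 3 * κ := by have := hqB g hg; linarith
      have e3 := hq g hg
      calc q g ^ 19 = q g * (q g ^ 18) := by ring
        _ ≤ _ := by gcongr
    calc ∑ g ∈ s, q g ^ 19 ≤ ∑ g ∈ s, q g * (3 * κ) ^ 18 := Finset.sum_le_sum h1
      _ = (∑ g ∈ s, q g) * (3 * κ) ^ 18 := by rw [Finset.sum_mul]
      _ ≤ (3 * κ) * (3 * κ) ^ 18 := by gcongr; linarith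
      _ = (3 * κ) ^ 19 := by ring
      _ ≤ δ := hδ
      _ ≤ _ := by have := sq_nonneg (1 - a); linarith

variable {M R : ℕ} [NeZero M] [NeZero R]

abbrev Om (M R : ℕ) := (ZMod M × Fin R) → Bool

def sh (g : ZMod M) (x : Om M R) : Om M R := fun p => x (p.1 + g, p.2)

def ng (x : Om M R) : Om M R := fun p => !(x p)

lemma sh_sh (g h : ZMod M) (x : Om M R) : sh g (sh h x) = sh (g + h) x := by
  funext p; simp [sh, add_assoc]

lemma sh_zero (x : Om M R) : sh 0 x = x := by funext p; simp [sh]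

lemma sh_ng (g : ZMod M) (x : Om M R) : sh g (ng x) = ng (sh g x) := rfl

noncomputable def ip (x y : Om M R) : ℝ := 𝔼 p, sg (x p) * sg (y p)

lemma ip_comm (x y : Om M R) : ip x y = ip y x := by
  refine Finset.expect_congr rfl fun p _ => mul_comm _ _

lemma ip_self (x : Om M R) : ip x x = 1 := by
  simp [ip, sg_mul_self]

lemma ip_sh (g : ZMod M) (x y : Om M R) : ip (sh g x) (sh g y) = ip x y := by
  refine Fintype.expect_equiv ((Equiv.addRight g).prodCongr (Equiv.refl _)) _ _ fun p => ?_
  simp [sh, Prod.map]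

lemma ip_sh_left (g : ZMod M) (x y : Om M R) : ip (sh g x) y = ip x (sh (-g) y) := by
  rw [← ip_sh (-g), sh_sh]; simp [sh_zero]

lemma ip_ng (x y : Om M R) : ip (ng x) y = - ip x y := by
  simp [ip, ng, sg_not, ← Finset.expect_neg_distrib]

lemma ip_ng' (x y : Om M R) : ip x (ng y) = - ip x y := by
  rw [ip_comm, ip_ng, ip_comm]

lemma abs_ip_le (x y : Om M R) : |ip x y| ≤ 1 := by
  refine (Finset.abs_expect_le _ _).trans ?_
  refine Finset.expect_le Finset.univ_nonempty fun p _ => ?_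
  rw [abs_mul, abs_sg, abs_sg]; norm_num

lemma ip_diff (x y w : Om M R) : |ip y w - ip x w| ≤ 1 - ip x y := by
  have h1 : ip y w - ip x w = 𝔼 p, (sg (y p) - sg (x p)) * sg (w p) := by
    rw [ip, ip, ← Finset.expect_sub_distrib]
    refine Finset.expect_congr rfl fun p _ => by ring
  have h2 : 1 - ip x y = 𝔼 p, (1 - sg (x p) * sg (y p)) := by
    rw [Finset.expect_sub_distrib, Fintype.expect_const, ip]
  rw [h1, h2]
  refine (Finset.abs_expect_le _ _).trans (Finset.expect_le_expect fun p _ => ?_)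
  rw [abs_mul, abs_sg, mul_one]
  cases x p <;> cases y p <;> norm_num [sg]

noncomputable def K (x y : Om M R) : ℝ := ∑ g : ZMod M, ip x (sh g y) ^ 40

lemma K_comm (x y : Om M R) : K x y = K y x := by
  refine Fintype.sum_equiv (Equiv.neg _) _ _ fun g => ?_
  rw [ip_comm, ip_sh_left]; simp

lemma K_sh (h : ZMod M) (x y : Om M R) : K (sh h x) y = K x y := by
  refine Fintype.sum_equiv (Equiv.addLeft (-h)) _ _ fun g => ?_
  rw [ip_sh_left, sh_sh]; simp

lemma K_ng (x y : Om M R) : K (ng x) y = K x y := by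
  refine Finset.sum_congr rfl fun g _ => ?_
  rw [ip_ng, Even.neg_pow (by decide)]

lemma K_split (x y : Om M R) :
    K x y = ip x y ^ 40 + ∑ g ∈ Finset.univ.erase (0 : ZMod M), ip x (sh g y) ^ 40 := by
  rw [K, ← Finset.add_sum_erase _ _ (Finset.mem_univ (0 : ZMod M)), sh_zero]

lemma K_ge (x y : Om M R) : ip x y ^ 40 ≤ K x y := by
  rw [K_split]
  have : 0 ≤ ∑ g ∈ Finset.univ.erase (0 : ZMod M), ip x (sh g y) ^ 40 :=
    Finset.sum_nonneg fun _ _ => Even.pow_nonneg (by decide) _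
  linarith

lemma K_self_ge (x : Om M R) : 1 ≤ K x x := by
  have := K_ge x x
  rw [ip_self] at this; simpa using this

def Good (ε : ℝ) (x : Om M R) : Prop := ∀ g : ZMod M, g ≠ 0 → |ip x (sh g x)| ≤ ε

lemma Good.sh {ε : ℝ} {x : Om M R} (hx : Good ε x) (h : ZMod M) : Good ε (sh h x) := by
  intro g hg
  rw [sh_sh, add_comm, ← sh_sh, ip_sh]; exact hx g hg

lemma Good.ng {ε : ℝ} {x : Om M R} (hx : Good ε x) : Good ε (ng x) := by
  intro g hg
  rw [sh_ng, ip_ng, ip_ng', neg_neg]; exact hx g hg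

lemma bessel {ε : ℝ} (hε : 0 ≤ ε) (x y : Om M R) (hy : Good ε y) :
    ∑ g, ip x (sh g y) ^ 2 ≤ 1 + M * ε := by
  set a : ZMod M → ℝ := fun g => ip x (sh g y) with ha
  set A := ∑ g, a g ^ 2 with hA
  have hA0 : 0 ≤ A := Finset.sum_nonneg fun _ _ => sq_nonneg _
  have h1 : A = 𝔼 p, sg (x p) * ∑ g, a g * sg (sh g y p) := by
    simp only [Finset.mul_sum]
    rw [Finset.expect_sum_comm]
    refine Finset.sum_congr rfl fun g _ => ?_
    rw [sq]
    conv_lhs => rw [ha]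
    simp only []
    conv_lhs => rw [ip]
    rw [Finset.expect_mul]
    refine Finset.expect_congr rfl fun p _ => by simp only [ha, ip]; ring
  have h2 : A ^ 2 ≤ 𝔼 p, (∑ g, a g * sg (sh g y p)) ^ 2 := by
    have := Finset.expect_mul_sq_le_sq_mul_sq Finset.univ (fun p => sg (x p))
      (fun p => ∑ g, a g * sg (sh g y p))
    rw [← h1] at this
    simpa [sq, sg_mul_self] using this
  have h3 : 𝔼 p, (∑ g, a g * sg (sh g y p)) ^ 2
      = ∑ g, ∑ h, a g * a h * ip (sh g y) (sh h y) := by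
    simp only [sq, Finset.sum_mul_sum]
    rw [Finset.expect_sum_comm]
    refine Finset.sum_congr rfl fun g _ => ?_
    rw [Finset.expect_sum_comm]
    refine Finset.sum_congr rfl fun h _ => ?_
    rw [ip, Finset.mul_expect]
    refine Finset.expect_congr rfl fun p _ => by ring
  have h4 : ∑ g, ∑ h, a g * a h * ip (sh g y) (sh h y) ≤
      ∑ g, ∑ h, ((if g = h then a g ^ 2 else 0) + ε * (|a g| * |a h|)) := by
    refine Finset.sum_le_sum fun g _ => Finset.sum_le_sum fun h _ => ?_
    split_ifs with e
    · subst e; rw [ip_self]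
      have : 0 ≤ ε * (|a g| * |a g|) := by positivity
      nlinarith
    · have : |ip (sh g y) (sh h y)| ≤ ε := by
        have := hy (h - g) (sub_ne_zero.2 (Ne.symm e))
        rw [ip_sh_left, sh_sh]
        simpa [sub_eq_add_neg, add_comm] using this
      calc a g * a h * ip (sh g y) (sh h y) ≤ |a g * a h * ip (sh g y) (sh h y)| := le_abs_self _
        _ = |ip (sh g y) (sh h y)| * (|a g| * |a h|) := by rw [abs_mul, abs_mul]; ring
        _ ≤ ε * (|a g| * |a h|) := by gcongr
        _ = _ := by ring
  have h5 : ∑ g, ∑ h, ((if g = h then a g ^ 2 else 0) + ε * (|a g| * |a h|))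
      = A + ε * (∑ g, |a g|) ^ 2 := by
    simp only [Finset.sum_add_distrib, ← Finset.mul_sum]
    simp [← Finset.sum_mul, sq]
    simp [A, sq]
  have h6 : (∑ g, |a g|) ^ 2 ≤ M * A := by
    have := sq_sum_le_card_mul_sum_sq (s := (Finset.univ : Finset (ZMod M))) (f := fun g => |a g|)
    simpa [ZMod.card] using this
  have h7 : A * A ≤ A * (1 + M * ε) := by
    have := mul_le_mul_of_nonneg_left h6 hε
    nlinarith
  rcases eq_or_lt_of_le hA0 with h0 | h0
  · rw [← h0]; positivity
  · exact le_of_mul_le_mul_left h7 h0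

lemma tailK {ε δ : ℝ} (hε : 0 ≤ ε) (hκ : M * ε ≤ 1 / 5) (hδ : (3 * (M * ε)) ^ 19 ≤ δ)
    (x y : Om M R) (hy : Good ε y) (h : ∀ g, |ip x (sh g y)| ≤ ip x y) :
    ∑ g ∈ Finset.univ.erase (0 : ZMod M), ip x (sh g y) ^ 38 ≤ (1 - ip x y) ^ 2 / 80 + δ := by
  have h0 : 0 ≤ ip x y := (abs_nonneg _).trans (h 0)
  have hb := bessel hε x y hy
  rw [← Finset.add_sum_erase _ _ (Finset.mem_univ (0 : ZMod M)), sh_zero] at hb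
  have := tail_bound (Finset.univ.erase (0 : ZMod M)) (fun g => ip x (sh g y) ^ 2) (ip x y)
    (M * ε) δ (fun _ _ => sq_nonneg _) h0 ((le_abs_self _).trans (abs_ip_le x y))
    (fun g _ => by rw [← sq_abs]; exact pow_le_pow_left₀ (abs_nonneg _) (h g) 2)
    (by linarith) (by positivity) hκ hδ
  simpa only [← pow_mul] using this

lemma tri_core {ε δ : ℝ} (hε : 0 ≤ ε) (hκ : M * ε ≤ 1 / 5) (hδ : (3 * (M * ε)) ^ 19 ≤ δ)
    (x y z : Om M R) (hy : Good ε y) (hz : Good ε z)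
    (hxy : ∀ g, |ip x (sh g y)| ≤ ip x y) (hyz : ∀ g, |ip y (sh g z)| ≤ ip y z)
    (hab : ip y z ≤ ip x y) : K x y + K y z ≤ 1 + K x z + 41 * δ := by
  have hδ0 : 0 ≤ δ := le_trans (by positivity) hδ
  have ha0 : 0 ≤ ip x y := (abs_nonneg _).trans (hxy 0)
  have hb0 : 0 ≤ ip y z := (abs_nonneg _).trans (hyz 0)
  have ha1 := (le_abs_self _).trans (abs_ip_le x y)
  have hb1 := (le_abs_self _).trans (abs_ip_le y z)
  have h1 := tailK hε hκ hδ x y hy hxy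
  have h2 := tailK hε hκ hδ y z hz hyz
  have h3 := pow_tri (ip x y) (ip y z) (ip x z) ha0 hb0 ha1 hb1
    (by have := (le_abs_self _).trans (ip_diff x y z); linarith)
  have h4 : ∑ g ∈ Finset.univ.erase (0 : ZMod M), ip x (sh g y) ^ 40
      ≤ ∑ g ∈ Finset.univ.erase (0 : ZMod M), ip x (sh g y) ^ 38 := by
    refine Finset.sum_le_sum fun g _ => ?_
    rw [← Even.pow_abs (by decide : Even 40), ← Even.pow_abs (by decide : Even 38)]
    exact pow_le_pow_of_le_one (abs_nonneg _) (abs_ip_le _ _) (by norm_num)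
  have h5 : ∑ g ∈ Finset.univ.erase (0 : ZMod M), ip y (sh g z) ^ 40
      ≤ ∑ g ∈ Finset.univ.erase (0 : ZMod M), ip x (sh g z) ^ 40
        + 40 * (1 - ip x y) * ∑ g ∈ Finset.univ.erase (0 : ZMod M), ip y (sh g z) ^ 38 := by
    rw [Finset.mul_sum, ← Finset.sum_add_distrib]
    refine Finset.sum_le_sum fun g _ => ?_
    exact pow_lip _ _ _ (abs_ip_le _ _) (ip_diff x y _)
  rw [K_split x y, K_split y z, K_split x z]
  set α := 1 - ip x y
  set β := 1 - ip y z
  have hα : 0 ≤ α := by simp only [α]; linarith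
  have hα1 : α ≤ 1 := by simp only [α]; linarith
  have hβ1 : β ≤ 1 := by simp only [β]; linarith
  have hαβ : α ≤ β := by simp only [α, β]; linarith
  have h6 := mul_le_mul_of_nonneg_left h2 (by positivity : 0 ≤ 40 * α)
  have h7 : α * δ ≤ δ := by nlinarith
  have h8 : α ^ 2 ≤ α * β := by nlinarith
  have h9 : α * β ^ 2 ≤ α * β := by
    have : β ^ 2 ≤ β := by nlinarith
    exact mul_le_mul_of_nonneg_left this hα
  have h10 : 0 ≤ α * β := by nlinarith
  nlinarith

lemma align (x y : Om M R) : ∃ x' : Om M R, (∀ z, K x' z = K x z) ∧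
    (∀ ε, Good ε x → Good ε x') ∧ ∀ g, |ip x' (sh g y)| ≤ ip x' y := by
  obtain ⟨g0, -, hg0⟩ := Finset.exists_max_image (Finset.univ : Finset (ZMod M))
    (fun g => |ip x (sh g y)|) Finset.univ_nonempty
  have key : ∀ g, |ip (sh (-g0) x) (sh g y)| ≤ |ip (sh (-g0) x) y| := by
    intro g
    rw [ip_sh_left, ip_sh_left, sh_sh]
    simpa using hg0 (g0 + g) (Finset.mem_univ _)
  rcases le_total 0 (ip (sh (-g0) x) y) with h | h
  · refine ⟨sh (-g0) x, fun z => K_sh _ _ _, fun ε hx => hx.sh _, fun g => ?_⟩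
    rw [← abs_of_nonneg h]; exact key g
  · refine ⟨ng (sh (-g0) x), fun z => by rw [K_ng, K_sh], fun ε hx => (hx.sh _).ng, fun g => ?_⟩
    rw [ip_ng, ip_ng, abs_neg, ← abs_of_nonpos h]; exact key g

lemma tri {ε δ : ℝ} (hε : 0 ≤ ε) (hκ : M * ε ≤ 1 / 5) (hδ : (3 * (M * ε)) ^ 19 ≤ δ)
    (x y z : Om M R) (hx : Good ε x) (hy : Good ε y) (hz : Good ε z) :
    K x y + K y z ≤ 1 + K x z + 41 * δ := by
  obtain ⟨x', hx1, hx2, hx3⟩ := align x y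
  obtain ⟨z', hz1, hz2, hz3⟩ := align z y
  have sw : ∀ u : Om M R, (∀ g, |ip u (sh g y)| ≤ ip u y) → ∀ g, |ip y (sh g u)| ≤ ip y u := by
    intro u hu g
    rw [ip_comm, ip_sh_left, ip_comm y u]; exact hu _
  have e1 : K x y = K x' y := (hx1 y).symm
  have e2 : K y z = K y z' := by rw [K_comm, ← hz1, K_comm]
  have e3 : K x z = K x' z' := by rw [← hx1, K_comm, ← hz1, K_comm]
  rw [e1, e2, e3]
  rcases le_total (ip y z') (ip x' y) with h | h
  · exact tri_core hε hκ hδ x' y z' hy (hz2 _ hz) hx3 (sw z' hz3) h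
  · have := tri_core hε hκ hδ z' y x' hy (hx2 _ hx) hz3 (sw x' hx3)
      (by rw [ip_comm y x', ip_comm z' y]; exact h)
    rw [K_comm z' y, K_comm y x', K_comm z' x'] at this
    linarith

lemma K_self_le {ε δ : ℝ} (hε : 0 ≤ ε) (hκ : M * ε ≤ 1 / 5) (hδ : (3 * (M * ε)) ^ 19 ≤ δ)
    (x : Om M R) (hx : Good ε x) : K x x ≤ 1 + δ := by
  have h1 := tailK hε hκ hδ x x hx (fun g => by rw [ip_self]; exact abs_ip_le _ _)
  have h4 : ∑ g ∈ Finset.univ.erase (0 : ZMod M), ip x (sh g x) ^ 40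
      ≤ ∑ g ∈ Finset.univ.erase (0 : ZMod M), ip x (sh g x) ^ 38 := by
    refine Finset.sum_le_sum fun g _ => ?_
    rw [← Even.pow_abs (by decide : Even 40), ← Even.pow_abs (by decide : Even 38)]
    exact pow_le_pow_of_le_one (abs_nonneg _) (abs_ip_le _ _) (by norm_num)
  rw [K_split, ip_self, one_pow]
  rw [ip_self] at h1
  have h2 : (1 - 1 : ℝ) ^ 2 / 80 = 0 := by norm_num
  rw [h2] at h1
  linarith
end KV


open Finset
open scoped BigOperators
set_option linter.unusedSectionVars false
namespace KV
variable {M R : ℕ} [NeZero M] [NeZero R]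

lemma card_idx : (Fintype.card (ZMod M × Fin R) : ℝ) = M * R := by
  simp [ZMod.card]

lemma MR_pos : (0:ℝ) < M * R := by
  have h1 : (0:ℝ) < M := by exact_mod_cast Nat.pos_of_ne_zero (NeZero.ne M)
  have h2 : (0:ℝ) < R := by exact_mod_cast Nat.pos_of_ne_zero (NeZero.ne R)
  positivity

lemma ip_eq (x y : Om M R) : ip x y = (∑ p, sg (x p) * sg (y p)) / (M * R) := by
  rw [ip, Fintype.expect_eq_sum_div_card, card_idx]

lemma moment4 (g : ZMod M) (hg : g ≠ 0) :
    𝔼 x : Om M R, ip x (sh g x) ^ 4 ≤ 324 / (M * R) ^ 2 := by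
  have hN := MR_pos (M := M) (R := R)
  set pr : ZMod M × Fin R → Finset (ZMod M × Fin R) := fun p => {p, (p.1 + g, p.2)} with hpr
  have hne : ∀ p : ZMod M × Fin R, p ≠ (p.1 + g, p.2) := by
    intro p h
    have := congrArg Prod.fst h
    simp at this
    exact hg this
  have hcard : ∀ p, #(pr p) = 2 := fun p => Finset.card_pair (hne p)
  have hchi : ∀ p (x : Om M R), chi (pr p) x = sg (x p) * sg (sh g x p) := by
    intro p x
    rw [chi, hpr, Finset.prod_pair (hne p)]; rfl
  set c : Finset (ZMod M × Fin R) → ℝ := fun S => ∑ p, if pr p = S then 1 else 0 with hc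
  have hρ : (√(1/3:ℝ)) ^ 2 = 1 / 3 := Real.sq_sqrt (by norm_num)
  have h1 := hyper (√(1/3:ℝ)) hρ c
  have h2 : ∀ x : Om M R, ∑ S, (√(1/3:ℝ)) ^ (#S) * c S * chi S x = (M * R) / 3 * ip x (sh g x) := by
    intro x
    rw [ip_eq]
    have : ∀ S, (√(1/3:ℝ)) ^ (#S) * c S * chi S x
        = ∑ p, if pr p = S then (√(1/3:ℝ)) ^ (#S) * chi S x else 0 := by
      intro S
      rw [hc]; simp only [Finset.mul_sum, Finset.sum_mul]
      refine Finset.sum_congr rfl fun p _ => ?_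
      split_ifs <;> simp
    simp only [this]
    rw [Finset.sum_comm]
    simp only [Finset.sum_ite_eq, Finset.mem_univ, if_true, hcard, hρ, hchi]
    rw [← Finset.mul_sum, div_mul_div_comm, mul_comm (3:ℝ), mul_div_mul_left _ _ hN.ne']; ring
  have hc0 : ∀ S, 0 ≤ c S := fun S => Finset.sum_nonneg fun p _ => by split_ifs <;> norm_num
  have hc2 : ∀ S, c S ≤ 2 := by
    intro S
    have : c S = #(Finset.univ.filter fun p => pr p = S) := by simp [hc]
    rw [this]
    rcases Finset.eq_empty_or_nonempty (Finset.univ.filter fun p => pr p = S) with h | ⟨p, hp⟩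
    · rw [h]; simp
    · have hp' : pr p = S := by simpa using hp
      have hS : #S = 2 := by rw [← hp', hcard]
      have : (Finset.univ.filter fun p => pr p = S) ⊆ S := by
        intro q hq
        have hq' : pr q = S := by simpa using hq
        rw [← hq']; simp [hpr]
      have := Finset.card_le_card this
      rw [hS] at this
      exact_mod_cast this
  have hcs : ∑ S, c S = M * R := by
    rw [hc, Finset.sum_comm]
    simp [ZMod.card]
  have h3 : ∑ S, c S ^ 2 ≤ 2 * (M * R) := by
    rw [← hcs, Finset.mul_sum]
    refine Finset.sum_le_sum fun S _ => ?_
    nlinarith [hc0 S, hc2 S]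
  simp only [h2, mul_pow] at h1
  rw [← Finset.mul_expect] at h1
  have h4 : (∑ S, c S ^ 2) ^ 2 ≤ (2 * (M * R)) ^ 2 :=
    pow_le_pow_left₀ (Finset.sum_nonneg fun _ _ => sq_nonneg _) h3 2
  have h5 := h1.trans h4
  rw [le_div_iff₀ (by positivity)]
  have e : ((M * R : ℝ) / 3) ^ 4 * (𝔼 x : Om M R, ip x (sh g x) ^ 4)
      = ((𝔼 x : Om M R, ip x (sh g x) ^ 4) * (M * R) ^ 2) * ((M * R) ^ 2 / 81) := by ring
  rw [e, show (2 * (M * R : ℝ)) ^ 2 = 324 * ((M * R) ^ 2 / 81) by ring] at h5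
  exact le_of_mul_le_mul_right h5 (by positivity)

open Classical in
noncomputable def bad (ε : ℝ) (x : Om M R) : ℝ := if Good ε x then 0 else 1

lemma bad_nonneg (ε : ℝ) (x : Om M R) : 0 ≤ bad ε x := by
  unfold bad; split_ifs <;> norm_num

lemma bad_bound {ε : ℝ} (hε : 0 < ε) (h : 324 * (M:ℝ) ≤ ε ^ 4 * (M * R)) :
    𝔼 x : Om M R, bad ε x ≤ 1 / (M * R) := by
  have hN := MR_pos (M := M) (R := R)
  have h1 : ∀ x : Om M R, bad ε x ≤
      ∑ g ∈ Finset.univ.erase (0 : ZMod M), ip x (sh g x) ^ 4 / ε ^ 4 := by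
    intro x
    unfold bad
    have hnn : ∀ g ∈ Finset.univ.erase (0 : ZMod M), 0 ≤ ip x (sh g x) ^ 4 / ε ^ 4 :=
      fun g _ => div_nonneg (Even.pow_nonneg (by decide) _) (by positivity)
    split_ifs with hx
    · exact Finset.sum_nonneg hnn
    · unfold Good at hx
      push Not at hx
      obtain ⟨g, hg, hgx⟩ := hx
      refine le_trans ?_ (Finset.single_le_sum hnn (Finset.mem_erase.2 ⟨hg, Finset.mem_univ g⟩))
      rw [one_le_div (by positivity), ← Even.pow_abs (by decide : Even 4) (ip x (sh g x))]
      exact pow_le_pow_left₀ hε.le hgx.le 4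
  calc 𝔼 x : Om M R, bad ε x
      ≤ 𝔼 x : Om M R, ∑ g ∈ Finset.univ.erase (0 : ZMod M), ip x (sh g x) ^ 4 / ε ^ 4 :=
        Finset.expect_le_expect fun x _ => h1 x
    _ = ∑ g ∈ Finset.univ.erase (0 : ZMod M), (𝔼 x : Om M R, ip x (sh g x) ^ 4) / ε ^ 4 := by
        rw [Finset.expect_sum_comm]
        refine Finset.sum_congr rfl fun g _ => by rw [Finset.expect_div]
    _ ≤ ∑ g ∈ Finset.univ.erase (0 : ZMod M), (324 / (M * R) ^ 2) / ε ^ 4 := by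
        refine Finset.sum_le_sum fun g hg => ?_
        have := moment4 (R := R) g (Finset.ne_of_mem_erase hg)
        gcongr
    _ ≤ ∑ g : ZMod M, (324 / (M * R : ℝ) ^ 2) / ε ^ 4 :=
        Finset.sum_le_sum_of_subset_of_nonneg (Finset.erase_subset _ _) fun _ _ _ => by positivity
    _ = M * ((324 / (M * R : ℝ) ^ 2) / ε ^ 4) := by simp [ZMod.card]
    _ ≤ _ := by
        rw [div_div, ← mul_div_assoc, div_le_div_iff₀ (by positivity) hN]
        nlinarith

lemma expect_ip_sq (w : Om M R) : 𝔼 x : Om M R, ip x w ^ 2 = 1 / (M * R) := by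
  have hN := MR_pos (M := M) (R := R)
  have h1 : ∀ x : Om M R, ip x w ^ 2 =
      ∑ p, ∑ q, (sg (w p) * sg (w q) / (M * R) ^ 2) * (chi {p} x * chi {q} x) := by
    intro x
    rw [ip_eq, div_pow, sq, Finset.sum_mul_sum, Finset.sum_div]
    refine Finset.sum_congr rfl fun p _ => ?_
    rw [Finset.sum_div]
    refine Finset.sum_congr rfl fun q _ => ?_
    simp [chi]; ring
  simp only [h1]
  rw [Finset.expect_sum_comm]
  simp only [Finset.expect_sum_comm, ← Finset.mul_expect, chi_orth, Finset.singleton_inj]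
  simp [sg_mul_self, ZMod.card]
  field_simp

lemma expect_K (y : Om M R) : 𝔼 x : Om M R, K x y ≤ 1 / R := by
  have hM : (0:ℝ) < M := by exact_mod_cast Nat.pos_of_ne_zero (NeZero.ne M)
  have hR : (0:ℝ) < R := by exact_mod_cast Nat.pos_of_ne_zero (NeZero.ne R)
  calc 𝔼 x : Om M R, K x y ≤ 𝔼 x : Om M R, ∑ g : ZMod M, ip x (sh g y) ^ 2 := by
        refine Finset.expect_le_expect fun x _ => Finset.sum_le_sum fun g _ => ?_
        rw [← Even.pow_abs (by decide : Even 40), ← Even.pow_abs (by decide : Even 2)]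
        exact pow_le_pow_of_le_one (abs_nonneg _) (abs_ip_le _ _) (by norm_num)
    _ = ∑ g : ZMod M, 1 / (M * R : ℝ) := by
        rw [Finset.expect_sum_comm]
        refine Finset.sum_congr rfl fun g _ => expect_ip_sq _
    _ ≤ 1 / R := by
        simp [ZMod.card]
        apply le_of_eq; field_simp

lemma ip_flip (x : Om M R) (i : ZMod M × Fin R) : ip x (flip x i) = 1 - 2 / (M * R) := by
  have hN := MR_pos (M := M) (R := R)
  have h1 : ∀ p, sg (x p) * sg (flip x i p) = 1 - if p = i then 2 else 0 := by
    intro p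
    split_ifs with h
    · subst h; simp [flip, sg_not, sg_mul_self]; norm_num
    · simp [flip, h, sg_mul_self]
  rw [ip_eq]
  simp only [h1, Finset.sum_sub_distrib]
  simp [ZMod.card]
  rw [sub_div, div_self hN.ne']

lemma K_flip (hN2 : 2 ≤ M * R) (x : Om M R) (i : ZMod M × Fin R) :
    1 - 80 / (M * R) ≤ K x (flip x i) := by
  have hN := MR_pos (M := M) (R := R)
  have hN2' : (2:ℝ) ≤ M * R := by exact_mod_cast hN2
  refine le_trans ?_ (K_ge _ _)
  rw [ip_flip]
  have : (-2:ℝ) ≤ -(2 / (M * R)) := by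
    have : 2 / (M * R : ℝ) ≤ 1 := by rw [div_le_one hN]; exact hN2'
    linarith
  have h := one_add_mul_le_pow this 40
  have e : (1:ℝ) + (40:ℕ) * (-(2 / (M * R))) = 1 - 80 / (M * R) := by push_cast; ring
  rw [e] at h
  simpa [sub_eq_add_neg] using h

lemma expect_sh (F : Om M R → ℝ) (g : ZMod M) : 𝔼 x, F (sh g x) = 𝔼 x, F x := by
  refine Fintype.expect_equiv ⟨fun x => sh g x, fun x => sh (-g) x, fun x => ?_, fun x => ?_⟩ _ _
    (fun x => rfl)
  · simp [sh_sh, sh_zero]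
  · simp [sh_sh, sh_zero]

lemma flip_sh (g : ZMod M) (x : Om M R) (p : ZMod M × Fin R) :
    flip (sh g x) p = sh g (flip x (p.1 + g, p.2)) := by
  funext q
  by_cases h : q = p
  · subst h; simp [flip, sh]
  · have : (q.1 + g, q.2) ≠ (p.1 + g, p.2) := by
      intro e; apply h
      simp at e
      exact Prod.ext e.1 e.2
    rw [flip, Function.update_of_ne h]
    simp only [sh, flip]
    rw [Function.update_of_ne this]

lemma inf_inv (f : Om M R → ℝ) (hf : ∀ g x, f (sh g x) = f x) (i : ZMod M × Fin R) :
    (M : ℝ) * inf f i ≤ ∑ j, inf f j := by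
  have h1 : ∀ g : ZMod M, inf f (i.1 + g, i.2) = inf f i := by
    intro g
    unfold inf
    rw [← expect_sh (fun x => |f x - f (flip x i)|) g]
    refine Finset.expect_congr rfl fun x _ => ?_
    rw [flip_sh, hf, hf]
  have h2 : ∑ j, inf f j = ∑ r : Fin R, ∑ g : ZMod M, inf f (g, r) := by
    rw [Fintype.sum_prod_type_right]
  rw [h2]
  have h3 : ∑ g : ZMod M, inf f (g, i.2) = M * inf f i := by
    rw [← Equiv.sum_comp (Equiv.addLeft i.1)]
    simp [h1, ZMod.card]
  rw [← h3]
  exact Finset.single_le_sum (f := fun r => ∑ g : ZMod M, inf f (g, r))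
    (fun r _ => Finset.sum_nonneg fun g _ => inf_nonneg f _) (Finset.mem_univ i.2)

lemma poincare (k : ℕ) (hk : 1 ≤ k) (hM : k ^ 3 * 9 ^ k ≤ M) (F : Om M R → ℝ)
    (hF : ∀ g x, F (sh g x) = F x) :
    (k : ℝ) / 2 * (𝔼 x, 𝔼 y, |F x - F y|) ≤ ∑ i, 𝔼 x, |F x - F (flip x i)| := by
  set f : ℝ → Om M R → ℝ := fun t x => if t < F x then 1 else 0 with hf
  have hcut : ∀ t, (k : ℝ) / 2 * (𝔼 x, 𝔼 y, |f t x - f t y|) ≤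
      ∑ i, 𝔼 x, |f t x - f t (flip x i)| := by
    intro t
    have hinv : ∀ g x, f t (sh g x) = f t x := fun g x => by simp only [hf, hF]
    refine kkl k M hk hM (f t) (fun x => ?_) (fun i => inf_inv (f t) hinv i)
    simp only [hf]; split_ifs <;> simp
  have hint : ∀ x y, MeasureTheory.Integrable (fun t => |f t x - f t y|) :=
    fun x y => (integral_cut (F x) (F y)).1
  have hval : ∀ x y, ∫ t, |f t x - f t y| = |F x - F y| :=
    fun x y => (integral_cut (F x) (F y)).2
  have hL : ∫ t, (k : ℝ) / 2 * (𝔼 x, 𝔼 y, |f t x - f t y|)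
      = (k : ℝ) / 2 * (𝔼 x, 𝔼 y, |F x - F y|) := by
    simp only [Fintype.expect_eq_sum_div_card]
    rw [MeasureTheory.integral_const_mul, MeasureTheory.integral_div,
      MeasureTheory.integral_finsetSum]
    · simp only [MeasureTheory.integral_div]
      congr 2
      refine Finset.sum_congr rfl fun x _ => ?_
      rw [MeasureTheory.integral_finsetSum]
      · simp only [hval]
      · exact fun y _ => hint x y
    · intro x _
      exact (MeasureTheory.integrable_finsetSum _ fun y _ => hint x y).div_const _
  have hRr : ∫ t, ∑ i, 𝔼 x, |f t x - f t (flip x i)| = ∑ i, 𝔼 x, |F x - F (flip x i)| := by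
    simp only [Fintype.expect_eq_sum_div_card]
    rw [MeasureTheory.integral_finsetSum]
    · refine Finset.sum_congr rfl fun i _ => ?_
      rw [MeasureTheory.integral_div, MeasureTheory.integral_finsetSum]
      · simp only [hval]
      · exact fun y _ => hint _ _
    · intro x _
      exact (MeasureTheory.integrable_finsetSum _ fun y _ => hint _ _).div_const _
  rw [← hL, ← hRr]
  refine MeasureTheory.integral_mono ?_ ?_ hcut
  · simp only [Fintype.expect_eq_sum_div_card]
    refine MeasureTheory.Integrable.const_mul (MeasureTheory.Integrable.div_const
      (MeasureTheory.integrable_finsetSum _ fun x _ => MeasureTheory.Integrable.div_const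
      (MeasureTheory.integrable_finsetSum _ fun y _ => hint x y) _) _) _
  · simp only [Fintype.expect_eq_sum_div_card]
    exact MeasureTheory.integrable_finsetSum _ fun x _ => MeasureTheory.Integrable.div_const
      (MeasureTheory.integrable_finsetSum _ fun y _ => hint _ _) _

lemma poincare_vec (k m : ℕ) (hk : 1 ≤ k) (hM : k ^ 3 * 9 ^ k ≤ M)
    (F : Om M R → PiLp 1 (fun _ : Fin m => ℝ)) (hF : ∀ g x, F (sh g x) = F x) :
    (k : ℝ) / 2 * (𝔼 x, 𝔼 y, ‖F x - F y‖) ≤ ∑ i, 𝔼 x, ‖F x - F (flip x i)‖ := by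
  have hn : ∀ u v : PiLp 1 (fun _ : Fin m => ℝ), ‖u - v‖ = ∑ l, |u l - v l| := by
    intro u v
    rw [PiLp.norm_eq_of_L1]; simp
  simp only [hn, Finset.expect_sum_comm, Finset.mul_sum]
  rw [Finset.sum_comm]
  refine Finset.sum_le_sum fun l _ => ?_
  exact poincare k hk hM (fun x => F x l) (fun g x => by simp only [hF])

lemma hilb {A : Type} [Fintype A] {n : ℕ} (v : Fin n → A → ℝ) :
    ∃ g : Fin n → lp (fun _ : ℕ => ℝ) 2, ∀ j k, ‖g j - g k‖ = √(∑ a, (v j a - v k a) ^ 2) := by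
  classical
  let enc : A → ℕ := fun a => (Fintype.equivFin A a : ℕ)
  have henc : Function.Injective enc := fun a b h =>
    (Fintype.equivFin A).injective (Fin.ext h)
  let e : A → lp (fun _ : ℕ => ℝ) 2 := fun a => lp.single 2 (enc a) (1:ℝ)
  have he : Orthonormal ℝ e := by
    rw [orthonormal_iff_ite]
    intro a b
    simp only [e]
    rw [lp.inner_single_left]
    by_cases h : a = b
    · subst h; simp
    · have : enc a ≠ enc b := fun h' => h (henc h')
      simp [h, lp.single_apply, Pi.single_apply, this]
  refine ⟨fun j => ∑ a, v j a • e a, fun j k => ?_⟩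
  rw [← Finset.sum_sub_distrib]
  simp only [← sub_smul]
  rw [norm_eq_sqrt_real_inner, he.inner_sum]
  simp [sq]

lemma K_gram : ∃ (A : Type) (_ : Fintype A) (V : Om M R → A → ℝ),
    ∀ x y, ∑ a, V x a * V y a = K x y := by
  have hN := MR_pos (M := M) (R := R)
  have hM : (0:ℝ) < M := by exact_mod_cast Nat.pos_of_ne_zero (NeZero.ne M)
  refine ⟨Fin 40 → (ZMod M × Fin R), inferInstance,
    fun x a => (√(M:ℝ))⁻¹ * ((M * R : ℝ) ^ 20)⁻¹ * ∑ g : ZMod M, ∏ l, sg (sh g x (a l)), ?_⟩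
  intro x y
  have h1 : ∀ g h : ZMod M, ∑ a : Fin 40 → (ZMod M × Fin R),
      (∏ l, sg (sh g x (a l))) * (∏ l, sg (sh h y (a l))) =
      (M * R) ^ 40 * ip (sh g x) (sh h y) ^ 40 := by
    intro g h
    rw [ip_eq, div_pow, mul_div_cancel₀ _ (by positivity)]
    rw [Fintype.sum_pow]
    refine Finset.sum_congr rfl fun a _ => ?_
    rw [Finset.prod_mul_distrib]
  have h2 : ∑ g : ZMod M, ∑ h : ZMod M, ip (sh g x) (sh h y) ^ 40 = M * K x y := by
    have : ∀ g : ZMod M, ∑ h : ZMod M, ip (sh g x) (sh h y) ^ 40 = K x y := fun g => K_sh g x y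
    simp [this, ZMod.card]
  have hs : (√(M:ℝ))⁻¹ * (√(M:ℝ))⁻¹ = (M:ℝ)⁻¹ := by
    rw [← mul_inv, Real.mul_self_sqrt hM.le]
  calc _ = ∑ a : Fin 40 → (ZMod M × Fin R), ((M:ℝ)⁻¹ * ((M * R : ℝ) ^ 40)⁻¹) *
        ∑ g : ZMod M, ∑ h : ZMod M, (∏ l, sg (sh g x (a l))) * (∏ l, sg (sh h y (a l))) := by
        refine Finset.sum_congr rfl fun a _ => ?_
        rw [← Finset.sum_mul_sum, ← hs]
        rw [show ((M * R : ℝ) ^ 40)⁻¹ = ((M * R : ℝ) ^ 20)⁻¹ * ((M * R : ℝ) ^ 20)⁻¹ by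
          rw [← mul_inv, ← pow_add]]
        ring
    _ = ((M:ℝ)⁻¹ * ((M * R : ℝ) ^ 40)⁻¹) * ∑ g : ZMod M, ∑ h : ZMod M,
          ((M * R) ^ 40 * ip (sh g x) (sh h y) ^ 40) := by
        rw [← Finset.mul_sum, Finset.sum_comm]
        congr 1
        refine Finset.sum_congr rfl fun g _ => ?_
        rw [Finset.sum_comm]
        refine Finset.sum_congr rfl fun h _ => h1 g h
    _ = _ := by
        simp only [← Finset.mul_sum]
        rw [h2]
        have hR : (0:ℝ) < R := by exact_mod_cast Nat.pos_of_ne_zero (NeZero.ne R)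
        field_simp
end KV


open Finset
open scoped BigOperators
set_option linter.unusedSectionVars false
namespace KV
variable {M R : ℕ} [NeZero M] [NeZero R]

lemma exists_rep : ∃ rep : Om M R → Om M R, (∀ g x, rep (sh g x) = rep x) ∧
    ∀ x, ∃ g, rep x = sh g x := by
  let S : Setoid (Om M R) :=
    { r := fun x y => ∃ g, y = sh g x
      iseqv := ⟨fun x => ⟨0, (sh_zero x).symm⟩, by
        rintro x y ⟨g, rfl⟩; exact ⟨-g, by simp [sh_sh, sh_zero]⟩, by
        rintro x y z ⟨g, rfl⟩ ⟨h, rfl⟩; exact ⟨h + g, by simp [sh_sh]⟩⟩ }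
  refine ⟨fun x => (Quotient.mk S x).out, fun g x => ?_, fun x => ?_⟩
  · have : Quotient.mk S (sh g x) = Quotient.mk S x :=
      Quotient.sound (s := S) ⟨-g, by simp [sh_sh, sh_zero]⟩
    simp only [this]
  · have h : S.r (Quotient.mk S x).out x := Quotient.mk_out (s := S) x
    exact S.iseqv.symm h

lemma K_nonneg (x y : Om M R) : 0 ≤ K x y :=
  Finset.sum_nonneg fun g _ => Even.pow_nonneg (by decide) _

lemma d0_nonneg (x y : Om M R) : 0 ≤ K x x + K y y - 2 * K x y := by
  obtain ⟨A, _, V, hV⟩ := K_gram (M := M) (R := R)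
  have : K x x + K y y - 2 * K x y = ∑ a, (V x a - V y a) ^ 2 := by
    rw [← hV, ← hV, ← hV, Finset.mul_sum, ← Finset.sum_add_distrib, ← Finset.sum_sub_distrib]
    refine Finset.sum_congr rfl fun a _ => by ring
  rw [this]; exact Finset.sum_nonneg fun _ _ => sq_nonneg _

lemma hilb_d {n : ℕ} (φ : Fin n → Om M R) (δ : ℝ) (hδ : 0 ≤ δ) :
    ∃ g : Fin n → lp (fun _ : ℕ => ℝ) 2, ∀ j k, ‖g j - g k‖ =
      √(if j = k then 0 else (K (φ j) (φ j) + K (φ k) (φ k) - 2 * K (φ j) (φ k)) + δ) := by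
  obtain ⟨A, _, V, hV⟩ := K_gram (M := M) (R := R)
  obtain ⟨g, hg⟩ := hilb (A := A ⊕ Fin n) (n := n)
    (fun j a => Sum.elim (fun a => V (φ j) a) (fun l => if l = j then √(δ / 2) else 0) a)
  refine ⟨g, fun j k => ?_⟩
  rw [hg]
  congr 1
  split_ifs with h
  · subst h; simp
  rw [Fintype.sum_sum_type]
  simp only [Sum.elim_inl, Sum.elim_inr]
  congr 1
  · rw [← hV, ← hV, ← hV, Finset.mul_sum, ← Finset.sum_add_distrib, ← Finset.sum_sub_distrib]
    refine Finset.sum_congr rfl fun a _ => by ring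
  · have hs : √(δ / 2) ^ 2 = δ / 2 := Real.sq_sqrt (by positivity)
    generalize √(δ / 2) = q at hs ⊢
    have : ∀ l : Fin n, ((if l = j then q else 0) - (if l = k then q else 0)) ^ 2
        = (if l = j then δ / 2 else 0) + (if l = k then δ / 2 else 0) := by
      intro l
      by_cases h1 : l = j
      · have h2 : l ≠ k := fun e => h (h1 ▸ e)
        simp [h1, h, hs]
      · by_cases h2 : l = k
        · simp [h2, Ne.symm h, hs]
        · simp [h1, h2]
    simp only [this, Finset.sum_add_distrib, Finset.sum_ite_eq', Finset.mem_univ, if_true]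
    ring

lemma main (k : ℕ) (hk : 1 ≤ k) (hM : k ^ 3 * 9 ^ k ≤ M) (hR : 6 ≤ R) {ε : ℝ} (hε : 0 < ε)
    (hκ : M * ε ≤ 1 / 5) (hδ : (3 * (M * ε)) ^ 19 ≤ 1 / (M * R : ℝ))
    (h324 : 324 * (M:ℝ) ≤ ε ^ 4 * (M * R)) (hMR : 100 ≤ M * R) (n : ℕ) (hn : 2 ^ (M * R) ≤ n) :
    ∃ d : Fin n → Fin n → ℝ,
          (∀ x, d x x = 0) ∧
          (∀ x y, x ≠ y → 0 < d x y) ∧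
          (∀ x y, d x y = d y x) ∧
          (∀ x y z, d x z ≤ d x y + d y z) ∧
          (∃ g : Fin n → lp (fun _ : ℕ => ℝ) 2,
            ∀ x y, ‖g x - g y‖ = Real.sqrt (d x y)) ∧
          ∀ (m : ℕ) (f : Fin n → PiLp 1 (fun _ : Fin m => ℝ)) (c' : ℝ),
            (∀ x y, d x y ≤ ‖f x - f y‖ ∧ ‖f x - f y‖ ≤ c' * d x y) →
            (k : ℝ) / 508 ≤ c' := by
  classical
  have hN := MR_pos (M := M) (R := R)
  have hNr : (100:ℝ) ≤ M * R := by exact_mod_cast hMR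
  have hRr : (6:ℝ) ≤ R := by exact_mod_cast hR
  set η : ℝ := 1 / (M * R) with hη
  have hη0 : 0 < η := by positivity
  have hη1 : η ≤ 1 / 100 := one_div_le_one_div_of_le (by norm_num) hNr
  have hηN : η * (M * R) = 1 := one_div_mul_cancel hN.ne'
  have hbad := bad_bound (M := M) (R := R) hε h324
  rw [← hη] at hbad
  -- good point
  have hx0 : ∃ x0 : Om M R, Good ε x0 := by
    by_contra hc
    push Not at hc
    have : ∀ x : Om M R, bad ε x = 1 := fun x => by simp [bad, hc x]
    simp [this] at hbad
    linarith
  obtain ⟨x0, hx0⟩ := hx0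
  have : Nonempty {x : Om M R // Good ε x} := ⟨⟨x0, hx0⟩⟩
  have hcard : Fintype.card {x : Om M R // Good ε x} ≤ Fintype.card (Fin n) := by
    refine (Fintype.card_subtype_le _).trans ?_
    simpa [Om, ZMod.card] using hn
  obtain ⟨e⟩ := Function.Embedding.nonempty_of_card_le hcard
  set φ : Fin n → Om M R := fun j => (Function.invFun e j).1 with hφ
  have hφg : ∀ j, Good ε (φ j) := fun j => (Function.invFun e j).2
  have hφe : ∀ z, φ (e z) = z.1 := fun z => by
    simp only [hφ, Function.leftInverse_invFun e.injective z]
  set δ : ℝ := 82 * η with hδd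
  have hδ0 : 0 < δ := by positivity
  set d : Fin n → Fin n → ℝ := fun j k =>
    if j = k then 0 else (K (φ j) (φ j) + K (φ k) (φ k) - 2 * K (φ j) (φ k)) + δ with hd
  have dne : ∀ {j k}, j ≠ k → d j k =
    (K (φ j) (φ j) + K (φ k) (φ k) - 2 * K (φ j) (φ k)) + δ := fun h => by simp [hd, h]
  have dself : ∀ j, d j j = 0 := fun j => by simp [hd]
  have dpos : ∀ x y, x ≠ y → 0 < d x y := by
    intro x y h
    rw [dne h]; have := d0_nonneg (φ x) (φ y); linarith
  have dnn : ∀ x y, 0 ≤ d x y := by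
    intro x y
    by_cases h : x = y
    · rw [h, dself]
    · exact (dpos x y h).le
  refine ⟨d, dself, dpos, ?_, ?_, hilb_d φ δ hδ0.le, ?_⟩
  · intro x y
    by_cases h : x = y
    · rw [h]
    · rw [dne h, dne (Ne.symm h), K_comm (φ y) (φ x)]; ring
  · intro x y z
    by_cases h1 : x = z
    · rw [h1, dself]; have := dnn z y; have := dnn y z; linarith
    by_cases h2 : x = y
    · rw [h2, dself]; simp
    by_cases h3 : y = z
    · rw [h3, dself]; simp
    rw [dne h1, dne h2, dne h3]
    have := tri hε.le hκ hδ (φ x) (φ y) (φ z) (hφg x) (hφg y) (hφg z)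
    have := K_self_ge (φ y)
    linarith
  intro m f c' hf
  obtain ⟨rep, hrep, hrep'⟩ := exists_rep (M := M) (R := R)
  set J : Om M R → Fin n := fun x => if h : Good ε (rep x) then e ⟨rep x, h⟩ else e ⟨x0, hx0⟩
    with hJ
  have hJinv : ∀ g x, J (sh g x) = J x := fun g x => by simp only [hJ, hrep]
  have hJφ : ∀ x, Good ε x → φ (J x) = rep x := by
    intro x hx
    have : Good ε (rep x) := by
      obtain ⟨g, hg⟩ := hrep' x; rw [hg]; exact hx.sh g
    simp only [hJ, this, dif_pos, hφe]
  have hKrep : ∀ x y : Om M R, K (rep x) (rep y) = K x y := by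
    intro x y
    obtain ⟨g, hg⟩ := hrep' x
    obtain ⟨h, hh⟩ := hrep' y
    rw [hg, hh, K_sh, K_comm, K_sh, K_comm]
  have hKle : ∀ x : Om M R, Good ε x → K x x ≤ 1 + η := fun x hx => K_self_le hε.le hκ hδ x hx
  have hdiam : ∀ j k, d j k ≤ 5 := by
    intro j k
    by_cases h : j = k
    · rw [h, dself]; norm_num
    rw [dne h]
    have h1 := hKle _ (hφg j)
    have h2 := hKle _ (hφg k)
    have h3 := K_nonneg (φ j) (φ k)
    linarith
  have hc0 : 0 ≤ c' := by
    have h2 : 2 ≤ n := by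
      refine le_trans ?_ hn
      calc 2 = 2 ^ 1 := rfl
        _ ≤ _ := Nat.pow_le_pow_right (by norm_num) (by omega)
    have hne : (⟨0, by omega⟩ : Fin n) ≠ ⟨1, by omega⟩ := by simp
    have h := dpos _ _ hne
    have h3 := (hf ⟨0, by omega⟩ ⟨1, by omega⟩).1.trans (hf ⟨0, by omega⟩ ⟨1, by omega⟩).2
    by_contra hc
    push Not at hc
    nlinarith
  set F : Om M R → PiLp 1 (fun _ : Fin m => ℝ) := fun x => f (J x) with hF
  have hP := poincare_vec k m hk hM F (fun g x => by simp only [hF, hJinv])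
  have hbadv : ∀ x : Om M R, Good ε x → bad ε x = 0 := fun x hx => by simp [bad, hx]
  have hbadv' : ∀ x : Om M R, ¬ Good ε x → bad ε x = 1 := fun x hx => by simp [bad, hx]
  have hup : ∀ i x, ‖F x - F (flip x i)‖ ≤
      c' * (244 * η + 5 * (bad ε x + bad ε (flip x i))) := by
    intro i x
    refine ((hf _ _).2).trans (mul_le_mul_of_nonneg_left ?_ hc0)
    have b1 := bad_nonneg ε x
    have b2 := bad_nonneg ε (flip x i)
    by_cases h1 : Good ε x
    · by_cases h2 : Good ε (flip x i)
      · by_cases h : J x = J (flip x i)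
        · rw [h, dself]; positivity
        · rw [dne h, hJφ _ h1, hJφ _ h2, hKrep, hKrep, hKrep]
          have h3 := hKle _ h1
          have h4 := hKle _ h2
          have h5 := K_flip (by omega) x i
          have e80 : 80 / (M * R : ℝ) = 80 * η := by rw [hη]; ring
          rw [e80] at h5
          linarith
      · rw [hbadv' _ h2]; have := hdiam (J x) (J (flip x i)); linarith
    · rw [hbadv' _ h1]; have := hdiam (J x) (J (flip x i)); linarith
  have hlow : ∀ x y, 2 - 2 * K x y - 2 * bad ε x - 2 * bad ε y ≤ ‖F x - F y‖ := by
    intro x y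
    have b1 := bad_nonneg ε x
    have b2 := bad_nonneg ε y
    have hk0 := K_nonneg x y
    by_cases h1 : Good ε x
    · by_cases h2 : Good ε y
      · refine le_trans ?_ (hf _ _).1
        by_cases h : J x = J y
        · rw [h, dself]
          have h6 : K x y = K (rep x) (rep x) := by
            rw [← hKrep x y, ← hJφ x h1, ← hJφ y h2, h]
          have h7 := K_self_ge (rep x)
          linarith
        · rw [dne h, hJφ _ h1, hJφ _ h2, hKrep, hKrep, hKrep]
          have := K_self_ge x
          have := K_self_ge y
          linarith
      · rw [hbadv' _ h2]; have := norm_nonneg (F x - F y); linarith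
    · rw [hbadv' _ h1]; have := norm_nonneg (F x - F y); linarith
  have hU : ∑ i, 𝔼 x, ‖F x - F (flip x i)‖ ≤ 254 * c' := by
    calc ∑ i, 𝔼 x, ‖F x - F (flip x i)‖
        ≤ ∑ i : ZMod M × Fin R, c' * (254 * η) := by
          refine Finset.sum_le_sum fun i _ => ?_
          refine (Finset.expect_le_expect fun x _ => hup i x).trans ?_
          rw [← Finset.mul_expect]
          refine mul_le_mul_of_nonneg_left ?_ hc0
          rw [Finset.expect_add_distrib, Fintype.expect_const, ← Finset.mul_expect,
            Finset.expect_add_distrib, expect_flip (fun x => bad ε x) i]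
          linarith
      _ = (M * R) * (c' * (254 * η)) := by
          rw [Finset.sum_const, nsmul_eq_mul, Finset.card_univ, card_idx]
      _ = 254 * c' * (η * (M * R)) := by ring
      _ = 254 * c' := by rw [hηN, mul_one]
  have hL : 1 ≤ 𝔼 x, 𝔼 y, ‖F x - F y‖ := by
    have h1 : ∀ x, 2 - 2 * (1 / R : ℝ) - 2 * bad ε x - 2 * η ≤ 𝔼 y, ‖F x - F y‖ := by
      intro x
      refine le_trans ?_ (Finset.expect_le_expect fun y _ => hlow x y)
      rw [Finset.expect_sub_distrib, Finset.expect_sub_distrib, Finset.expect_sub_distrib,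
        Fintype.expect_const, Fintype.expect_const, ← Finset.mul_expect, ← Finset.mul_expect]
      have := expect_K x
      simp only [K_comm x]
      linarith
    refine le_trans ?_ (Finset.expect_le_expect fun x _ => h1 x)
    rw [Finset.expect_sub_distrib, Finset.expect_sub_distrib,
        Fintype.expect_const, Fintype.expect_const, ← Finset.mul_expect]
    have : (1:ℝ) / R ≤ 1 / 6 := one_div_le_one_div_of_le (by norm_num) hRr
    linarith
  have hkk : (0:ℝ) ≤ (k:ℝ) / 2 := by positivity
  have := mul_le_mul_of_nonneg_left hL hkk
  linarith

lemma params (k : ℕ) (hk : 1 ≤ k) (n : ℕ) (hn : 2 ^ (1024 ^ k) ^ 35 ≤ n) :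
    ∃ d : Fin n → Fin n → ℝ,
          (∀ x, d x x = 0) ∧
          (∀ x y, x ≠ y → 0 < d x y) ∧
          (∀ x y, d x y = d y x) ∧
          (∀ x y z, d x z ≤ d x y + d y z) ∧
          (∃ g : Fin n → lp (fun _ : ℕ => ℝ) 2,
            ∀ x y, ‖g x - g y‖ = Real.sqrt (d x y)) ∧
          ∀ (m : ℕ) (f : Fin n → PiLp 1 (fun _ : Fin m => ℝ)) (c' : ℝ),
            (∀ x y, d x y ≤ ‖f x - f y‖ ∧ ‖f x - f y‖ ≤ c' * d x y) →
            (k : ℝ) / 508 ≤ c' := by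
  have hB1 : 1024 ≤ 1024 ^ k := by
    calc 1024 = 1024 ^ 1 := rfl
      _ ≤ _ := Nat.pow_le_pow_right (by norm_num) hk
  have hB2 : k ^ 3 * 9 ^ k ≤ 1024 ^ k := by
    have h1 : k ^ 3 ≤ 8 ^ k := by
      calc k ^ 3 ≤ (2 ^ k) ^ 3 := Nat.pow_le_pow_left (Nat.lt_two_pow_self).le 3
        _ = 8 ^ k := by rw [← pow_mul, mul_comm, pow_mul]; norm_num
    calc k ^ 3 * 9 ^ k ≤ 8 ^ k * 9 ^ k := Nat.mul_le_mul_right _ h1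
      _ = 72 ^ k := by rw [← mul_pow]; norm_num
      _ ≤ 1024 ^ k := Nat.pow_le_pow_left (by norm_num) k
  generalize 1024 ^ k = B at hn hB1 hB2
  have hBr : (1024:ℝ) ≤ B := by exact_mod_cast hB1
  have hB0 : (0:ℝ) < B := by linarith
  have : NeZero (B ^ 5) := ⟨by positivity⟩
  have : NeZero (B ^ 30) := ⟨by positivity⟩
  have hpow : ∀ j, 1 ≤ j → B ≤ B ^ j := fun j hj => Nat.le_self_pow (by omega) B
  have hone : ∀ j, (1:ℝ) ≤ (B:ℝ) ^ j := fun j => one_le_pow₀ (by linarith)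
  have hMe : ((B:ℝ) ^ 5) * (1 / (3 * (B:ℝ) ^ 7)) = 1 / (3 * (B:ℝ) ^ 2) := by
    field_simp
  refine main (M := B ^ 5) (R := B ^ 30) k hk (hB2.trans (hpow 5 (by norm_num)))
    (le_trans (by omega) (hpow 30 (by norm_num))) (ε := 1 / (3 * (B:ℝ) ^ 7)) (by positivity)
    ?_ ?_ ?_ ?_ n ?_
  · push_cast
    rw [hMe]
    refine one_div_le_one_div_of_le (by norm_num) ?_
    nlinarith
  · push_cast
    rw [hMe, show 3 * (1 / (3 * (B:ℝ) ^ 2)) = 1 / (B:ℝ) ^ 2 by field_simp, div_pow, one_pow,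
      ← pow_mul, ← pow_add]
    refine one_div_le_one_div_of_le (by positivity) (pow_le_pow_right₀ (by linarith) (by norm_num))
  · push_cast
    have : (1 / (3 * (B:ℝ) ^ 7)) ^ 4 * ((B:ℝ) ^ 5 * (B:ℝ) ^ 30) = (B:ℝ) ^ 5 * ((B:ℝ) ^ 2 / 81) := by
      field_simp
      norm_num
    rw [this, mul_comm]
    refine mul_le_mul_of_nonneg_left ?_ (by positivity)
    nlinarith
  · rw [← pow_add]
    exact le_trans (by omega) (hpow _ (by norm_num))
  · rw [← pow_add]; exact hn

lemma loglog (k n : ℕ) (hk : 1 ≤ k) (h1 : 2 ^ (1024 ^ k) ^ 35 ≤ n)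
    (h2 : n < 2 ^ (1024 ^ (k + 1)) ^ 35) :
    (1 / 355600 : ℝ) * (Real.log (Real.log n)) ^ ((1 : ℝ) / 6) ≤ (k : ℝ) / 508 := by
  have hk' : (1:ℝ) ≤ k := by exact_mod_cast hk
  have h4 : 4 ≤ n := by
    refine le_trans ?_ h1
    calc 4 = 2 ^ 2 := rfl
      _ ≤ _ := Nat.pow_le_pow_right (by norm_num) ?_
    have hB1 : 2 ≤ 1024 ^ k := by
      calc 2 ≤ 1024 ^ 1 := by norm_num
        _ ≤ _ := Nat.pow_le_pow_right (by norm_num) hk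
    exact hB1.trans (Nat.le_self_pow (by norm_num) _)
  have h4' : (4:ℝ) ≤ n := by exact_mod_cast h4
  have hln : 1 ≤ Real.log n := by
    rw [Real.le_log_iff_exp_le (by linarith)]
    have := Real.exp_one_lt_d9
    linarith
  have hl2 : Real.log 2 ≤ 1 := by have := Real.log_two_lt_d9; linarith
  have hl20 : 0 < Real.log 2 := Real.log_pos (by norm_num)
  have hll0 : 0 ≤ Real.log (Real.log n) := Real.log_nonneg hln
  have hu : Real.log n ≤ ((1024:ℝ) ^ (k + 1)) ^ 35 := by
    have : (n:ℝ) ≤ (2:ℝ) ^ ((1024 ^ (k + 1)) ^ 35 : ℕ) := by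
      have := h2.le
      exact_mod_cast this
    have h := Real.log_le_log (by linarith) this
    rw [Real.log_pow] at h
    refine h.trans ?_
    push_cast
    have : (0:ℝ) ≤ ((1024:ℝ) ^ (k + 1)) ^ 35 := by positivity
    nlinarith
  have hll : Real.log (Real.log n) ≤ 700 * k := by
    have h := Real.log_le_log (by linarith) hu
    rw [Real.log_pow, Real.log_pow, show (1024:ℝ) = 2 ^ 10 by norm_num, Real.log_pow] at h
    push_cast at h
    nlinarith
  have h6 : (Real.log (Real.log n)) ^ ((1 : ℝ) / 6) ≤ 700 * k := by
    calc (Real.log (Real.log n)) ^ ((1 : ℝ) / 6) ≤ (700 * k : ℝ) ^ ((1 : ℝ) / 6) :=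
          Real.rpow_le_rpow hll0 hll (by norm_num)
      _ ≤ (700 * k : ℝ) ^ (1 : ℝ) := Real.rpow_le_rpow_of_exponent_le (by linarith) (by norm_num)
      _ = _ := Real.rpow_one _
  linarith

lemma exists_k (T : ℕ → ℕ) (hT : StrictMono T) (n : ℕ) (hn : T 1 ≤ n) :
    ∃ k, 1 ≤ k ∧ T k ≤ n ∧ n < T (k + 1) := by
  have hex : ∃ j, n < T j := ⟨n + 1, lt_of_lt_of_le (Nat.lt_succ_self n) (hT.id_le _)⟩
  classical
  have h1 := Nat.find_spec hex
  have h2 := fun j => Nat.find_min hex (m := j)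
  generalize Nat.find hex = j at h1 h2
  have hj : 2 ≤ j := by
    by_contra hc
    have : T j ≤ T 1 := hT.monotone (by omega)
    omega
  obtain ⟨k, rfl⟩ : ∃ k, j = k + 1 := ⟨j - 1, by omega⟩
  exact ⟨k, by omega, by have := h2 k (by omega); omega, h1⟩

end KV


end KVsection

theorem khot_vishnoi :
    ∃ c : ℝ, 0 < c ∧
      ∃ N₀ : ℕ, ∀ n : ℕ, N₀ ≤ n →
        ∃ d : Fin n → Fin n → ℝ,
          (∀ x, d x x = 0) ∧
          (∀ x y, x ≠ y → 0 < d x y) ∧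
          (∀ x y, d x y = d y x) ∧
          (∀ x y z, d x z ≤ d x y + d y z) ∧
          (∃ g : Fin n → lp (fun _ : ℕ => ℝ) 2,
            ∀ x y, ‖g x - g y‖ = Real.sqrt (d x y)) ∧
          ∀ (m : ℕ) (f : Fin n → PiLp 1 (fun _ : Fin m => ℝ)) (c' : ℝ),
            (∀ x y, d x y ≤ ‖f x - f y‖ ∧ ‖f x - f y‖ ≤ c' * d x y) →
            c * (Real.log (Real.log n)) ^ ((1 : ℝ) / 6) ≤ c' := by
  obtain ⟨T, hTd⟩ : ∃ T : ℕ → ℕ, ∀ k, T k = 2 ^ (1024 ^ k) ^ 35 := ⟨_, fun k => rfl⟩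
  have hT : StrictMono T := by
    intro a b hab
    rw [hTd, hTd]
    refine Nat.pow_lt_pow_right (by norm_num) (Nat.pow_lt_pow_left ?_ (by norm_num))
    exact Nat.pow_lt_pow_right (by norm_num) hab
  refine ⟨1 / 355600, by norm_num, T 1, fun n hn => ?_⟩
  obtain ⟨k, hk, h1, h2⟩ := KV.exists_k T hT n hn
  rw [hTd] at h1 h2
  obtain ⟨d, hd1, hd2, hd3, hd4, hd5, hd6⟩ := KV.params k hk n h1
  exact ⟨d, hd1, hd2, hd3, hd4, hd5, fun m f c' hf =>
    (KV.loglog k n hk h1 h2).trans (hd6 m f c' hf)⟩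
end

section
/- Let G be a finite simple graph that is d-regular with d ≥ 3, and let A be its adjacency matrix (a symmetric 0/1 matrix with zero diagonal). Then there exists a symmetric real matrix B with B_{uv} ∈ {−1, 1} whenever A_{uv} = 1 and B_{uv} = 0 whenever A_{uv} = 0 (a signing of the edges of G), such that every eigenvalue of B is at most 2·√(d−1). -/
namespace BL
open Matrix Polynomial
set_option linter.unusedSectionVars false
set_option linter.unusedSimpArgs false
variable {V : Type*} [Fintype V] [DecidableEq V]

/-- edge matrix -/
def E (R : Type*) [CommRing R] (e : Sym2 V) : Matrix V V R :=
  Matrix.of fun i j => if s(i, j) = e then 1 else 0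

/-- sum over all signings -/
def P {R : Type*} [CommRing R] (φ : Matrix V V R → R) : List (Sym2 V) → Matrix V V R → R
  | [], M => φ M
  | e :: L, M => P φ L (M - E R e) + P φ L (M + E R e)

/-- replace the rows outside S by identity rows -/
def N {R : Type*} [CommRing R] (S : Finset V) (M : Matrix V V R) : Matrix V V R :=
  Matrix.of fun i j => if i ∈ S then M i j else (1 : Matrix V V R) i j

lemma E_isSymm (R : Type*) [CommRing R] (e : Sym2 V) : (E R e).IsSymm := by
  ext i j; simp [E, Sym2.eq_swap]

lemma P_map {R T : Type*} [CommRing R] [CommRing T] (f : R →+* T) (L : List (Sym2 V))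
    (M : Matrix V V R) : f (P det L M) = P det L (M.map f) := by
  induction L generalizing M with
  | nil => simp [P, RingHom.map_det]
  | cons e L ih =>
    have h : (E R e).map f = E T e := by ext i j; simp only [E, map_apply, of_apply]; split_ifs <;> simp
    simp only [P, map_add, ih]
    congr 2
    · rw [← h]; ext i j; simp
    · rw [← h]; ext i j; simp

lemma det_rank_one {R : Type*} [CommRing R] (M : Matrix V V R) (w : V → R) (a : R) :
    det (M + a • vecMulVec w w) = det M + a * (det (M + vecMulVec w w) - det M) := by
  have key : ∀ a : R, det (M + a • vecMulVec w w) =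
      det ((fromBlocks M 0 (replicateRow Unit (-w)) (1 : Matrix Unit Unit R))) + 
      a * det ((fromBlocks M (replicateCol Unit w) (replicateRow Unit (-w)) (0 : Matrix Unit Unit R))) := by
    intro a
    have h1 : det (M + a • vecMulVec w w) = 
      det ((fromBlocks M (replicateCol Unit (a • w)) (replicateRow Unit (-w)) (1 : Matrix Unit Unit R))) := by
      rw [det_fromBlocks_one₂₂]
      congr 1
      ext i j
      simp [Matrix.mul_apply, vecMulVec_apply, mul_assoc]
    rw [h1]
    set Z := fromBlocks M 0 (replicateRow Unit (-w)) (1 : Matrix Unit Unit R)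
    have e1 : fromBlocks M (replicateCol Unit (a • w)) (replicateRow Unit (-w)) (1 : Matrix Unit Unit R)
      = Z.updateCol (Sum.inr ()) ((Sum.elim 0 1 : V ⊕ Unit → R) + a • (Sum.elim w 0 : V ⊕ Unit → R)) := by
      ext (i|i) (j|j) <;> simp [Z, updateCol_apply]
    have e2 : fromBlocks M (replicateCol Unit w) (replicateRow Unit (-w)) (0 : Matrix Unit Unit R)
      = Z.updateCol (Sum.inr ()) (Sum.elim w 0) := by
      ext (i|i) (j|j) <;> simp [Z, updateCol_apply]
    have e3 : Z = Z.updateCol (Sum.inr ()) (Sum.elim 0 1) := by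
      ext (i|i) (j|j) <;> simp [Z, updateCol_apply]
    rw [e1, e2, det_updateCol_add, det_updateCol_smul, ← e3]
  have h0 := key 0
  have h1 := key 1
  rw [key a]
  simp only [zero_smul, add_zero, zero_mul, one_smul, one_mul] at h0 h1
  rw [h1, h0]; ring

lemma P_rank_one {R : Type*} [CommRing R] (L : List (Sym2 V)) (M : Matrix V V R) (w : V → R) (a : R) :
    P det L (M + a • vecMulVec w w) = P det L M + a * (P det L (M + vecMulVec w w) - P det L M) := by
  induction L generalizing M with
  | nil => exact det_rank_one M w a
  | cons e L ih =>
    simp only [P]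
    rw [add_sub_right_comm, add_right_comm, ih, ih, add_sub_right_comm M (vecMulVec w w), add_right_comm M _ (E R e)]
    ring

lemma det_two_rows {R : Type*} [CommRing R] (Z : Matrix V V R) (a b : V) (hab : a ≠ b)
    (x y : V → R) (s : R) :
    det ((Z.updateRow a ((fun j => Z a j) + s • x)).updateRow b ((fun j => Z b j) + s • y)) =
      det Z + s * det (Z.updateRow a x) + s * det (Z.updateRow b y) +
        s * s * det ((Z.updateRow a x).updateRow b y) := by
  have e5 : Z.updateRow a (fun j => Z a j) = Z := updateRow_eq_self _ _
  have e6 : Z.updateRow b (fun j => Z b j) = Z := updateRow_eq_self _ _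
  rw [det_updateRow_add, det_updateRow_smul, Matrix.updateRow_comm Z hab,
    Matrix.updateRow_comm Z hab, det_updateRow_add, det_updateRow_smul,
    det_updateRow_add, det_updateRow_smul, e6, e5, Matrix.updateRow_comm Z hab.symm,
    Matrix.updateRow_comm Z hab.symm, e5]
  ring

lemma det_N_pm_aux {R : Type*} [CommRing R] (S : Finset V) (M : Matrix V V R) (a b : V) (hab : a ≠ b)
    (ha : a ∈ S) (hb : b ∉ S) :
    det (N S (M - E R s(a,b))) + det (N S (M + E R s(a,b))) = 2 * det (N S M) := by
  have key : ∀ s : R, det (N S (M + s • E R s(a,b))) = det (N S M) +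
      s * det ((N S M).updateRow a (Pi.single b 1)) := by
    intro s
    have e1 : N S (M + s • E R s(a,b)) =
        (N S M).updateRow a ((fun j => N S M a j) + s • Pi.single b 1) := by
      ext i j
      simp only [N, E, updateRow_apply, of_apply, Pi.add_apply, Pi.smul_apply, Pi.single_apply,
        Matrix.add_apply, Matrix.smul_apply, smul_eq_mul, Sym2.eq_iff]
      by_cases hib : i = b
      · subst hib; simp [hb, hab.symm]
      · by_cases hia : i = a
        · subst hia; simp [ha, hab]
        · simp [hia, hib]
    have e5 : (N S M).updateRow a (fun j => N S M a j) = N S M := updateRow_eq_self _ _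
    rw [e1, det_updateRow_add, det_updateRow_smul, e5]
  have h1 := key 1
  have h2 := key (-1)
  simp only [one_smul, neg_smul, ← sub_eq_add_neg] at h1 h2
  rw [h1, h2]; ring

lemma det_N_pm {R : Type*} [CommRing R] (S : Finset V) (M : Matrix V V R) (a b : V) (hab : a ≠ b) :
    det (N S (M - E R s(a,b))) + det (N S (M + E R s(a,b))) =
    2 * det (N S M) - (if a ∈ S ∧ b ∈ S then 2 * det (N ((S.erase a).erase b) M) else 0) := by
  by_cases ha : a ∈ S
  · by_cases hb : b ∈ S
    · rw [if_pos ⟨ha, hb⟩]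
      have key : ∀ s : R, det (N S (M + s • E R s(a,b))) = det (N S M) +
         s * det ((N S M).updateRow a (Pi.single b 1)) +
         s * det ((N S M).updateRow b (Pi.single a 1))
         - s * s * det (N ((S.erase a).erase b) M) := by
        intro s
        have e1 : N S (M + s • E R s(a,b)) =
            ((N S M).updateRow a ((fun j => N S M a j) + s • Pi.single b 1)).updateRow b
            ((fun j => N S M b j) + s • Pi.single a 1) := by
          ext i j
          simp only [N, E, updateRow_apply, of_apply, Pi.add_apply, Pi.smul_apply, Pi.single_apply,
            Matrix.add_apply, Matrix.smul_apply, smul_eq_mul, Sym2.eq_iff]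
          by_cases hib : i = b
          · subst hib; simp [hb, hab.symm]
          · by_cases hia : i = a
            · subst hia; simp [ha, hab]
            · simp [hia, hib]
        have e3 : det (((N S M).updateRow a (Pi.single b 1)).updateRow b (Pi.single a 1))
           = - det (N ((S.erase a).erase b) M) := by
          have : ((N S M).updateRow a (Pi.single b 1)).updateRow b (Pi.single a 1) =
            (N ((S.erase a).erase b) M).submatrix (Equiv.swap a b) id := by
            ext i j
            simp only [N, updateRow_apply, of_apply, submatrix_apply, id, Equiv.swap_apply_def,
              Finset.mem_erase, Matrix.one_apply, Pi.single_apply]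
            by_cases hib : i = b
            · subst hib; simp [hab.symm, eq_comm]
            · by_cases hia : i = a
              · subst hia; simp [hab, eq_comm]
              · simp [hia, hib]
          rw [this, det_permute]
          simp [Equiv.Perm.sign_swap hab]
        rw [e1, det_two_rows _ _ _ hab, e3]
        ring
      have h1 := key 1
      have h2 := key (-1)
      simp only [one_smul, neg_smul, ← sub_eq_add_neg] at h1 h2
      rw [h1, h2]; ring
    · rw [det_N_pm_aux S M a b hab ha hb]; simp [hb]
  · by_cases hb : b ∈ S
    · rw [Sym2.eq_swap, det_N_pm_aux S M b a hab.symm hb ha]; simp [ha]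
    · have key : ∀ s : R, N S (M + s • E R s(a,b)) = N S M := by
        intro s
        ext i j
        simp only [N, E, of_apply, Matrix.add_apply, Matrix.smul_apply, smul_eq_mul, Sym2.eq_iff]
        by_cases hib : i = b
        · subst hib; simp [hb, hab.symm]
        · by_cases hia : i = a
          · subst hia; simp [ha, hab]
          · simp [hia, hib]
      have h1 := key 1
      have h2 := key (-1)
      simp only [one_smul, neg_smul, ← sub_eq_add_neg] at h1 h2
      rw [h1, h2]; simp [ha]; ring

lemma P_add {R : Type*} [CommRing R] (φ ψ : Matrix V V R → R) (c : R) (L : List (Sym2 V))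
    (M : Matrix V V R) : P (fun M => 2 * φ M - c * ψ M) L M = 2 * P φ L M - c * P ψ L M := by
  induction L generalizing M with
  | nil => rfl
  | cons e L ih => simp only [P, ih]; ring

lemma P_comm {R : Type*} [CommRing R] (φ : Matrix V V R → R) (F : Matrix V V R) (L : List (Sym2 V))
    (M : Matrix V V R) :
    P φ L (M - F) + P φ L (M + F) = P (fun M => φ (M - F) + φ (M + F)) L M := by
  induction L generalizing M with
  | nil => rfl
  | cons e L ih =>
    simp only [P, ← ih]
    rw [sub_right_comm, add_sub_right_comm, add_sub_right_comm, add_right_comm M F]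
    ring

/-- matching numbers polynomial -/
def m (x : ℝ) : List (Sym2 V) → Finset V → ℝ
  | [], S => x ^ S.card
  | e :: L, S => m x L S - if (∀ a ∈ e, a ∈ S) then m x L (S.filter (· ∉ e)) else 0

lemma P_eq_m (x : ℝ) (L : List (Sym2 V)) (hL : ∀ e ∈ L, ¬ e.IsDiag) (S : Finset V) :
    P (fun M => det (N S M)) L (x • (1 : Matrix V V ℝ)) = 2 ^ L.length * m x L S := by
  induction L generalizing S with
  | nil =>
    simp only [P, m, List.length_nil, pow_zero, one_mul]
    have : N S (x • (1 : Matrix V V ℝ)) = diagonal (fun i => if i ∈ S then x else 1) := by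
      ext i j
      simp only [N, of_apply, Matrix.smul_apply, Matrix.one_apply, diagonal_apply]
      split_ifs <;> simp
    rw [this, det_diagonal]
    simp [Finset.prod_ite]
  | cons e L ih =>
    have ih' := ih (fun e he => hL e (List.mem_cons_of_mem _ he))
    have he := hL e List.mem_cons_self
    induction e using Sym2.ind with
    | _ a b =>
    have hab : a ≠ b := by simpa using he
    simp only [P, P_comm, det_N_pm S _ a b hab, m]
    have h1 : (fun M : Matrix V V ℝ => 2 * det (N S M) -
        (if a ∈ S ∧ b ∈ S then 2 * det (N ((S.erase a).erase b) M) else 0)) =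
        fun M => 2 * det (N S M) - (if a ∈ S ∧ b ∈ S then 2 else 0) * det (N ((S.erase a).erase b) M) := by
      funext M; split_ifs <;> simp
    rw [h1, P_add, ih', ih']
    have h2 : S.filter (· ∉ s(a,b)) = (S.erase a).erase b := by
      ext i; simp; tauto
    rw [h2]
    simp only [Sym2.mem_iff, forall_eq_or_imp, forall_eq, List.length_cons]
    split_ifs <;> ring

lemma m_cons (x : ℝ) (L : List (Sym2 V)) (a b : V) (S : Finset V) :
    m x (s(a,b) :: L) S = m x L S - if a ∈ S ∧ b ∈ S then m x L ((S.erase a).erase b) else 0 := by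
  have h2 : S.filter (· ∉ s(a,b)) = (S.erase a).erase b := by
    ext i; simp; tauto
  rw [m, h2]
  simp only [Sym2.mem_iff, forall_eq_or_imp, forall_eq]

lemma m_rec (x : ℝ) (L : List (Sym2 V)) (hL : ∀ e ∈ L, ¬ e.IsDiag) (S : Finset V) (u : V) (hu : u ∈ S) :
    m x L S = x * m x L (S.erase u) -
      ∑ v ∈ S.erase u, (L.count s(u,v) : ℝ) * m x L ((S.erase u).erase v) := by
  induction L generalizing S with
  | nil =>
    simp only [m, List.count_nil, Nat.cast_zero, zero_mul, Finset.sum_const_zero, sub_zero]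
    rw [Finset.card_erase_of_mem hu, ← pow_succ', Nat.sub_add_cancel (Finset.card_pos.2 ⟨u, hu⟩)]
  | cons e L ih =>
    have ih' := ih (fun e he => hL e (List.mem_cons_of_mem _ he))
    have he := hL e List.mem_cons_self
    by_cases hue : u ∈ e
    · obtain ⟨b, rfl⟩ := Sym2.mem_iff_exists.1 hue
      have hub : u ≠ b := by simpa using he
      simp only [m_cons, ih' S hu]
      simp only [Finset.mem_erase, ne_eq, not_true_eq_false, false_and, and_false, if_false, sub_zero,
        List.count_cons]
      have : ∀ v, ((L.count s(u,v) + if (s(u,b) == s(u,v)) = true then 1 else 0 : ℕ) : ℝ) =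
          L.count s(u,v) + if v = b then 1 else 0 := by
        intro v
        by_cases h : v = b
        · simp [h]
        · have : ¬ b = v := fun h' => h h'.symm
          simp [h, this, hub, hub.symm]
      simp only [this, add_mul, Finset.sum_add_distrib, ite_mul, one_mul, zero_mul, Finset.sum_ite_eq', hu, true_and,
        Finset.mem_erase, hub.symm, ne_eq, not_false_eq_true]
      ring
    · induction e using Sym2.ind with
      | _ a b =>
      have hua : u ≠ a := fun h => hue (by simp [h])
      have hub : u ≠ b := fun h => hue (by simp [h])
      have hc : ∀ v, (s(a,b) :: L).count s(u,v) = L.count s(u,v) := by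
        intro v
        rw [List.count_cons]
        simp [hua.symm, hub.symm]
      simp only [hc, m_cons]
      by_cases hS : a ∈ S ∧ b ∈ S
      · have hu' : u ∈ (S.erase a).erase b := by simp [hu, hua, hub]
        rw [ih' S hu, ih' _ hu']
        simp only [hS.1, hS.2, Finset.mem_erase, hua.symm, hub.symm, ne_eq, not_false_eq_true, and_true, true_and,
          if_true]
        have h1 : ((S.erase a).erase b).erase u = ((S.erase u).erase a).erase b := by
          ext i; simp; tauto
        have h2 : ((S.erase u).erase a).erase b = (S.erase u).filter (fun v => ¬ a = v ∧ ¬ b = v) := by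
          ext i; simp; tauto
        have h3 : ∀ v, (((S.erase u).erase v).erase a).erase b = (((S.erase u).erase a).erase b).erase v := by
          intro v; ext i; simp; tauto
        simp only [h1, h3, mul_sub, Finset.sum_sub_distrib]
        have h4 : ∑ v ∈ ((S.erase u).erase a).erase b, (L.count s(u,v) : ℝ) *
            m x L ((((S.erase u).erase a).erase b).erase v) = ∑ v ∈ S.erase u, (L.count s(u,v) : ℝ) *
            (if ¬ a = v ∧ ¬ b = v then m x L ((((S.erase u).erase a).erase b).erase v) else 0) := by
          simp only [mul_ite, mul_zero]
          rw [← Finset.sum_filter, ← h2]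
        rw [h4]
        ring
      · have h1 : ∀ T : Finset V, T ⊆ S → ¬ (a ∈ T ∧ b ∈ T) := fun T hT h => hS ⟨hT h.1, hT h.2⟩
        rw [if_neg hS, if_neg (h1 _ (Finset.erase_subset _ _)), sub_zero, sub_zero, ih' S hu]
        congr 1
        refine Finset.sum_congr rfl fun v _ => ?_
        rw [if_neg (h1 _ ((Finset.erase_subset _ _).trans (Finset.erase_subset _ _))), sub_zero]

lemma m_pos (G : SimpleGraph V) [DecidableRel G.Adj] (d : ℕ) (hd : 3 ≤ d)
    (hreg : G.IsRegularOfDegree d) (x : ℝ) (hx : 2 * Real.sqrt ((d : ℝ) - 1) < x) (S : Finset V) :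
    0 < m x G.edgeFinset.toList S ∧ ∀ u ∈ S, (∃ w, G.Adj u w ∧ w ∉ S) →
      Real.sqrt ((d : ℝ) - 1) * m x G.edgeFinset.toList (S.erase u) ≤ m x G.edgeFinset.toList S := by
  have hd' : (3 : ℝ) ≤ d := by exact_mod_cast hd
  set r := Real.sqrt ((d : ℝ) - 1) with hr
  have hrr : r * r = d - 1 := Real.mul_self_sqrt (by linarith)
  have hr0 : 0 < r := Real.sqrt_pos.2 (by linarith)
  set L := G.edgeFinset.toList with hLdef
  have hL : ∀ e ∈ L, ¬ e.IsDiag := by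
    intro e he
    exact G.not_isDiag_of_mem_edgeFinset (by simpa [L] using he)
  have hcount : ∀ u v, L.count s(u,v) = if G.Adj u v then 1 else 0 := by
    intro u v
    split_ifs with h
    · exact List.count_eq_one_of_mem (Finset.nodup_toList _) (by simpa [L] using h)
    · exact List.count_eq_zero_of_not_mem (by simpa [L] using h)
  induction hn : S.card using Nat.strong_induction_on generalizing S with
  | _ n ih =>
  have main : ∀ u ∈ S, ∀ k : ℝ, (((S.erase u).filter (G.Adj u)).card : ℝ) ≤ k →
      0 < m x L (S.erase u) ∧ (2 * r - k / r) * m x L (S.erase u) ≤ m x L S := by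
    intro u hu k hk
    have hlt : (S.erase u).card < n := hn ▸ Finset.card_erase_lt_of_mem hu
    obtain ⟨h0, h1⟩ := ih _ hlt (S.erase u) rfl
    refine ⟨h0, ?_⟩
    rw [m_rec x L hL S u hu]
    have h2 : ∑ v ∈ S.erase u, (L.count s(u,v) : ℝ) * m x L ((S.erase u).erase v) ≤
        (k / r) * m x L (S.erase u) := by
      calc ∑ v ∈ S.erase u, (L.count s(u,v) : ℝ) * m x L ((S.erase u).erase v)
          = ∑ v ∈ (S.erase u).filter (G.Adj u), m x L ((S.erase u).erase v) := by
            rw [Finset.sum_filter]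
            refine Finset.sum_congr rfl fun v _ => ?_
            rw [hcount]; split_ifs <;> simp
        _ ≤ ∑ v ∈ (S.erase u).filter (G.Adj u), m x L (S.erase u) / r := by
            refine Finset.sum_le_sum fun v hv => ?_
            rw [Finset.mem_filter] at hv
            rw [le_div_iff₀ hr0, mul_comm]
            exact h1 v hv.1 ⟨u, hv.2.symm, by simp⟩
        _ = (((S.erase u).filter (G.Adj u)).card : ℝ) * (m x L (S.erase u) / r) := by
            rw [Finset.sum_const, nsmul_eq_mul]
        _ ≤ k * (m x L (S.erase u) / r) := by gcongr
        _ = _ := by ring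
    nlinarith
  have hdeg : ∀ u, ((S.erase u).filter (G.Adj u)) ⊆ G.neighborFinset u := by
    intro u v hv
    simpa using (Finset.mem_filter.1 hv).2
  have hcard : ∀ u, (G.neighborFinset u).card = d := fun u => hreg u
  constructor
  · rcases S.eq_empty_or_nonempty with rfl | ⟨u, hu⟩
    · have : ∀ L : List (Sym2 V), m x L ∅ = 1 := by
        intro L
        induction L with
        | nil => simp [m]
        | cons e L ih =>
          induction e using Sym2.ind with
          | _ a b => simp [m_cons, ih]
      rw [this]; norm_num
    · obtain ⟨h0, h1⟩ := main u hu d (by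
        have := Finset.card_le_card (hdeg u); rw [hcard] at this; exact_mod_cast this)
      refine lt_of_lt_of_le (mul_pos ?_ h0) h1
      rw [sub_pos, div_lt_iff₀ hr0]; nlinarith
  · rintro u hu ⟨w, hw, hwS⟩
    obtain ⟨h0, h1⟩ := main u hu (d - 1) (by
        have : ((S.erase u).filter (G.Adj u)).card < (G.neighborFinset u).card := by
          refine Finset.card_lt_card ((Finset.ssubset_iff_of_subset (hdeg u)).2 ⟨w, by simpa using hw, ?_⟩)
          simp [hwS]
        rw [hcard] at this
        have : (((S.erase u).filter (G.Adj u)).card : ℝ) + 1 ≤ d := by exact_mod_cast this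
        linarith)
    have : 2 * r - ((d : ℝ) - 1) / r = r := by
      rw [← hrr]; field_simp; ring
    rwa [this] at h1

lemma start_pos (G : SimpleGraph V) [DecidableRel G.Adj] (d : ℕ) (hd : 3 ≤ d)
    (hreg : G.IsRegularOfDegree d) (x : ℝ) (hx : 2 * Real.sqrt ((d : ℝ) - 1) < x) :
    0 < P det G.edgeFinset.toList (x • (1 : Matrix V V ℝ)) := by
  have hL : ∀ e ∈ G.edgeFinset.toList, ¬ e.IsDiag := by
    intro e he
    exact G.not_isDiag_of_mem_edgeFinset (by simpa using he)
  have h := P_eq_m x G.edgeFinset.toList hL Finset.univ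
  have h1 : (fun M : Matrix V V ℝ => det (N Finset.univ M)) = det := by
    funext M; congr 1; ext i j; simp [N]
  rw [h1] at h
  rw [h]
  exact mul_pos (by positivity) (m_pos G d hd hreg x hx _).1
/-- positive imaginary part -/
def UH (M : Matrix V V ℂ) : Prop := ∀ v : V → ℂ, v ≠ 0 → 0 < (star v ⬝ᵥ M *ᵥ v).im

lemma UH.add_herm {M H : Matrix V V ℂ} (hM : UH M) (hH : H.IsHermitian) : UH (M + H) := by
  intro v hv
  have h1 : (star v ⬝ᵥ H *ᵥ v).im = 0 := hH.im_star_dotProduct_mulVec_self v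
  rw [add_mulVec, dotProduct_add, Complex.add_im, h1, add_zero]
  exact hM v hv

lemma UH.add_rank {M : Matrix V V ℂ} (hM : UH M) (w : V → ℂ) (hw : star w = w) (a : ℂ) (ha : 0 ≤ a.im) :
    UH (M + a • vecMulVec w w) := by
  intro v hv
  have h1 : star v ⬝ᵥ (a • vecMulVec w w) *ᵥ v = a * (Complex.normSq (w ⬝ᵥ v) : ℂ) := by
    have : star v ⬝ᵥ w = star (w ⬝ᵥ v) := by rw [star_dotProduct, hw]
    rw [smul_mulVec, dotProduct_smul, vecMulVec_mulVec, dotProduct_smul, this, smul_eq_mul,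
      Complex.normSq_eq_conj_mul_self]
    simp [mul_comm]
  rw [add_mulVec, dotProduct_add, Complex.add_im, h1]
  have h2 := hM v hv
  have h3 := Complex.normSq_nonneg (w ⬝ᵥ v)
  have : (a * (Complex.normSq (w ⬝ᵥ v) : ℂ)).im = a.im * Complex.normSq (w ⬝ᵥ v) := by
    simp
  rw [this]
  positivity

lemma UH.det_ne {M : Matrix V V ℂ} (hM : UH M) : det M ≠ 0 := by
  intro h
  obtain ⟨v, hv, h0⟩ := exists_mulVec_eq_zero_iff.2 h
  have := hM v hv
  simp [h0] at this

/-- w plus minus -/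
def w (R : Type*) [CommRing R] (s : R) (a b : V) : V → R := Pi.single a 1 + s • Pi.single b 1

/-- diagonal -/
def D (R : Type*) [CommRing R] (a b : V) : Matrix V V R :=
  diagonal (fun i => if i = a ∨ i = b then 1 else 0)

lemma vecw (R : Type*) [CommRing R] (s : R) (hs : s * s = 1) (a b : V) (hab : a ≠ b) :
    vecMulVec (w R s a b) (w R s a b) = D R a b + s • E R s(a,b) := by
  ext i j
  simp only [vecMulVec_apply, w, D, E, Pi.add_apply, Pi.smul_apply, Pi.single_apply, smul_eq_mul,
    Matrix.add_apply, diagonal_apply, Matrix.smul_apply, of_apply, Sym2.eq_iff]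
  by_cases hia : i = a
  · subst hia
    by_cases hja : j = i
    · subst hja; simp [hab]
    · simp [hja, hab, Ne.symm hja]
  · by_cases hib : i = b
    · subst hib
      by_cases hja : j = i
      · subst hja; simp [hab, hia, hs]
      · simp [hja, hab, Ne.symm hja, hia]
    · simp [hia, hib]

lemma quad (q0 q1 q2 : ℂ) (h : ∀ t : ℂ, 0 ≤ t.im → q0 + q1 * t + q2 * (t * t) ≠ 0) : q1 ≠ 2 * q0 := by
  intro h1
  subst h1
  have h0 : q0 ≠ 0 := by simpa using h 0 le_rfl
  -- w^2 q0 + 2 q0 w + q2 = 0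
  obtain ⟨y, hy⟩ := IsAlgClosed.exists_pow_nat_eq (1 - q2 / q0) (n := 2) (by norm_num)
  have key : ∀ w : ℂ, w ≠ 0 → w.im ≤ 0 → (w + 1) ^ 2 = 1 - q2 / q0 → False := by
    intro w hw him hr
    refine h w⁻¹ ?_ ?_
    · rw [Complex.inv_im]
      exact div_nonneg (by linarith) (Complex.normSq_nonneg _)
    · have : q2 = q0 * (1 - (w+1)^2) := by rw [hr]; field_simp; ring
      rw [this]; field_simp; ring
  by_cases hc : q2 = 0
  · exact key (-2) (by norm_num) (by simp) (by simp [hc]; norm_num)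
  · have hne : ∀ w : ℂ, (w + 1) ^ 2 = 1 - q2 / q0 → w ≠ 0 := by
      rintro w hr rfl
      have : q2 / q0 = 0 := by linear_combination hr
      simp [h0, hc] at this
    rcases le_total y.im 0 with hi | hi
    · have e : (y - 1 + 1) ^ 2 = 1 - q2 / q0 := by rw [← hy]; ring
      exact key (y - 1) (hne _ e) (by simpa using hi) e
    · have e : (-y - 1 + 1) ^ 2 = 1 - q2 / q0 := by rw [← hy]; ring
      exact key (-y - 1) (hne _ e) (by simpa using hi) e

lemma stable (L : List (Sym2 V)) (hL : ∀ e ∈ L, ¬ e.IsDiag) (M : Matrix V V ℂ) (hM : UH M) :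
    P det L M ≠ 0 := by
  induction L generalizing M with
  | nil => exact hM.det_ne
  | cons e L ih =>
    have ih' := ih (fun e he => hL e (List.mem_cons_of_mem _ he))
    have he := hL e List.mem_cons_self
    induction e using Sym2.ind with
    | _ a b =>
    have hab : a ≠ b := by simpa using he
    set W₁ := vecMulVec (w ℂ 1 a b) (w ℂ 1 a b) with hW₁
    set W₂ := vecMulVec (w ℂ (-1) a b) (w ℂ (-1) a b) with hW₂
    have e1 := vecw ℂ 1 (by norm_num) a b hab
    have e2 := vecw ℂ (-1) (by norm_num) a b hab
    have s1 : star (w ℂ 1 a b) = w ℂ 1 a b := by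
      ext i; simp [w, Pi.single_apply, apply_ite (starRingEnd ℂ)]
    have s2 : star (w ℂ (-1) a b) = w ℂ (-1) a b := by
      ext i; simp [w, Pi.single_apply, apply_ite (starRingEnd ℂ)]
    set K := M + D ℂ a b with hK
    have hKU : UH K := hM.add_herm (by
      refine Matrix.isHermitian_diagonal_of_self_adjoint _ ?_
      ext i; simp [apply_ite (starRingEnd ℂ)])
    have f1 : M - E ℂ s(a,b) = K + (-1 : ℂ) • W₁ := by rw [hW₁, e1, hK]; module
    have f2 : M + E ℂ s(a,b) = K + (-1 : ℂ) • W₂ := by rw [hW₂, e2, hK]; module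
    have q := quad (P det L K) ((P det L (K + W₁) - P det L K) + (P det L (K + W₂) - P det L K))
      ((P det L (K + W₁ + W₂) - P det L (K + W₁)) - (P det L (K + W₂) - P det L K)) (by
        intro t ht
        have := ih' _ ((hKU.add_rank _ s1 t ht).add_rank _ s2 t ht)
        rw [P_rank_one, P_rank_one, add_right_comm K, P_rank_one] at this
        intro h0
        apply this
        rw [add_right_comm K W₁ W₂] at h0
        rw [← h0]
        ring)
    simp only [P]
    rw [f1, f2, P_rank_one, P_rank_one]
    intro h0
    apply q
    linear_combination -h0
/-- the polynomial of expected characteristic polynomials -/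
noncomputable def pol (L : List (Sym2 V)) (A : Matrix V V ℝ) : ℝ[X] := P det L (charmatrix A)

lemma pol_eval (L : List (Sym2 V)) (A : Matrix V V ℝ) (x : ℝ) :
    (pol L A).eval x = P det L (x • (1 : Matrix V V ℝ) - A) := by
  have := P_map (evalRingHom x) L (charmatrix A)
  rw [coe_evalRingHom] at this
  rw [pol, this]
  congr 1
  ext i j
  simp [charmatrix_apply, diagonal_apply, Matrix.one_apply, apply_ite (eval x)]

lemma pol_aeval (L : List (Sym2 V)) (A : Matrix V V ℝ) (z : ℂ) :
    aeval z (pol L A) = P det L (z • (1 : Matrix V V ℂ) - A.map (fun r : ℝ => (r : ℂ))) := by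
  have := P_map ((aeval z : ℝ[X] →ₐ[ℝ] ℂ) : ℝ[X] →+* ℂ) L (charmatrix A)
  rw [pol]
  refine this.trans ?_
  congr 1
  ext i j
  simp [charmatrix_apply, diagonal_apply, Matrix.one_apply, apply_ite (aeval z)]

lemma E_map (e : Sym2 V) : (E ℝ e).map C = E ℝ[X] e := by
  ext i j; simp only [E, map_apply, of_apply]; split_ifs <;> simp

lemma pol_cons (e : Sym2 V) (L : List (Sym2 V)) (A : Matrix V V ℝ) :
    pol (e :: L) A = pol L (A + E ℝ e) + pol L (A - E ℝ e) := by
  simp only [pol, P]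
  congr 2
  · rw [← E_map]; ext1 i j; simp [charmatrix_apply]; ring
  · rw [← E_map]; ext1 i j; simp [charmatrix_apply]; ring

lemma pol_deg (L : List (Sym2 V)) (A : Matrix V V ℝ) :
    (pol L A).natDegree ≤ Fintype.card V ∧ (pol L A).coeff (Fintype.card V) = 2 ^ L.length := by
  induction L generalizing A with
  | nil =>
    have h : pol [] A = A.charpoly := rfl
    rw [h]
    have h1 := A.charpoly_natDegree_eq_dim
    refine ⟨h1.le, ?_⟩
    have := A.charpoly_monic
    rw [Monic, leadingCoeff, h1] at this
    simpa using this
  | cons e L ih =>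
    rw [pol_cons]
    refine ⟨natDegree_add_le_of_degree_le (ih _).1 (ih _).1, ?_⟩
    rw [coeff_add, (ih _).2, (ih _).2, List.length_cons]; ring

lemma pol_deg' (L : List (Sym2 V)) (A : Matrix V V ℝ) :
    (pol L A).degree = Fintype.card V ∧ (pol L A).leadingCoeff = 2 ^ L.length := by
  obtain ⟨h1, h2⟩ := pol_deg L A
  have h3 : (pol L A).natDegree = Fintype.card V :=
    natDegree_eq_of_le_of_coeff_ne_zero h1 (by rw [h2]; positivity)
  have h4 : pol L A ≠ 0 := by
    intro h
    rw [h] at h2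
    simp at h2
    exact absurd h2.symm (by positivity)
  exact ⟨by rw [degree_eq_natDegree h4, h3], by rw [leadingCoeff, h3, h2]⟩

open scoped ComplexOrder in
lemma UH_base (A : Matrix V V ℝ) (hA : A.IsSymm) (z : ℂ) (hz : 0 < z.im) :
    UH (z • (1 : Matrix V V ℂ) - A.map (fun r : ℝ => (r : ℂ))) := by
  rw [sub_eq_add_neg]
  apply UH.add_herm
  · intro v hv
    rw [smul_mulVec, one_mulVec, dotProduct_smul]
    have h1 : 0 < star v ⬝ᵥ v := dotProduct_star_self_pos_iff.2 hv
    rw [Complex.lt_def] at h1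
    simp at h1
    rw [smul_eq_mul, Complex.mul_im]
    rw [← h1.2]
    simp
    exact mul_pos hz h1.1
  · ext i j
    simp [hA.apply]

lemma wronsk_aux (g h : ℝ[X]) (H : ∀ z : ℂ, 0 < z.im → 0 ≤ (aeval z g * (starRingEnd ℂ) (aeval z h)).im) (x : ℝ) :
    0 ≤ g.derivative.eval x * h.eval x - g.eval x * h.derivative.eval x := by
  have e1 : ∀ (p : ℝ[X]), ((aeval (x : ℂ)) p) = ((p.eval x : ℝ) : ℂ) := fun p => by
    have := aeval_algebraMap_apply ℂ x p
    simpa using this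
  let F : ℝ → ℝ := fun t => (aeval ((x : ℂ) + t * Complex.I) g * aeval ((x : ℂ) - t * Complex.I) h).im
  have hF0 : F 0 = 0 := by
    simp only [F, Complex.ofReal_zero, zero_mul, add_zero, sub_zero]
    rw [e1, e1]
    simp
  have hFpos : ∀ t, 0 < t → 0 ≤ F t := by
    intro t ht
    have := H ((x : ℂ) + t * Complex.I) (by simpa using ht)
    rw [← aeval_conj] at this
    simpa [F, sub_eq_add_neg] using this
  have hd1 : HasDerivAt (fun t : ℝ => aeval ((x : ℂ) + t * Complex.I) g)
      ((g.derivative.eval x : ℝ) * Complex.I) 0 := by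
    have h1 : HasDerivAt (fun t : ℝ => (x : ℂ) + t * Complex.I) Complex.I 0 := by
      simpa using ((Complex.ofRealCLM.hasDerivAt (x := 0)).mul_const Complex.I).const_add (x : ℂ)
    have h2 := (g.hasDerivAt_aeval ((x : ℂ) + (0:ℝ) * Complex.I)).comp (0:ℝ) h1
    exact h2.congr_deriv (by simp [e1])
  have hd2 : HasDerivAt (fun t : ℝ => aeval ((x : ℂ) - t * Complex.I) h)
      (-((h.derivative.eval x : ℝ) * Complex.I)) 0 := by
    have h1 : HasDerivAt (fun t : ℝ => (x : ℂ) - t * Complex.I) (-Complex.I) 0 := by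
      simpa using ((Complex.ofRealCLM.hasDerivAt (x := 0)).mul_const Complex.I).const_sub (x : ℂ)
    have h2 := (h.hasDerivAt_aeval ((x : ℂ) - (0:ℝ) * Complex.I)).comp (0:ℝ) h1
    exact h2.congr_deriv (by simp [e1])
  have hd3 := hd1.mul hd2
  have hd4 : HasDerivAt F (g.derivative.eval x * h.eval x - g.eval x * h.derivative.eval x) 0 := by
    have := (Complex.imCLM.hasFDerivAt.comp_hasDerivAt (0:ℝ) hd3)
    refine this.congr_deriv ?_
    simp [e1]; ring
  -- slope
  have hs := hd4.tendsto_slope_zero_right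
  refine ge_of_tendsto hs ?_
  filter_upwards [self_mem_nhdsWithin] with t ht
  have ht' : 0 < t := ht
  simp only [zero_add, hF0, sub_zero, smul_eq_mul]
  exact mul_nonneg (by positivity) (hFpos t ht')

lemma wronsk (L : List (Sym2 V)) (hL : ∀ e ∈ L, ¬ e.IsDiag) (A : Matrix V V ℝ) (hA : A.IsSymm) (w : V → ℝ) (x : ℝ) :
    0 ≤ (pol L A).eval x * (pol L (A + vecMulVec w w)).derivative.eval x -
      (pol L A).derivative.eval x * (pol L (A + vecMulVec w w)).eval x := by
  set g := pol L A
  set f := pol L (A + vecMulVec w w)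
  have := wronsk_aux g (g - f) (by
    intro z hz
    set wc : V → ℂ := fun i => (w i : ℂ)
    set K := z • (1 : Matrix V V ℂ) - A.map (fun r : ℝ => (r : ℂ)) with hK
    have hU := UH_base A hA z hz
    have hg : aeval z g = P det L K := pol_aeval _ _ _
    have hf : aeval z f = P det L (K + (-1 : ℂ) • vecMulVec wc wc) := by
      rw [pol_aeval]; congr 1
      ext i j; simp [K, wc, vecMulVec_apply]; ring
    rw [map_sub, hf, hg, P_rank_one]
    set G := P det L K
    set H := P det L (K + vecMulVec wc wc) - G
    have e : G - (G + -1 * H) = H := by ring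
    rw [e]
    by_cases hH : H = 0
    · simp [hH]
    · by_contra hneg
      push Not at hneg
      have := stable L hL _ (hU.add_rank wc (by ext i; simp [wc]) (-(G / H)) (by
        rw [Complex.neg_im, neg_nonneg]
        have : G / H = G * (starRingEnd ℂ) H * ((Complex.normSq H)⁻¹ : ℝ) := by
          rw [div_eq_mul_inv, Complex.inv_def]; push_cast; ring
        rw [this, Complex.im_mul_ofReal]
        exact mul_nonpos_of_nonpos_of_nonneg hneg.le (inv_nonneg.2 (Complex.normSq_nonneg _))))
      rw [P_rank_one] at this
      apply this
      change G + -(G / H) * H = 0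
      field_simp; ring) x
  simp only [derivative_sub, eval_sub] at this
  linarith
open Filter Topology in
lemma pos_of_no_root (g : ℝ[X]) (hg : 0 < g.leadingCoeff) (R : ℝ) (h : ∀ x, R < x → g.eval x ≠ 0) :
    ∀ x, R < x → 0 < g.eval x := by
  intro x hx
  by_contra hneg
  push Not at hneg
  have hev : ∀ᶠ y in atTop, 0 < g.eval y := by
    by_cases hd : 0 < g.degree
    · exact (g.tendsto_atTop_of_leadingCoeff_nonneg hd hg.le).eventually_gt_atTop 0
    · have := eq_C_of_degree_le_zero (not_lt.1 hd)
      rw [this] at hg ⊢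
      simp at hg
      simp [hg]
  obtain ⟨y, hy0, hy⟩ := (hev.and (eventually_ge_atTop x)).exists
  obtain ⟨c, hc, hc0⟩ := intermediate_value_Icc hy g.continuous.continuousOn ⟨hneg, hy0.le⟩
  exact h c (lt_of_lt_of_le hx hc.1) hc0

lemma ratio_mono (g f : ℝ[X]) (R : ℝ) (hg : ∀ x, R < x → 0 < g.eval x)
    (W : ∀ x, 0 ≤ g.eval x * f.derivative.eval x - g.derivative.eval x * f.eval x) :
    MonotoneOn (fun x => f.eval x / g.eval x) (Set.Ioi R) := by
  have hd : ∀ x ∈ Set.Ioi R, HasDerivAt (fun x => f.eval x / g.eval x)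
      ((f.derivative.eval x * g.eval x - f.eval x * g.derivative.eval x) / (g.eval x) ^ 2) x :=
    fun x hx => (f.hasDerivAt x).div (g.hasDerivAt x) (hg x hx).ne'
  refine monotoneOn_of_deriv_nonneg (convex_Ioi R)
    (fun x hx => (hd x hx).continuousAt.continuousWithinAt) ?_ ?_
  · rw [interior_Ioi]
    exact fun x hx => (hd x hx).differentiableAt.differentiableWithinAt
  · rw [interior_Ioi]
    intro x hx
    rw [(hd x hx).deriv]
    have := W x
    exact div_nonneg (by linarith) (sq_nonneg _)

open Filter Topology in
lemma interlace (g f₁ f₂ : ℝ[X]) (hg : 0 < g.leadingCoeff)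
    (d1 : f₁.degree = g.degree) (d2 : f₂.degree = g.degree)
    (l1 : f₁.leadingCoeff = g.leadingCoeff) (l2 : f₂.leadingCoeff = g.leadingCoeff)
    (W₁ : ∀ x, 0 ≤ g.eval x * f₁.derivative.eval x - g.derivative.eval x * f₁.eval x)
    (W₂ : ∀ x, 0 ≤ g.eval x * f₂.derivative.eval x - g.derivative.eval x * f₂.eval x)
    (R : ℝ) (h : ∀ x, R < x → 0 < f₁.eval x + f₂.eval x) :
    (∀ x, R < x → 0 < f₁.eval x) ∨ (∀ x, R < x → 0 < f₂.eval x) := by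
  have hg0 : g ≠ 0 := by rintro rfl; simp at hg
  have hgR : ∀ x, R < x → 0 < g.eval x := by
    apply pos_of_no_root g hg
    by_contra hc
    push Not at hc
    obtain ⟨y, hy, hy0⟩ := hc
    obtain ⟨ρ, hρ, hmax⟩ := g.roots.toFinset.exists_max_image id ⟨y, by simp [hg0, hy0]⟩
    simp only [Multiset.mem_toFinset, mem_roots hg0, IsRoot.def, id] at hρ hmax
    have hgρ : ∀ x, ρ < x → 0 < g.eval x := by
      apply pos_of_no_root g hg
      intro x hx hx0
      linarith [hmax x hx0]
    have key : ∀ f : ℝ[X], f.degree = g.degree → f.leadingCoeff = g.leadingCoeff →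
        (∀ x, 0 ≤ g.eval x * f.derivative.eval x - g.derivative.eval x * f.eval x) → f.eval ρ ≤ 0 := by
      intro f hd hl W
      have hm := ratio_mono g f ρ hgρ W
      have hlim := f.div_tendsto_atTop_leadingCoeff_div_of_degree_eq g hd
      rw [hl, div_self hg.ne'] at hlim
      have hle : ∀ x, ρ < x → f.eval x ≤ g.eval x := by
        intro x hx
        have : f.eval x / g.eval x ≤ 1 := by
          refine ge_of_tendsto hlim ?_
          filter_upwards [eventually_ge_atTop x] with z hz
          exact hm hx (lt_of_lt_of_le hx hz) hz
        exact (div_le_one (hgρ x hx)).1 this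
      rw [← hρ]
      have t1 : Tendsto (fun x => f.eval x) (𝓝[>] ρ) (𝓝 (f.eval ρ)) := f.continuous.continuousWithinAt
      have t2 : Tendsto (fun x => g.eval x) (𝓝[>] ρ) (𝓝 (g.eval ρ)) := g.continuous.continuousWithinAt
      refine le_of_tendsto_of_tendsto t1 t2 ?_
      filter_upwards [self_mem_nhdsWithin] with x hx
      exact hle x hx
    have := h ρ (lt_of_lt_of_le hy (hmax y hy0))
    linarith [key f₁ d1 l1 W₁, key f₂ d2 l2 W₂]
  by_contra hc
  push Not at hc
  obtain ⟨⟨x, hx, hx0⟩, ⟨y, hy, hy0⟩⟩ := hc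
  have hz : R < min x y := lt_min hx hy
  have key : ∀ f : ℝ[X], (∀ x, 0 ≤ g.eval x * f.derivative.eval x - g.derivative.eval x * f.eval x) →
      ∀ x, R < x → f.eval x ≤ 0 → ∀ z, R < z → z ≤ x → f.eval z ≤ 0 := by
    intro f W x hx hx0 z hz hzx
    have h1 : f.eval z / g.eval z ≤ f.eval x / g.eval x := ratio_mono g f R hgR W hz hx hzx
    have h2 : f.eval x / g.eval x ≤ 0 := div_nonpos_of_nonpos_of_nonneg hx0 (hgR x hx).le
    by_contra hcc
    push Not at hcc
    have := div_pos hcc (hgR z hz)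
    linarith
  have := h _ hz
  linarith [key f₁ W₁ x hx hx0 _ hz (min_le_left _ _), key f₂ W₂ y hy hy0 _ hz (min_le_right _ _)]

/-- signings of a list of edges -/
def Sgn : List (Sym2 V) → Matrix V V ℝ → Prop
  | [], B => B = 0
  | e :: L, B => ∃ B', Sgn L B' ∧ (B = E ℝ e + B' ∨ B = - E ℝ e + B')

lemma exists_sgn (L : List (Sym2 V)) (hL : ∀ e ∈ L, ¬ e.IsDiag) (A : Matrix V V ℝ) (hA : A.IsSymm)
    (R : ℝ) (h : ∀ x, R < x → 0 < (pol L A).eval x) :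
    ∃ B, Sgn L B ∧ ∀ x, R < x → 0 < (A + B).charpoly.eval x := by
  induction L generalizing A with
  | nil => exact ⟨0, rfl, by rw [add_zero]; exact h⟩
  | cons e L ih =>
    have hL' := (fun e he => hL e (List.mem_cons_of_mem _ he) : ∀ e ∈ L, ¬ e.IsDiag)
    have he := hL e List.mem_cons_self
    have hEs := E_isSymm ℝ e
    have hor : (∀ x, R < x → 0 < (pol L (A + E ℝ e)).eval x) ∨
        (∀ x, R < x → 0 < (pol L (A - E ℝ e)).eval x) := by
      induction e using Sym2.ind with
      | _ a b =>
      have hab : a ≠ b := by simpa using he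
      have hD : (A - D ℝ a b).IsSymm := hA.sub (isSymm_diagonal _)
      have e1 := vecw ℝ 1 (by norm_num) a b hab
      have e2 := vecw ℝ (-1) (by norm_num) a b hab
      have f1 : A + E ℝ s(a,b) = A - D ℝ a b + vecMulVec (w ℝ 1 a b) (w ℝ 1 a b) := by
        rw [e1]; module
      have f2 : A - E ℝ s(a,b) = A - D ℝ a b + vecMulVec (w ℝ (-1) a b) (w ℝ (-1) a b) := by
        rw [e2]; module
      apply interlace (pol L (A - D ℝ a b))
      · rw [(pol_deg' _ _).2]; positivity
      · rw [(pol_deg' _ _).1, (pol_deg' _ _).1]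
      · rw [(pol_deg' _ _).1, (pol_deg' _ _).1]
      · rw [(pol_deg' _ _).2, (pol_deg' _ _).2]
      · rw [(pol_deg' _ _).2, (pol_deg' _ _).2]
      · rw [f1]; exact wronsk L hL' _ hD _
      · rw [f2]; exact wronsk L hL' _ hD _
      · intro x hx
        have := h x hx
        rwa [pol_cons, eval_add] at this
    rcases hor with h1 | h1
    · obtain ⟨B, hB, hB'⟩ := ih hL' _ (hA.add hEs) h1
      exact ⟨E ℝ e + B, ⟨B, hB, Or.inl rfl⟩, by simpa only [add_assoc] using hB'⟩
    · obtain ⟨B, hB, hB'⟩ := ih hL' _ (hA.sub hEs) h1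
      exact ⟨-E ℝ e + B, ⟨B, hB, Or.inr rfl⟩, by simpa only [add_assoc, sub_eq_add_neg] using hB'⟩

lemma sgn_prop (L : List (Sym2 V)) (hL : L.Nodup) (B : Matrix V V ℝ) (h : Sgn L B) :
    B.IsSymm ∧ (∀ u v, s(u,v) ∈ L → B u v = 1 ∨ B u v = -1) ∧ (∀ u v, s(u,v) ∉ L → B u v = 0) := by
  induction L generalizing B with
  | nil =>
    have : B = 0 := h
    subst this
    simp [Matrix.isSymm_zero]
  | cons e L ih =>
    obtain ⟨B', hB', h⟩ := h
    rw [List.nodup_cons] at hL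
    obtain ⟨i1, i2, i3⟩ := ih hL.2 B' hB'
    have hE1 : ∀ u v, s(u,v) = e → E ℝ e u v = 1 := fun u v h => by simp [E, h]
    have hE0 : ∀ u v, s(u,v) ≠ e → E ℝ e u v = 0 := fun u v h => by simp [E, h]
    refine ⟨?_, ?_, ?_⟩
    · rcases h with rfl | rfl
      · exact (E_isSymm ℝ e).add i1
      · exact (E_isSymm ℝ e).neg.add i1
    · intro u v huv
      by_cases hu : s(u,v) = e
      · have h3 := i3 u v (hu ▸ hL.1)
        have h4 := hE1 u v hu
        rcases h with rfl | rfl <;> simp [h3, h4]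
      · have h3 := i2 u v ((List.mem_cons.1 huv).resolve_left hu)
        have h4 := hE0 u v hu
        rcases h with rfl | rfl <;> simpa [h4] using h3
    · intro u v huv
      rw [List.mem_cons, not_or] at huv
      have h3 := i3 u v huv.2
      have h4 := hE0 u v huv.1
      rcases h with rfl | rfl <;> simp [h3, h4]
end BL


/-- Marcus–Spielman–Srivastava (one-sided Bilu–Linial conjecture): every `d`-regular
graph (`d ≥ 3`) admits a signing of its edges so that all eigenvalues of the signed
adjacency matrix are at most `2√(d-1)`. -/
theorem bilu_linial_signing {V : Type*} [Fintype V] [DecidableEq V]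
    (G : SimpleGraph V) [DecidableRel G.Adj] (d : ℕ) (hd : 3 ≤ d)
    (hreg : G.IsRegularOfDegree d) :
    ∃ B : Matrix V V ℝ,
      B.IsSymm ∧
      (∀ u v, G.Adj u v → B u v = 1 ∨ B u v = -1) ∧
      (∀ u v, ¬ G.Adj u v → B u v = 0) ∧
      ∀ μ : ℝ, Module.End.HasEigenvalue (Matrix.toLin' B) μ →
        μ ≤ 2 * Real.sqrt ((d : ℝ) - 1) := by

  obtain ⟨B, hB, hB'⟩ := BL.exists_sgn G.edgeFinset.toList
    (fun e he => G.not_isDiag_of_mem_edgeFinset (by simpa using he)) 0 Matrix.isSymm_zero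
    (2 * Real.sqrt ((d : ℝ) - 1)) (by
      intro x hx
      rw [BL.pol_eval, sub_zero]
      exact BL.start_pos G d hd hreg x hx)
  obtain ⟨h1, h2, h3⟩ := BL.sgn_prop _ (Finset.nodup_toList _) B hB
  refine ⟨B, h1, fun u v h => h2 u v (by simpa using h), fun u v h => h3 u v (by simpa using h), ?_⟩
  intro μ hμ
  by_contra hlt
  push Not at hlt
  have h4 := hB' μ hlt
  rw [zero_add] at h4
  rw [Module.End.hasEigenvalue_iff_isRoot_charpoly, Matrix.charpoly_toLin', Polynomial.IsRoot.def] at hμ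
  linarith
end

section
/- For every ρ with 0 ≤ ρ < 1 and every ε > 0, there exists τ > 0 (an influence bound depending only on ρ and ε) such that for every n and every function f : {−1,1}ⁿ → [−1,1] with E[f(x)] = 0 (under the uniform distribution) and with Inf_i(f) ≤ τ for every coordinate i, the noise stability satisfies S_ρ(f) ≤ (2/π)·arcsin(ρ) + ε. -/
open Finset

/-- Expectation of `f` on the Boolean cube `{-1,1}ⁿ` (coded by `Fin n → Bool`)
under the uniform measure. -/
noncomputable def cubeMean (n : ℕ) (f : (Fin n → Bool) → ℝ) : ℝ :=
  (∑ x : Fin n → Bool, f x) / 2 ^ n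

/-- Noise stability of `f` at correlation `ρ`: the expectation of `f x * f y` over a
`ρ`-correlated pair `(x, y)`; `x` is uniform and each bit of `y` equals the corresponding
bit of `x` with probability `(1+ρ)/2`, independently. -/
noncomputable def noiseStability (n : ℕ) (ρ : ℝ) (f : (Fin n → Bool) → ℝ) : ℝ :=
  (∑ x : Fin n → Bool, ∑ y : Fin n → Bool,
    f x * f y * ∏ i : Fin n, (if x i = y i then (1 + ρ) / 2 else (1 - ρ) / 2)) / 2 ^ n

/-- The influence of coordinate `i` on `f : {-1,1}ⁿ → ℝ`: the expected conditional
variance of `f` in the `i`-th coordinate given the remaining coordinates,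
`E_x [((f x - f (x with bit i flipped))/2)²]`. -/
noncomputable def influence (n : ℕ) (i : Fin n) (f : (Fin n → Bool) → ℝ) : ℝ :=
  (∑ x : Fin n → Bool, ((f x - f (Function.update x i (!(x i)))) / 2) ^ 2) / 2 ^ n


namespace MIS
open Real MeasureTheory Filter Topology

noncomputable def gp (t : ℝ) : ℝ := √(2 / π) * exp (-(1/2) * t ^ 2)
noncomputable def gP (a : ℝ) : ℝ := ∫ t in (0:ℝ)..a, gp t

lemma gp_cont : Continuous gp := by unfold gp; fun_prop
lemma gp_pos (t : ℝ) : 0 < gp t := by unfold gp; positivity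

lemma gP_deriv (a : ℝ) : HasStrictDerivAt gP (gp a) a :=
  gp_cont.integral_hasStrictDerivAt 0 a

lemma gP_zero : gP 0 = 0 := by simp [gP]

lemma gP_neg (a : ℝ) : gP (-a) = - gP a := by
  unfold gP
  have h := intervalIntegral.integral_comp_neg (a := 0) (b := a) gp
  have h2 : (fun x => gp (-x)) = gp := by funext x; simp [gp]
  rw [h2] at h
  rw [h, intervalIntegral.integral_symm]; simp

lemma gP_mono : StrictMono gP := by
  apply strictMono_of_deriv_pos
  intro x
  rw [(gP_deriv x).hasDerivAt.deriv]; exact gp_pos x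

lemma gP_cont : Continuous gP :=
  continuous_iff_continuousAt.2 fun a => (gP_deriv a).hasDerivAt.continuousAt

lemma gP_tendsto : Tendsto gP atTop (𝓝 1) := by
  have hi : Integrable gp := (integrable_exp_neg_mul_sq (b := 1/2) (by norm_num)).const_mul _
  have h := intervalIntegral_tendsto_integral_Ioi (μ := volume) (f := gp) 0 hi.integrableOn tendsto_id
  have h2 : ∫ x in Set.Ioi (0:ℝ), gp x = 1 := by
    unfold gp
    rw [integral_const_mul, integral_gaussian_Ioi]
    rw [← mul_div_assoc, ← Real.sqrt_mul (by positivity)]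
    have : (2 / π * (π / (1/2))) = 2 ^ 2 := by field_simp
    rw [this, Real.sqrt_sq (by norm_num)]; norm_num
  rw [h2] at h; exact h

lemma gP_surj {x : ℝ} (h1 : -1 < x) (h2 : x < 1) : ∃ a, gP a = x := by
  have ha : ∃ a, x ≤ gP a := by
    obtain ⟨a, ha⟩ := (gP_tendsto.eventually (eventually_gt_nhds h2)).exists
    exact ⟨a, le_of_lt ha⟩
  have hb : ∃ a, gP a ≤ x := by
    obtain ⟨a, ha⟩ := (gP_tendsto.eventually (eventually_gt_nhds (show -x < 1 by linarith))).exists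
    exact ⟨-a, by rw [gP_neg]; linarith⟩
  exact mem_range_of_exists_le_of_exists_ge gP_cont hb ha

noncomputable def gI : ℝ → ℝ := Function.invFun gP

lemma gI_gP (a : ℝ) : gI (gP a) = a := Function.leftInverse_invFun gP_mono.injective a

lemma gP_gI {x : ℝ} (h1 : -1 < x) (h2 : x < 1) : gP (gI x) = x :=
  Function.invFun_eq (gP_surj h1 h2)

lemma gI_zero : gI 0 = 0 := by rw [← gP_zero, gI_gP, gP_zero]

lemma gI_deriv {x : ℝ} (h1 : -1 < x) (h2 : x < 1) : HasDerivAt gI (gp (gI x))⁻¹ x := by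
  obtain ⟨a, rfl⟩ := gP_surj h1 h2
  rw [gI_gP]
  exact ((gP_deriv a).to_local_left_inverse (gp_pos a).ne'
    (Eventually.of_forall gI_gP)).hasDerivAt

/-- the integrand -/
noncomputable def kq (a b t : ℝ) : ℝ := exp (-(a ^ 2 - 2 * sin t * a * b + b ^ 2) / (2 * cos t ^ 2))

noncomputable def kR (θ a b : ℝ) : ℝ := ∫ t in (0:ℝ)..θ, kq a b t

lemma kq_symm (a b t : ℝ) : kq a b t = kq b a t := by unfold kq; ring_nf
lemma kR_symm (θ a b : ℝ) : kR θ a b = kR θ b a := by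
  unfold kR; congr 1; funext t; exact kq_symm a b t

lemma kq_le_one (a b t : ℝ) : kq a b t ≤ 1 := by
  unfold kq
  rw [exp_le_one_iff, neg_div]
  have : 0 ≤ (a ^ 2 - 2 * sin t * a * b + b ^ 2) := by
    nlinarith [sq_nonneg (a - sin t * b), sin_sq_le_one t, sq_nonneg b]
  have : 0 ≤ (a ^ 2 - 2 * sin t * a * b + b ^ 2) / (2 * cos t ^ 2) := by positivity
  linarith

lemma kq_hasDeriv (a b t : ℝ) :
    HasDerivAt (fun a => kq a b t) (kq a b t * (-(a - sin t * b) / cos t ^ 2)) a := by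
  unfold kq
  have h : HasDerivAt (fun a : ℝ => -(a ^ 2 - 2 * sin t * a * b + b ^ 2) / (2 * cos t ^ 2))
      (-(2 * a - 2 * sin t * b) / (2 * cos t ^ 2)) a := by
    apply HasDerivAt.div_const
    apply HasDerivAt.neg
    have h1 := (hasDerivAt_pow 2 a)
    have h2 := ((hasDerivAt_id a).const_mul (2 * sin t)).mul_const b
    have h3 := (h1.sub h2).add_const (b ^ 2)
    simpa using h3
  convert h.exp using 2
  rw [show -(2 * a - 2 * sin t * b) = 2 * (-(a - sin t * b)) by ring, mul_div_mul_left _ _ (by norm_num)]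

variable {θ : ℝ}

lemma cos_pos_of (h1 : θ < π / 2) {t : ℝ} (ht : t ∈ Set.Icc 0 θ) : 0 < cos t :=
  cos_pos_of_mem_Ioo ⟨by linarith [ht.1, pi_pos], by linarith [ht.2]⟩

lemma kq_contOn (h1 : θ < π / 2) (a b : ℝ) : ContinuousOn (kq a b) (Set.Icc 0 θ) := by
  unfold kq
  apply ContinuousOn.rexp
  apply ContinuousOn.div (by fun_prop) (by fun_prop)
  intro t ht
  have := cos_pos_of h1 ht
  positivity

/-- partial derivative of the integral, before computing it -/
lemma kR_hasDeriv (h0 : 0 ≤ θ) (h1 : θ < π / 2) (a b : ℝ) :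
    HasDerivAt (fun a => kR θ a b) (∫ t in (0:ℝ)..θ, kq a b t * (-(a - sin t * b) / cos t ^ 2)) a := by
  have hu : Set.uIoc 0 θ ⊆ Set.Icc 0 θ := by rw [Set.uIoc_of_le h0]; exact Set.Ioc_subset_Icc_self
  have huI : Set.uIcc 0 θ = Set.Icc 0 θ := Set.uIcc_of_le h0
  have hcont : ContinuousOn (fun t => kq a b t * (-(a - sin t * b) / cos t ^ 2)) (Set.Icc 0 θ) := by
    apply (kq_contOn h1 a b).mul
    apply ContinuousOn.div (by fun_prop) (by fun_prop)
    intro t ht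
    have := cos_pos_of h1 ht
    positivity
  refine (intervalIntegral.hasDerivAt_integral_of_dominated_loc_of_deriv_le (𝕜 := ℝ)
    (F := fun a t => kq a b t)
    (F' := fun a t => kq a b t * (-(a - sin t * b) / cos t ^ 2))
    (bound := fun _ => (|a| + 1 + |b|) / cos θ ^ 2) (s := Metric.ball a 1)
    (Metric.ball_mem_nhds a one_pos) ?_ ?_ ?_ ?_ ?_ ?_).2
  · refine Eventually.of_forall fun x => ?_
    exact ((kq_contOn h1 x b).mono hu).aestronglyMeasurable measurableSet_uIoc
  · exact (by rw [huI]; exact kq_contOn h1 a b : ContinuousOn _ _).intervalIntegrable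
  · exact (hcont.mono hu).aestronglyMeasurable measurableSet_uIoc
  · refine Eventually.of_forall fun t ht x hx => ?_
    have ht := hu ht
    have hc := cos_pos_of h1 ht
    have hcθ := cos_pos_of h1 (Set.right_mem_Icc.2 h0)
    have hle : cos θ ≤ cos t := cos_le_cos_of_nonneg_of_le_pi ht.1 (by linarith [pi_pos]) ht.2
    have hx' : |x| ≤ |a| + 1 := by
      rw [Metric.mem_ball, Real.dist_eq] at hx
      have := abs_sub_abs_le_abs_sub x a
      linarith
    have h3 : |x - sin t * b| ≤ |a| + 1 + |b| := by
      refine (abs_sub _ _).trans ?_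
      rw [abs_mul]
      have := mul_le_mul_of_nonneg_right (abs_sin_le_one t) (abs_nonneg b)
      linarith
    rw [Real.norm_eq_abs, abs_mul, abs_div, abs_neg, abs_of_pos (show 0 < kq x b t from exp_pos _),
      abs_of_pos (pow_pos hc 2)]
    calc kq x b t * (|x - sin t * b| / cos t ^ 2) ≤ 1 * (|x - sin t * b| / cos t ^ 2) := by
          gcongr; exact kq_le_one _ _ _
      _ ≤ _ := by rw [one_mul]; gcongr
  · exact intervalIntegrable_const
  · exact Eventually.of_forall fun t _ x _ => kq_hasDeriv x b t

lemma gp_mul (a b t : ℝ) (hc : cos t ≠ 0) :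
    gp a * gp ((b - sin t * a) / cos t) = 2 / π * kq a b t := by
  unfold gp kq
  rw [mul_mul_mul_comm, Real.mul_self_sqrt (by positivity), ← Real.exp_add]
  congr 2
  field_simp
  have := sin_sq t
  have h2 := cos_sq' t
  rw [h2]; ring_nf

lemma kR_deriv_eq (h0 : 0 ≤ θ) (h1 : θ < π / 2) (a b : ℝ) :
    2 / π * ∫ t in (0:ℝ)..θ, kq a b t * (-(a - sin t * b) / cos t ^ 2)
      = gp a * gP ((b - sin θ * a) / cos θ) - gp a * gP b := by
  have huI : Set.uIcc 0 θ = Set.Icc 0 θ := Set.uIcc_of_le h0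
  rw [← intervalIntegral.integral_const_mul]
  rw [intervalIntegral.integral_eq_sub_of_hasDerivAt
    (f := fun t => gp a * gP ((b - sin t * a) / cos t))]
  · simp
  · intro t ht
    rw [huI] at ht
    have hc := cos_pos_of h1 ht
    have hu : HasDerivAt (fun t => (b - sin t * a) / cos t)
        (((-(cos t * a)) * cos t - (b - sin t * a) * (-sin t)) / cos t ^ 2) t := by
      apply HasDerivAt.div _ (hasDerivAt_cos t) hc.ne'
      simpa using ((hasDerivAt_sin t).mul_const a).const_sub b
    have := (((gP_deriv _).hasDerivAt.comp t hu)).const_mul (gp a)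
    refine this.congr_deriv ?_
    rw [← mul_assoc, ← mul_assoc, gp_mul a b t hc.ne']
    congr 2
    have := sin_sq_add_cos_sq t
    linear_combination (-a) * this
  · apply ContinuousOn.intervalIntegrable
    rw [huI]
    apply ContinuousOn.mul continuousOn_const
    apply (kq_contOn h1 a b).mul
    apply ContinuousOn.div (by fun_prop) (by fun_prop)
    intro t ht
    have := cos_pos_of h1 ht
    positivity

noncomputable def kK (θ a b : ℝ) : ℝ := gP a * gP b + 2 / π * kR θ a b

lemma kK_symm (θ a b : ℝ) : kK θ a b = kK θ b a := by unfold kK; rw [kR_symm]; ring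

lemma kK_deriv1 (h0 : 0 ≤ θ) (h1 : θ < π / 2) (a b : ℝ) :
    HasDerivAt (fun a => kK θ a b) (gp a * gP ((b - sin θ * a) / cos θ)) a := by
  have := ((gP_deriv a).hasDerivAt.mul_const (gP b)).add
    ((kR_hasDeriv h0 h1 a b).const_mul (2 / π))
  rw [kR_deriv_eq h0 h1] at this
  refine this.congr_deriv ?_
  ring

lemma kK_deriv (h0 : 0 ≤ θ) (h1 : θ < π / 2) {a b : ℝ → ℝ} {a' b' l : ℝ}
    (ha : HasDerivAt a a' l) (hb : HasDerivAt b b' l) :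
    HasDerivAt (fun l => kK θ (a l) (b l))
      (gp (a l) * gP ((b l - sin θ * a l) / cos θ) * a'
        + gp (b l) * gP ((a l - sin θ * b l) / cos θ) * b') l := by
  have hs := hasStrictFDerivAt_uncurry_coprod (𝕜 := ℝ) (u := (a l, b l)) (f := kK θ)
    (f₁ := fun a b => ContinuousLinearMap.toSpanSingleton ℝ (gp a * gP ((b - sin θ * a) / cos θ)))
    (f₂ := fun a b => ContinuousLinearMap.toSpanSingleton ℝ (gp b * gP ((a - sin θ * b) / cos θ)))
    (Eventually.of_forall fun v => (kK_deriv1 h0 h1 v.1 v.2).hasFDerivAt)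
    (Eventually.of_forall fun v => by
      have := (kK_deriv1 h0 h1 v.2 v.1).hasFDerivAt
      simp_rw [kK_symm θ _ v.1] at this
      exact this)
    (by
      have := gp_cont
      have := gP_cont
      apply Continuous.continuousAt
      change Continuous fun v : ℝ × ℝ => ContinuousLinearMap.toSpanSingleton ℝ (gp v.1 * gP ((v.2 - sin θ * v.1) / cos θ))
      refine (ContinuousLinearMap.toSpanSingletonCLE (𝕜 := ℝ) (E := ℝ)).continuous.comp ?_
      fun_prop)
    (by
      have := gp_cont
      have := gP_cont
      apply Continuous.continuousAt
      change Continuous fun v : ℝ × ℝ => ContinuousLinearMap.toSpanSingleton ℝ (gp v.2 * gP ((v.1 - sin θ * v.2) / cos θ))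
      refine (ContinuousLinearMap.toSpanSingletonCLE (𝕜 := ℝ) (E := ℝ)).continuous.comp ?_
      fun_prop)
  have := hs.hasFDerivAt.comp_hasDerivAt l (ha.prodMk hb)
  refine this.congr_deriv ?_
  simp [Function.HasUncurry.uncurry]
  ring

/-! Two point inequality -/

lemma antitone_aux {f f' : ℝ → ℝ} (h : ∀ l ∈ Set.Icc (0:ℝ) 1, HasDerivAt f (f' l) l)
    (hn : ∀ l ∈ Set.Icc (0:ℝ) 1, f' l ≤ 0) : ∀ l ∈ Set.Icc (0:ℝ) 1, f l ≤ f 0 := by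
  have : AntitoneOn f (Set.Icc 0 1) := by
    apply antitoneOn_of_deriv_nonpos (convex_Icc 0 1)
    · exact fun l hl => (h l hl).continuousAt.continuousWithinAt
    · exact fun l hl => (h l (interior_subset hl)).differentiableAt.differentiableWithinAt
    · intro l hl
      rw [(h l (interior_subset hl)).deriv]; exact hn l (interior_subset hl)
  intro l hl
  exact this (by simp) hl hl.1

lemma taylor_aux {f f' f'' : ℝ → ℝ} {M : ℝ} (h1 : ∀ l ∈ Set.Icc (0:ℝ) 1, HasDerivAt f (f' l) l)
    (h2 : ∀ l ∈ Set.Icc (0:ℝ) 1, HasDerivAt f' (f'' l) l)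
    (hM : ∀ l ∈ Set.Icc (0:ℝ) 1, f'' l ≤ M) (h0 : f' 0 = 0) : f 1 ≤ f 0 + M / 2 := by
  have k1 : ∀ l ∈ Set.Icc (0:ℝ) 1, f' l - M * l ≤ 0 := by
    intro l hl
    have := antitone_aux (f := fun l => f' l - M * l) (f' := fun l => f'' l - M)
      (fun l hl => ((h2 l hl).sub ((hasDerivAt_id l).const_mul M)).congr_deriv (by simp))
      (fun l hl => by linarith [hM l hl]) l hl
    simpa [h0] using this
  have := antitone_aux (f := fun l => f l - M / 2 * l ^ 2) (f' := fun l => f' l - M * l)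
      (fun l hl => by
        refine ((h1 l hl).sub ((hasDerivAt_pow 2 l).const_mul (M / 2))).congr_deriv ?_
        simp; ring) k1 1 (by simp)
  simp at this
  linarith

noncomputable def bB (θ x y : ℝ) : ℝ := kK θ (gI x) (gI y)
noncomputable def bG (θ x y : ℝ) : ℝ := gP ((gI y - sin θ * gI x) / cos θ)
noncomputable def bH1 (θ x y : ℝ) : ℝ :=
  gp ((gI y - sin θ * gI x) / cos θ) * (-(sin θ * (gp (gI x))⁻¹) / cos θ)
noncomputable def bH2 (θ x y : ℝ) : ℝ :=
  gp ((gI y - sin θ * gI x) / cos θ) * ((gp (gI y))⁻¹ / cos θ)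
noncomputable def bQ (θ x y h k : ℝ) : ℝ :=
  h * (h * bH1 θ x y + k * bH2 θ x y) + k * (k * bH1 θ y x + h * bH2 θ y x)

lemma gI_path {x h l : ℝ} (h1 : -1 < x + l * h) (h2 : x + l * h < 1) :
    HasDerivAt (fun l => gI (x + l * h)) ((gp (gI (x + l * h)))⁻¹ * h) l := by
  have := (gI_deriv h1 h2).comp l (((hasDerivAt_id l).mul_const h).const_add x)
  exact this.congr_deriv (by simp)

lemma bB_path (h0 : 0 ≤ θ) (h1 : θ < π / 2) {x y h k l : ℝ}
    (hx1 : -1 < x + l * h) (hx2 : x + l * h < 1) (hy1 : -1 < y + l * k) (hy2 : y + l * k < 1) :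
    HasDerivAt (fun l => bB θ (x + l * h) (y + l * k))
      (h * bG θ (x + l * h) (y + l * k) + k * bG θ (y + l * k) (x + l * h)) l := by
  refine (kK_deriv h0 h1 (gI_path hx1 hx2) (gI_path hy1 hy2)).congr_deriv ?_
  have e1 := (gp_pos (gI (x + l * h))).ne'
  have e2 := (gp_pos (gI (y + l * k))).ne'
  unfold bG
  field_simp

lemma bG_path {x y h k l : ℝ}
    (hx1 : -1 < x + l * h) (hx2 : x + l * h < 1) (hy1 : -1 < y + l * k) (hy2 : y + l * k < 1) :
    HasDerivAt (fun l => bG θ (x + l * h) (y + l * k))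
      (h * bH1 θ (x + l * h) (y + l * k) + k * bH2 θ (x + l * h) (y + l * k)) l := by
  have := (gP_deriv _).hasDerivAt.comp l
    (((gI_path hy1 hy2).sub ((gI_path hx1 hx2).const_mul (sin θ))).div_const (cos θ))
  refine this.congr_deriv ?_
  unfold bH1 bH2
  simp only [Pi.sub_apply]
  ring

lemma bQ_neg (h0 : 0 ≤ θ) (h1 : θ < π / 2) (x y h k : ℝ) :
    (1 + sin θ) / 2 * bQ θ x y h k + (1 - sin θ) / 2 * bQ θ x y h (-k) ≤ 0 := by
  have hc : 0 < cos θ := cos_pos_of h1 (Set.right_mem_Icc.2 h0)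
  have hs : 0 ≤ sin θ := sin_nonneg_of_nonneg_of_le_pi h0 (by linarith [pi_pos])
  have e1 := gp_mul (gI x) (gI y) θ hc.ne'
  have e2 := gp_mul (gI y) (gI x) θ hc.ne'
  rw [kq_symm, ← e1] at e2
  unfold bQ bH1 bH2
  have p1 := gp_pos (gI x)
  have p2 := gp_pos (gI y)
  set α := gp (gI x)
  set β := gp (gI y)
  set u := gp ((gI y - sin θ * gI x) / cos θ) with hu
  have pu : 0 < u := gp_pos _
  set v := gp ((gI x - sin θ * gI y) / cos θ)
  have hv : v = α * u / β := by field_simp; linarith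
  rw [hv]
  have : (1 + sin θ) / 2 * (h * (h * (u * (-(sin θ * α⁻¹) / cos θ)) + k * (u * (β⁻¹ / cos θ))) +
        k * (k * (α * u / β * (-(sin θ * β⁻¹) / cos θ)) + h * (α * u / β * (α⁻¹ / cos θ)))) +
      (1 - sin θ) / 2 * (h * (h * (u * (-(sin θ * α⁻¹) / cos θ)) + -k * (u * (β⁻¹ / cos θ))) +
        -k * (-k * (α * u / β * (-(sin θ * β⁻¹) / cos θ)) + h * (α * u / β * (α⁻¹ / cos θ))))
      = - (sin θ * u / (cos θ * α * β ^ 2) * (β * h - α * k) ^ 2) := by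
    field_simp
    ring
  rw [this]
  have : 0 ≤ sin θ * u / (cos θ * α * β ^ 2) * (β * h - α * k) ^ 2 := by positivity
  linarith

lemma bB_zero : bB θ 0 0 = 2 / π * θ := by
  simp [bB, kK, gI_zero, gP_zero, kR, kq]

lemma bB_bounds (h0 : 0 ≤ θ) (h1 : θ < π / 2) {x y : ℝ} (hx : |x| < 1) (hy : |y| < 1) :
    x * y ≤ bB θ x y ∧ |bB θ x y| ≤ 2 := by
  rw [abs_lt] at hx hy
  unfold bB kK
  rw [gP_gI hx.1 hx.2, gP_gI hy.1 hy.2]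
  have hi : IntervalIntegrable (kq (gI x) (gI y)) volume 0 θ := by
    apply ContinuousOn.intervalIntegrable
    rw [Set.uIcc_of_le h0]; exact kq_contOn h1 _ _
  have k1 : 0 ≤ kR θ (gI x) (gI y) :=
    intervalIntegral.integral_nonneg h0 fun t _ => (exp_pos _).le
  have k2 : kR θ (gI x) (gI y) ≤ θ := by
    have := intervalIntegral.integral_mono_on h0 hi (intervalIntegrable_const (c := (1:ℝ)))
      fun t _ => kq_le_one _ _ t
    simpa [kR] using this
  have k3 : 0 ≤ 2 / π * kR θ (gI x) (gI y) := by positivity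
  have k4 : 2 / π * kR θ (gI x) (gI y) ≤ 1 := by
    rw [div_mul_eq_mul_div, div_le_one pi_pos]; linarith
  have k5 : |x * y| ≤ 1 := by
    rw [abs_mul]; exact mul_le_one₀ (abs_le.2 ⟨hx.1.le, hx.2.le⟩) (abs_nonneg _) (abs_le.2 ⟨hy.1.le, hy.2.le⟩)
  refine ⟨by linarith, ?_⟩
  rw [abs_le] at k5 ⊢
  constructor <;> linarith

lemma gI_contOn : ContinuousOn gI (Set.Ioo (-1) 1) :=
  fun _ hx => (gI_deriv hx.1 hx.2).continuousAt.continuousWithinAt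

lemma unif_aux {κ : ℝ} (H : ℝ → ℝ → ℝ) 
    (hH : ContinuousOn (fun p : ℝ × ℝ => H p.1 p.2) (Set.Icc (-κ) κ ×ˢ Set.Icc (-κ) κ))
    {e : ℝ} (he : 0 < e) : ∃ d > 0, ∀ x y x' y', x ∈ Set.Icc (-κ) κ → y ∈ Set.Icc (-κ) κ →
      x' ∈ Set.Icc (-κ) κ → y' ∈ Set.Icc (-κ) κ → |x' - x| < d → |y' - y| < d →
      |H x' y' - H x y| ≤ e := by
  have hc : IsCompact (Set.Icc (-κ) κ ×ˢ Set.Icc (-κ) κ) := isCompact_Icc.prod isCompact_Icc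
  have := hc.uniformContinuousOn_of_continuous hH
  rw [Metric.uniformContinuousOn_iff] at this
  obtain ⟨d, hd, h⟩ := this e he
  refine ⟨d, hd, fun x y x' y' hx hy hx' hy' h1 h2 => ?_⟩
  have := h (x', y') ⟨hx', hy'⟩ (x, y) ⟨hx, hy⟩ (by
    rw [Prod.dist_eq, Real.dist_eq, Real.dist_eq]; exact max_lt h1 h2)
  rw [Real.dist_eq] at this
  exact this.le

lemma bH_contOn {κ : ℝ} (h1 : κ < 1) :
    ContinuousOn (fun p : ℝ × ℝ => bH1 θ p.1 p.2) (Set.Icc (-κ) κ ×ˢ Set.Icc (-κ) κ) ∧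
    ContinuousOn (fun p : ℝ × ℝ => bH2 θ p.1 p.2) (Set.Icc (-κ) κ ×ˢ Set.Icc (-κ) κ) := by
  have hsub : Set.Icc (-κ) κ ⊆ Set.Ioo (-1) 1 := fun x hx => ⟨by linarith [hx.1], by linarith [hx.2]⟩
  have c1 : ContinuousOn (fun p : ℝ × ℝ => gI p.1) (Set.Icc (-κ) κ ×ˢ Set.Icc (-κ) κ) :=
    gI_contOn.comp continuousOn_fst fun p hp => hsub hp.1
  have c2 : ContinuousOn (fun p : ℝ × ℝ => gI p.2) (Set.Icc (-κ) κ ×ˢ Set.Icc (-κ) κ) :=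
    gI_contOn.comp continuousOn_snd fun p hp => hsub hp.2
  have c3 : ContinuousOn (fun p : ℝ × ℝ => gp ((gI p.2 - sin θ * gI p.1) / cos θ))
      (Set.Icc (-κ) κ ×ˢ Set.Icc (-κ) κ) :=
    gp_cont.comp_continuousOn ((c2.sub (continuousOn_const.mul c1)).div_const _)
  have c4 := (gp_cont.comp_continuousOn c1).inv₀ (fun p _ => (gp_pos _).ne')
  have c5 := (gp_cont.comp_continuousOn c2).inv₀ (fun p _ => (gp_pos _).ne')
  constructor
  · exact c3.mul ((continuousOn_const.mul c4).neg.div_const _)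
  · exact c3.mul (c5.div_const _)

lemma seg_mem {κ x h l : ℝ} (hp : x + h ∈ Set.Icc (-κ) κ) (hm : x - h ∈ Set.Icc (-κ) κ)
    (hl : l ∈ Set.Icc (0:ℝ) 1) : x + l * h ∈ Set.Icc (-κ) κ ∧ x + l * (-h) ∈ Set.Icc (-κ) κ := by
  obtain ⟨a1, a2⟩ := hp
  obtain ⟨b1, b2⟩ := hm
  obtain ⟨l1, l2⟩ := hl
  refine ⟨⟨?_, ?_⟩, ⟨?_, ?_⟩⟩ <;> nlinarith

theorem two_point (h0 : 0 ≤ θ) (h1 : θ < π / 2) {κ : ℝ} (hκ : κ < 1) {η : ℝ} (hη : 0 < η) :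
    ∃ C : ℝ, 0 ≤ C ∧ ∀ x y h k : ℝ, x + h ∈ Set.Icc (-κ) κ → x - h ∈ Set.Icc (-κ) κ →
      y + k ∈ Set.Icc (-κ) κ → y - k ∈ Set.Icc (-κ) κ →
      (1 + sin θ) / 4 * (bB θ (x + h) (y + k) + bB θ (x - h) (y - k))
        + (1 - sin θ) / 4 * (bB θ (x + h) (y - k) + bB θ (x - h) (y + k))
      ≤ bB θ x y + (η * h ^ 2 + C * h ^ 4) + (η * k ^ 2 + C * k ^ 4) := by
  obtain ⟨d1, hd1, u1⟩ := unif_aux (κ := κ) (bH1 θ) (bH_contOn hκ).1 hη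
  obtain ⟨d2, hd2, u2⟩ := unif_aux (κ := κ) (bH2 θ) (bH_contOn hκ).2 hη
  set d := min d1 d2 with hd
  have hdp : 0 < d := lt_min hd1 hd2
  have hs0 : 0 ≤ sin θ := sin_nonneg_of_nonneg_of_le_pi h0 (by linarith [pi_pos])
  have hs1 := sin_le_one θ
  refine ⟨4 / d ^ 4, by positivity, fun x y h k hx1 hx2 hy1 hy2 => ?_⟩
  have hlt : ∀ z ∈ Set.Icc (-κ) κ, |z| < 1 := fun z hz =>
    abs_lt.2 ⟨by linarith [hz.1], by linarith [hz.2]⟩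
  have hx0 : x ∈ Set.Icc (-κ) κ := ⟨by linarith [hx1.1, hx2.1], by linarith [hx1.2, hx2.2]⟩
  have hy0 : y ∈ Set.Icc (-κ) κ := ⟨by linarith [hy1.1, hy2.1], by linarith [hy1.2, hy2.2]⟩
  by_cases hsm : |h| < d ∧ |k| < d
  · -- small increments
    obtain ⟨hh, hk⟩ := hsm
    have close : ∀ l ∈ Set.Icc (0:ℝ) 1, ∀ a : ℝ, |a| < d → ∀ z : ℝ, |z + l * a - z| < d := by
      intro l hl a ha z
      rw [add_sub_cancel_left, abs_mul, abs_of_nonneg hl.1]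
      nlinarith [hl.2, abs_nonneg a]
    have key : ∀ a b : ℝ, |a| < d → |b| < d → ∀ l ∈ Set.Icc (0:ℝ) 1, x + l * a ∈ Set.Icc (-κ) κ →
        y + l * b ∈ Set.Icc (-κ) κ →
        bQ θ (x + l * a) (y + l * b) a b ≤ bQ θ x y a b + 2 * η * (a ^ 2 + b ^ 2) := by
      intro a b ha hb l hl ma mb
      have ca := close l hl a ha x
      have cb := close l hl b hb y
      have v1 := u1 x y _ _ hx0 hy0 ma mb (ca.trans_le (min_le_left _ _)) (cb.trans_le (min_le_left _ _))
      have v2 := u2 x y _ _ hx0 hy0 ma mb (ca.trans_le (min_le_right _ _)) (cb.trans_le (min_le_right _ _))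
      have v3 := u1 y x _ _ hy0 hx0 mb ma (cb.trans_le (min_le_left _ _)) (ca.trans_le (min_le_left _ _))
      have v4 := u2 y x _ _ hy0 hx0 mb ma (cb.trans_le (min_le_right _ _)) (ca.trans_le (min_le_right _ _))
      have w1 := mul_le_mul_of_nonneg_left (abs_le.1 v1).2 (sq_nonneg a)
      have w3 := mul_le_mul_of_nonneg_left (abs_le.1 v3).2 (sq_nonneg b)
      have cross : ∀ D : ℝ, |D| ≤ η → a * b * D ≤ η * (a ^ 2 + b ^ 2) / 2 := by
        intro D hD
        have := abs_le.1 hD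
        nlinarith [mul_nonneg (sub_nonneg.2 this.2) (sq_nonneg (a - b)),
          mul_nonneg (sub_nonneg.2 this.1) (sq_nonneg (a + b)),
          mul_nonneg (sub_nonneg.2 this.2) (sq_nonneg (a + b)),
          mul_nonneg (sub_nonneg.2 this.1) (sq_nonneg (a - b))]
      have w2 := cross _ v2
      have w4 := cross _ v4
      unfold bQ
      nlinarith
    have in1 : ∀ z ∈ Set.Icc (-κ) κ, -1 < z := fun z hz => by linarith [hz.1]
    have in2 : ∀ z ∈ Set.Icc (-κ) κ, z < 1 := fun z hz => by linarith [hz.2]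
    have T := taylor_aux (M := 2 * η * (h ^ 2 + k ^ 2))
      (f := fun l => (1 + sin θ) / 4 * (bB θ (x + l * h) (y + l * k) + bB θ (x + l * (-h)) (y + l * (-k)))
        + (1 - sin θ) / 4 * (bB θ (x + l * h) (y + l * (-k)) + bB θ (x + l * (-h)) (y + l * k)))
      (f' := fun l => (1 + sin θ) / 4 *
          ((h * bG θ (x + l * h) (y + l * k) + k * bG θ (y + l * k) (x + l * h))
          + ((-h) * bG θ (x + l * (-h)) (y + l * (-k)) + (-k) * bG θ (y + l * (-k)) (x + l * (-h))))
        + (1 - sin θ) / 4 *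
          ((h * bG θ (x + l * h) (y + l * (-k)) + (-k) * bG θ (y + l * (-k)) (x + l * h))
          + ((-h) * bG θ (x + l * (-h)) (y + l * k) + k * bG θ (y + l * k) (x + l * (-h)))))
      (f'' := fun l => (1 + sin θ) / 4 * (bQ θ (x + l * h) (y + l * k) h k
          + bQ θ (x + l * (-h)) (y + l * (-k)) (-h) (-k))
        + (1 - sin θ) / 4 * (bQ θ (x + l * h) (y + l * (-k)) h (-k)
          + bQ θ (x + l * (-h)) (y + l * k) (-h) k))
      (by
        intro l hl
        obtain ⟨mx1, mx2⟩ := seg_mem hx1 hx2 hl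
        obtain ⟨my1, my2⟩ := seg_mem hy1 hy2 hl
        exact (((bB_path h0 h1 (in1 _ mx1) (in2 _ mx1) (in1 _ my1) (in2 _ my1)).add
          (bB_path h0 h1 (in1 _ mx2) (in2 _ mx2) (in1 _ my2) (in2 _ my2))).const_mul _).add
          (((bB_path h0 h1 (in1 _ mx1) (in2 _ mx1) (in1 _ my2) (in2 _ my2)).add
          (bB_path h0 h1 (in1 _ mx2) (in2 _ mx2) (in1 _ my1) (in2 _ my1))).const_mul _))
      (by
        intro l hl
        obtain ⟨mx1, mx2⟩ := seg_mem hx1 hx2 hl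
        obtain ⟨my1, my2⟩ := seg_mem hy1 hy2 hl
        have P : ∀ a b : ℝ, x + l * a ∈ Set.Icc (-κ) κ → y + l * b ∈ Set.Icc (-κ) κ →
            HasDerivAt (fun l => a * bG θ (x + l * a) (y + l * b) + b * bG θ (y + l * b) (x + l * a))
              (bQ θ (x + l * a) (y + l * b) a b) l := fun a b ma mb =>
          ((bG_path (in1 _ ma) (in2 _ ma) (in1 _ mb) (in2 _ mb)).const_mul a).add
            ((bG_path (in1 _ mb) (in2 _ mb) (in1 _ ma) (in2 _ ma)).const_mul b)
        exact (((P _ _ mx1 my1).add (P _ _ mx2 my2)).const_mul _).add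
          (((P _ _ mx1 my2).add (P _ _ mx2 my1)).const_mul _))
      (by
        intro l hl
        obtain ⟨mx1, mx2⟩ := seg_mem hx1 hx2 hl
        obtain ⟨my1, my2⟩ := seg_mem hy1 hy2 hl
        have hh' : |-h| < d := by rwa [abs_neg]
        have hk' : |-k| < d := by rwa [abs_neg]
        have q1 := key h k hh hk l hl mx1 my1
        have q2 := key (-h) (-k) hh' hk' l hl mx2 my2
        have q3 := key h (-k) hh hk' l hl mx1 my2
        have q4 := key (-h) k hh' hk l hl mx2 my1
        have N := bQ_neg h0 h1 x y h k
        have s1 : bQ θ x y (-h) (-k) = bQ θ x y h k := by unfold bQ; ring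
        have s2 : bQ θ x y (-h) k = bQ θ x y h (-k) := by unfold bQ; ring
        rw [s1] at q2
        rw [s2] at q4
        simp only [neg_sq] at q2 q3 q4
        have r1 := mul_le_mul_of_nonneg_left (add_le_add q1 q2) (show 0 ≤ (1 + sin θ) / 4 by linarith)
        have r2 := mul_le_mul_of_nonneg_left (add_le_add q3 q4) (show 0 ≤ (1 - sin θ) / 4 by linarith)
        linarith)
      (by simp; ring)
    simp only [one_mul, zero_mul, add_zero, ← sub_eq_add_neg] at T
    have c1 : 0 ≤ 4 / d ^ 4 * h ^ 4 := by positivity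
    have c2 : 0 ≤ 4 / d ^ 4 * k ^ 4 := by positivity
    linarith
  · -- large increments
    have b1 := (abs_le.1 (bB_bounds h0 h1 (hlt _ hx1) (hlt _ hy1)).2).2
    have b2 := (abs_le.1 (bB_bounds h0 h1 (hlt _ hx2) (hlt _ hy2)).2).2
    have b3 := (abs_le.1 (bB_bounds h0 h1 (hlt _ hx1) (hlt _ hy2)).2).2
    have b4 := (abs_le.1 (bB_bounds h0 h1 (hlt _ hx2) (hlt _ hy1)).2).2
    have b0 := (abs_le.1 (bB_bounds h0 h1 (hlt _ hx0) (hlt _ hy0)).2).1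
    have r1 := mul_le_mul_of_nonneg_left (add_le_add b1 b2) (show 0 ≤ (1 + sin θ) / 4 by linarith)
    have r2 := mul_le_mul_of_nonneg_left (add_le_add b3 b4) (show 0 ≤ (1 - sin θ) / 4 by linarith)
    have c1 : 0 ≤ 4 / d ^ 4 * h ^ 4 := by positivity
    have c2 : 0 ≤ 4 / d ^ 4 * k ^ 4 := by positivity
    have c3 : 0 ≤ η * h ^ 2 := by positivity
    have c4 : 0 ≤ η * k ^ 2 := by positivity
    have big : ∀ z : ℝ, d ≤ |z| → 4 ≤ 4 / d ^ 4 * z ^ 4 := by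
      intro z hz
      rw [div_mul_eq_mul_div, le_div_iff₀ (by positivity)]
      have : d ^ 4 ≤ |z| ^ 4 := by gcongr
      rw [show |z| ^ 4 = z ^ 4 from by rw [← abs_pow]; exact abs_of_nonneg (by positivity)] at this
      linarith
    rw [not_and_or, not_lt, not_lt] at hsm
    rcases hsm with hz | hz
    · have := big h hz; linarith
    · have := big k hz; linarith
/-! The discrete cube -/

lemma sum_cube_succ (n : ℕ) (f : (Fin (n + 1) → Bool) → ℝ) :
    ∑ x, f x = ∑ x : Fin n → Bool, (f (Fin.cons true x) + f (Fin.cons false x)) := by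
  rw [← (Fin.consEquiv (fun _ => Bool)).sum_comp f, Fintype.sum_prod_type]
  simp [Fin.consEquiv, sum_add_distrib]

def rs {n : ℕ} (s : Bool) (f : (Fin (n + 1) → Bool) → ℝ) : (Fin n → Bool) → ℝ :=
  fun x => f (Fin.cons s x)
noncomputable def av {n : ℕ} (f : (Fin (n + 1) → Bool) → ℝ) : (Fin n → Bool) → ℝ :=
  fun x => (f (Fin.cons true x) + f (Fin.cons false x)) / 2
noncomputable def df {n : ℕ} (f : (Fin (n + 1) → Bool) → ℝ) : (Fin n → Bool) → ℝ :=
  fun x => (f (Fin.cons true x) - f (Fin.cons false x)) / 2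
noncomputable def lf {n : ℕ} (a b : (Fin n → Bool) → ℝ) : (Fin (n + 1) → Bool) → ℝ :=
  fun x => a (Fin.tail x) + (if x 0 then 1 else -1) * b (Fin.tail x)

section basic
variable {n : ℕ}

@[simp] lemma rs_true_lf (a b : (Fin n → Bool) → ℝ) : rs true (lf a b) = a + b := by
  funext x; simp [rs, lf]
@[simp] lemma rs_false_lf (a b : (Fin n → Bool) → ℝ) : rs false (lf a b) = a - b := by
  funext x; simp [rs, lf, sub_eq_add_neg]
@[simp] lemma av_lf (a b : (Fin n → Bool) → ℝ) : av (lf a b) = a := by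
  funext x; simp [av, lf]; ring
@[simp] lemma df_lf (a b : (Fin n → Bool) → ℝ) : df (lf a b) = b := by
  funext x; simp [df, lf]
lemma lf_av_df (f : (Fin (n + 1) → Bool) → ℝ) : lf (av f) (df f) = f := by
  funext x
  have h : f x = f (Fin.cons (x 0) (Fin.tail x)) := by rw [Fin.cons_self_tail]
  rw [h]
  simp only [lf, av, df]
  cases x 0 <;> simp <;> ring
lemma rs_true_eq (f : (Fin (n + 1) → Bool) → ℝ) : rs true f = av f + df f := by
  funext x; simp [rs, av, df]; ring
lemma rs_false_eq (f : (Fin (n + 1) → Bool) → ℝ) : rs false f = av f - df f := by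
  funext x; simp [rs, av, df]; ring
lemma av_add (f g : (Fin (n + 1) → Bool) → ℝ) : av (f + g) = av f + av g := by
  funext x; simp [av]; ring
lemma df_add (f g : (Fin (n + 1) → Bool) → ℝ) : df (f + g) = df f + df g := by
  funext x; simp [df]; ring
lemma av_smul (c : ℝ) (f : (Fin (n + 1) → Bool) → ℝ) : av (c • f) = c • av f := by
  funext x; simp [av]; ring
lemma df_smul (c : ℝ) (f : (Fin (n + 1) → Bool) → ℝ) : df (c • f) = c • df f := by
  funext x; simp [df]; ring
lemma av_const (c : ℝ) : av (fun _ : Fin (n + 1) → Bool => c) = fun _ => c := by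
  funext x; simp [av]
lemma df_const (c : ℝ) : df (fun _ : Fin (n + 1) → Bool => c) = 0 := by
  funext x; simp [df]
lemma lf_add (a b c d : (Fin n → Bool) → ℝ) : lf (a + c) (b + d) = lf a b + lf c d := by
  funext x; simp only [lf, Pi.add_apply]; ring
lemma lf_smul (t : ℝ) (a b : (Fin n → Bool) → ℝ) : lf (t • a) (t • b) = t • lf a b := by
  funext x; simp only [lf, Pi.smul_apply, smul_eq_mul]; ring

lemma mean_succ (f : (Fin (n + 1) → Bool) → ℝ) :
    cubeMean (n + 1) f = (cubeMean n (rs true f) + cubeMean n (rs false f)) / 2 := by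
  unfold cubeMean rs
  rw [sum_cube_succ, sum_add_distrib, pow_succ]
  field_simp

lemma mean_zero (f : (Fin 0 → Bool) → ℝ) (x : Fin 0 → Bool) : cubeMean 0 f = f x := by
  unfold cubeMean
  rw [Fintype.sum_subsingleton _ x]; simp

lemma mean_add (f g : (Fin n → Bool) → ℝ) : cubeMean n (f + g) = cubeMean n f + cubeMean n g := by
  simp [cubeMean, sum_add_distrib, add_div]
lemma mean_smul (c : ℝ) (f : (Fin n → Bool) → ℝ) : cubeMean n (c • f) = c * cubeMean n f := by
  simp [cubeMean, ← mul_sum, mul_div_assoc]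
lemma mean_mono {f g : (Fin n → Bool) → ℝ} (h : ∀ x, f x ≤ g x) : cubeMean n f ≤ cubeMean n g := by
  unfold cubeMean
  gcongr with x
  exact h x
lemma mean_nonneg {f : (Fin n → Bool) → ℝ} (h : ∀ x, 0 ≤ f x) : 0 ≤ cubeMean n f := by
  unfold cubeMean
  exact div_nonneg (sum_nonneg fun x _ => h x) (by positivity)
@[simp] lemma mean_const (c : ℝ) : cubeMean n (fun _ => c) = c := by
  simp [cubeMean]

lemma mean_av (f : (Fin (n + 1) → Bool) → ℝ) : cubeMean (n + 1) f = cubeMean n (av f) := by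
  rw [mean_succ, rs_true_eq, rs_false_eq, sub_eq_add_neg, ← neg_one_smul ℝ (df f)]
  simp only [mean_add, mean_smul]; ring

/-- mean of squares -/
noncomputable def m2 (f : (Fin n → Bool) → ℝ) : ℝ := cubeMean n (fun x => f x ^ 2)
/-- mean of fourth powers -/
noncomputable def m4 (f : (Fin n → Bool) → ℝ) : ℝ := cubeMean n (fun x => f x ^ 4)

lemma m2_nonneg (f : (Fin n → Bool) → ℝ) : 0 ≤ m2 f := mean_nonneg fun x => by positivity
lemma m4_nonneg (f : (Fin n → Bool) → ℝ) : 0 ≤ m4 f := mean_nonneg fun x => by positivity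

lemma m2_rs (f : (Fin (n + 1) → Bool) → ℝ) : m2 f = (m2 (rs true f) + m2 (rs false f)) / 2 :=
  mean_succ _
lemma m4_rs (f : (Fin (n + 1) → Bool) → ℝ) : m4 f = (m4 (rs true f) + m4 (rs false f)) / 2 :=
  mean_succ _

lemma m2_succ (f : (Fin (n + 1) → Bool) → ℝ) : m2 f = m2 (av f) + m2 (df f) := by
  unfold m2
  rw [mean_av, ← mean_add]
  congr 1; funext x; simp [av, df]; ring

lemma m2_smul (c : ℝ) (f : (Fin n → Bool) → ℝ) : m2 (c • f) = c ^ 2 * m2 f := by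
  unfold m2; rw [← mean_smul]; congr 1; funext x; simp; ring
lemma m4_smul (c : ℝ) (f : (Fin n → Bool) → ℝ) : m4 (c • f) = c ^ 4 * m4 f := by
  unfold m4; rw [← mean_smul]; congr 1; funext x; simp; ring
lemma m2_const (c : ℝ) : m2 (fun _ : Fin n → Bool => c) = c ^ 2 := by simp [m2]
lemma m4_const (c : ℝ) : m4 (fun _ : Fin n → Bool => c) = c ^ 4 := by simp [m4]

lemma cs (f g : (Fin n → Bool) → ℝ) :
    cubeMean n (fun x => f x * g x) ^ 2 ≤ m2 f * m2 g := by
  unfold m2 cubeMean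
  rw [div_pow, div_mul_div_comm, ← sq]
  gcongr
  exact sum_mul_sq_le_sq_mul_sq _ _ _

lemma mean_sq_le (f : (Fin n → Bool) → ℝ) : cubeMean n f ^ 2 ≤ m2 f := by
  have := cs f (fun _ => 1)
  simpa [m2_const] using this

lemma infl_zero (f : (Fin (n + 1) → Bool) → ℝ) : influence (n + 1) 0 f = m2 (df f) := by
  have h : influence (n + 1) 0 f = m2 (fun x => (f x - f (Function.update x 0 (!(x 0)))) / 2) := rfl
  rw [h, m2_rs]
  have h1 : m2 (rs true (fun x => (f x - f (Function.update x 0 (!(x 0)))) / 2)) = m2 (df f) := by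
    congr 1; funext x; simp [rs, df, Fin.update_cons_zero]
  have h2 : m2 (rs false (fun x => (f x - f (Function.update x 0 (!(x 0)))) / 2)) = m2 (df f) := by
    unfold m2; congr 1; funext x; simp [rs, df, Fin.update_cons_zero]; ring
  rw [h1, h2]; ring

lemma infl_succ (f : (Fin (n + 1) → Bool) → ℝ) (i : Fin n) :
    influence (n + 1) i.succ f = influence n i (av f) + influence n i (df f) := by
  have h : influence (n + 1) i.succ f
    = m2 (fun x => (f x - f (Function.update x i.succ (!(x i.succ)))) / 2) := rfl
  have ha : influence n i (av f)
    = m2 (fun x => (av f x - av f (Function.update x i (!(x i)))) / 2) := rfl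
  have hb : influence n i (df f)
    = m2 (fun x => (df f x - df f (Function.update x i (!(x i)))) / 2) := rfl
  rw [h, ha, hb, m2_succ]
  congr 2
  · funext x; simp [av, ← Fin.cons_update]; ring
  · funext x; simp [df, ← Fin.cons_update]; ring

end basic

/-- multiplier operators -/
noncomputable def Mq : (n : ℕ) → (ℕ → ℝ) → ((Fin n → Bool) → ℝ) → ((Fin n → Bool) → ℝ)
  | 0, q, f => q 0 • f
  | n + 1, q, f => lf (Mq n q (av f)) (Mq n (fun m => q (m + 1)) (df f))

section mult
variable {n : ℕ}

lemma Mq_add (q : ℕ → ℝ) (f g : (Fin n → Bool) → ℝ) : Mq n q (f + g) = Mq n q f + Mq n q g := by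
  induction n generalizing q with
  | zero => simp [Mq]
  | succ n ih => simp [Mq, av_add, df_add, ih, lf_add]

lemma Mq_smul (q : ℕ → ℝ) (c : ℝ) (f : (Fin n → Bool) → ℝ) : Mq n q (c • f) = c • Mq n q f := by
  induction n generalizing q with
  | zero => exact smul_comm _ _ _
  | succ n ih => simp [Mq, av_smul, df_smul, ih, lf_smul]

lemma Mq_qadd (q r : ℕ → ℝ) (f : (Fin n → Bool) → ℝ) :
    Mq n (fun m => q m + r m) f = Mq n q f + Mq n r f := by
  induction n generalizing q r with
  | zero => simp [Mq, add_smul]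
  | succ n ih => simp [Mq, ih, ← lf_add]

lemma Mq_qsmul (c : ℝ) (r : ℕ → ℝ) (f : (Fin n → Bool) → ℝ) :
    Mq n (fun m => c * r m) f = c • Mq n r f := by
  induction n generalizing r with
  | zero => simp [Mq, mul_smul]
  | succ n ih => simp [Mq, ih, ← lf_smul]

lemma Mq_comp (q r : ℕ → ℝ) (f : (Fin n → Bool) → ℝ) :
    Mq n q (Mq n r f) = Mq n (fun m => q m * r m) f := by
  induction n generalizing q r with
  | zero => simp [Mq, mul_smul]
  | succ n ih => simp [Mq, ih]

lemma Mq_const (q : ℕ → ℝ) (c : ℝ) : Mq n q (fun _ => c) = fun _ => q 0 * c := by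
  induction n generalizing q c with
  | zero => funext x; simp [Mq]
  | succ n ih =>
    have h0 : Mq n (fun m => q (m + 1)) 0 = 0 := by
      have := Mq_smul (fun m => q (m + 1)) 0 (0 : (Fin n → Bool) → ℝ)
      simpa using this
    simp only [Mq, av_const, df_const, ih, h0]
    funext x; simp [lf]

lemma Mq_mean (q : ℕ → ℝ) (f : (Fin n → Bool) → ℝ) : cubeMean n (Mq n q f) = q 0 * cubeMean n f := by
  induction n generalizing q with
  | zero => simp [Mq, mean_smul]
  | succ n ih => simp [Mq, mean_av, ih]

lemma Mq_m2 (q : ℕ → ℝ) {A : ℝ} (hq : ∀ m, q m ^ 2 ≤ A) (f : (Fin n → Bool) → ℝ) :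
    m2 (Mq n q f) ≤ A * m2 f := by
  induction n generalizing q with
  | zero => 
    simp only [Mq, m2_smul]
    exact mul_le_mul_of_nonneg_right (hq 0) (m2_nonneg f)
  | succ n ih =>
    rw [m2_succ, m2_succ f, mul_add]
    simp only [Mq, av_lf, df_lf]
    exact add_le_add (ih q hq _) (ih _ (fun m => hq _) _)

lemma Mq_infl (q : ℕ → ℝ) {A : ℝ} (hq : ∀ m, q m ^ 2 ≤ A) (i : Fin n) (f : (Fin n → Bool) → ℝ) :
    influence n i (Mq n q f) ≤ A * influence n i f := by
  induction n generalizing q with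
  | zero => exact i.elim0
  | succ n ih =>
    refine Fin.cases ?_ (fun j => ?_) i
    · rw [infl_zero, infl_zero]
      simp only [Mq, df_lf]
      exact Mq_m2 _ (fun m => hq _) _
    · rw [infl_succ, infl_succ, mul_add]
      simp only [Mq, av_lf, df_lf]
      exact add_le_add (ih q hq _ _) (ih _ (fun m => hq _) _ _)

/-- noise operator -/
noncomputable def T (n : ℕ) (δ : ℝ) : ((Fin n → Bool) → ℝ) → ((Fin n → Bool) → ℝ) :=
  Mq n (fun m => δ ^ m)

lemma T_succ (δ : ℝ) (f : (Fin (n + 1) → Bool) → ℝ) :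
    T (n + 1) δ f = lf (T n δ (av f)) (δ • T n δ (df f)) := by
  simp only [T, Mq, pow_succ', ← Mq_qsmul]

lemma T_zero (δ : ℝ) (f : (Fin 0 → Bool) → ℝ) : T 0 δ f = f := by simp [T, Mq]

lemma T_bound {δ : ℝ} (h0 : 0 ≤ δ) (h1 : δ ≤ 1) (f : (Fin n → Bool) → ℝ)
    (hf : ∀ x, |f x| ≤ 1) (x : Fin n → Bool) : |T n δ f x| ≤ 1 := by
  induction n with
  | zero => rw [T_zero]; exact hf x
  | succ n ih =>
    rw [T_succ]
    have ht := ih (rs true f) (fun x => hf _) (Fin.tail x)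
    have hg := ih (rs false f) (fun x => hf _) (Fin.tail x)
    rw [rs_true_eq, T, Mq_add] at ht
    rw [rs_false_eq, sub_eq_add_neg, ← neg_one_smul ℝ, T, Mq_add, Mq_smul] at hg
    simp only [lf, T, Pi.add_apply, Pi.smul_apply, smul_eq_mul, abs_le] at *
    split_ifs <;> constructor <;> nlinarith

lemma hyper (f : (Fin n → Bool) → ℝ) : m4 (T n (1/2) f) ≤ m2 f ^ 2 := by
  induction n with
  | zero =>
    rw [T_zero, m4, m2, mean_zero _ Fin.elim0, mean_zero _ Fin.elim0]
    exact le_of_eq (by ring)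
  | succ n ih =>
    rw [T_succ, m2_succ]
    have ha := ih (av f)
    have hb := ih (df f)
    set a := T n (1/2) (av f)
    set b := T n (1/2) (df f)
    have hA := m2_nonneg (av f)
    have hB := m2_nonneg (df f)
    set A := m2 (av f)
    set B := m2 (df f)
    have e : m4 (lf a ((1/2:ℝ) • b)) = m4 a + 3/2 * cubeMean n (fun x => a x ^ 2 * b x ^ 2) + 1/16 * m4 b := by
      unfold m4
      rw [mean_av, ← mean_smul, ← mean_smul, ← mean_add, ← mean_add]
      congr 1; funext x; simp [av, lf]; ring
    have hcs := cs (fun x => a x ^ 2) (fun x => b x ^ 2)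
    have e1 : m2 (fun x => a x ^ 2) = m4 a := by unfold m2 m4; congr 1; funext x; ring
    have e2 : m2 (fun x => b x ^ 2) = m4 b := by unfold m2 m4; congr 1; funext x; ring
    rw [e1, e2] at hcs
    have hmix : cubeMean n (fun x => a x ^ 2 * b x ^ 2) ≤ A * B := by
      apply le_of_sq_le_sq _ (by positivity)
      calc _ ≤ m4 a * m4 b := hcs
        _ ≤ A ^ 2 * B ^ 2 := mul_le_mul ha hb (m4_nonneg b) (by positivity)
        _ = _ := by ring
    rw [e]
    nlinarith [mul_nonneg hA hB]

end mult

/-- martingale differences -/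
noncomputable def D : (n : ℕ) → Fin n → ((Fin n → Bool) → ℝ) → ((Fin n → Bool) → ℝ)
  | 0, i, _ => i.elim0
  | n + 1, i, f => Fin.cases (fun _ => cubeMean n (df f)) (fun j => lf (D n j (av f)) (D n j (df f))) i

section mart
variable {n : ℕ}

lemma D_zero (f : (Fin (n + 1) → Bool) → ℝ) : D (n + 1) 0 f = fun _ => cubeMean n (df f) := rfl
lemma D_succ (j : Fin n) (f : (Fin (n + 1) → Bool) → ℝ) :
    D (n + 1) j.succ f = lf (D n j (av f)) (D n j (df f)) := rfl

lemma D_add (i : Fin n) (f g : (Fin n → Bool) → ℝ) : D n i (f + g) = D n i f + D n i g := by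
  induction n with
  | zero => exact i.elim0
  | succ n ih =>
    refine Fin.cases ?_ (fun j => ?_) i
    · simp only [D_zero, df_add, mean_add]; rfl
    · simp only [D_succ, av_add, df_add, ih, lf_add]

lemma D_smul (i : Fin n) (c : ℝ) (f : (Fin n → Bool) → ℝ) : D n i (c • f) = c • D n i f := by
  induction n with
  | zero => exact i.elim0
  | succ n ih =>
    refine Fin.cases ?_ (fun j => ?_) i
    · simp only [D_zero, df_smul, mean_smul]; rfl
    · simp only [D_succ, av_smul, df_smul, ih, lf_smul]

lemma D_rs_true (j : Fin n) (f : (Fin (n + 1) → Bool) → ℝ) :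
    rs true (D (n + 1) j.succ f) = D n j (rs true f) := by
  rw [D_succ, rs_true_lf, rs_true_eq, D_add]
lemma D_rs_false (j : Fin n) (f : (Fin (n + 1) → Bool) → ℝ) :
    rs false (D (n + 1) j.succ f) = D n j (rs false f) := by
  rw [D_succ, rs_false_lf, rs_false_eq, sub_eq_add_neg (av f), ← neg_one_smul ℝ (df f), D_add, D_smul,
    neg_one_smul, ← sub_eq_add_neg]

lemma D_T (i : Fin n) (δ : ℝ) (f : (Fin n → Bool) → ℝ) : D n i (T n δ f) = δ • T n δ (D n i f) := by
  induction n with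
  | zero => exact i.elim0
  | succ n ih =>
    refine Fin.cases ?_ (fun j => ?_) i
    · rw [T_succ, D_zero, D_zero, df_lf, mean_smul, T, T, Mq_mean, Mq_const]
      funext x; simp
    · rw [T_succ, T_succ, D_succ, D_succ, av_lf, df_lf, av_lf, df_lf, D_smul, ih, ih, ← lf_smul]

lemma D_m2_le (i : Fin n) (f : (Fin n → Bool) → ℝ) : m2 (D n i f) ≤ influence n i f := by
  induction n with
  | zero => exact i.elim0
  | succ n ih =>
    refine Fin.cases ?_ (fun j => ?_) i
    · rw [D_zero, m2_const, infl_zero]; exact mean_sq_le _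
    · rw [D_succ, m2_succ, av_lf, df_lf, infl_succ]; exact add_le_add (ih _ _) (ih _ _)

lemma D_sum (f : (Fin n → Bool) → ℝ) : ∑ i, m2 (D n i f) + cubeMean n f ^ 2 = m2 f := by
  induction n with
  | zero => simp [m2, mean_zero _ (Fin.elim0 : Fin 0 → Bool)]
  | succ n ih =>
    rw [Fin.sum_univ_succ, D_zero, m2_const, m2_succ f, ← ih, ← ih, mean_av f]
    simp only [D_succ, m2_succ (lf _ _), av_lf, df_lf, sum_add_distrib]
    ring

lemma D_sum_le (f : (Fin n → Bool) → ℝ) : ∑ i, m2 (D n i f) ≤ m2 f := by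
  nlinarith [D_sum f, sq_nonneg (cubeMean n f)]

lemma mean_abs_le {f : (Fin n → Bool) → ℝ} (hf : ∀ x, |f x| ≤ 1) : |cubeMean n f| ≤ 1 := by
  rw [abs_le]
  constructor
  · have := mean_mono (f := fun _ => -1) (g := f) (fun x => (abs_le.1 (hf x)).1)
    simpa using this
  · have := mean_mono (f := f) (g := fun _ => 1) (fun x => (abs_le.1 (hf x)).2)
    simpa using this

lemma D_bound (i : Fin n) (f : (Fin n → Bool) → ℝ) (hf : ∀ x, |f x| ≤ 1) (x : Fin n → Bool) :
    |D n i f x| ≤ 1 := by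
  induction n with
  | zero => exact i.elim0
  | succ n ih =>
    revert x
    refine Fin.cases ?_ (fun j => ?_) i
    · intro x
      rw [D_zero]
      apply mean_abs_le
      intro y
      have h1 := abs_le.1 (hf (Fin.cons true y))
      have h2 := abs_le.1 (hf (Fin.cons false y))
      unfold df
      rw [abs_le]; constructor <;> linarith
    · intro x
      rw [← Fin.cons_self_tail x]
      cases x 0
      · change |rs false (D (n + 1) j.succ f) (Fin.tail x)| ≤ 1
        rw [D_rs_false]; exact ih _ _ (fun y => hf _) _
      · change |rs true (D (n + 1) j.succ f) (Fin.tail x)| ≤ 1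
        rw [D_rs_true]; exact ih _ _ (fun y => hf _) _

lemma D_m4_T (i : Fin n) (f : (Fin n → Bool) → ℝ) :
    m4 (D n i (T n (1/2) f)) ≤ m2 (D n i f) ^ 2 := by
  rw [D_T, m4_smul]
  have := hyper (D n i f)
  have := m4_nonneg (T n (1/2) (D n i f))
  linarith

lemma Q4_bound {δ τ : ℝ} (h0 : 0 ≤ δ) (h1 : δ ≤ 1) (k : ℕ) (f : (Fin n → Bool) → ℝ)
    (hf : ∀ x, |f x| ≤ 1) (hi : ∀ i, influence n i f ≤ τ) (hτ : 0 ≤ τ) :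
    ∑ i, m4 (D n i (T n δ f)) ≤ 4 * (4 ^ k * τ * 4 ^ k) + 4 * (δ ^ k) ^ 2 := by
  set N := Mq n (fun m => if m ≤ k then (2 * δ) ^ m else 0) f with hN
  set H := Mq n (fun m => if m ≤ k then 0 else δ ^ m) f with hH
  have hf2 : m2 f ≤ 1 := by
    have := mean_mono (f := fun x => f x ^ 2) (g := fun _ => 1)
      (fun x => by simpa using sq_le_one_iff_abs_le_one _ |>.2 (hf x))
    simpa [m2] using this
  have hdec : T n δ f = T n (1/2) N + H := by
    rw [hN, hH, T, T, Mq_comp, ← Mq_qadd]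
    congr 1; funext m
    split_ifs
    · rw [← mul_pow]; ring
    · simp
  have hNq : ∀ m, (if m ≤ k then (2 * δ) ^ m else 0) ^ 2 ≤ (4:ℝ) ^ k := by
    intro m
    split_ifs with h
    · calc ((2 * δ) ^ m) ^ 2 = (δ ^ m) ^ 2 * 4 ^ m := by
            rw [mul_pow, mul_pow, ← pow_mul, mul_comm m 2, pow_mul]; norm_num; ring
        _ ≤ 1 * 4 ^ k := by
          gcongr
          · exact pow_le_one₀ (by positivity) (pow_le_one₀ h0 h1)
          · norm_num
        _ = _ := one_mul _
    · simp
  have hHq : ∀ m, (if m ≤ k then 0 else δ ^ m) ^ 2 ≤ (δ ^ k) ^ 2 := by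
    intro m
    split_ifs with h
    · rw [zero_pow (by norm_num)]; positivity
    · have : δ ^ m ≤ δ ^ k := pow_le_pow_of_le_one h0 h1 (by omega)
      gcongr
  have hpt : ∀ i, m4 (D n i (T n δ f)) ≤ 4 * m4 (D n i (T n (1/2) N)) + 4 * m2 (D n i H) := by
    intro i
    unfold m4 m2
    rw [← mean_smul, ← mean_smul, ← mean_add]
    apply mean_mono
    intro x
    have hb := D_bound i _ (T_bound h0 h1 f hf) x
    rw [hdec, D_add] at *
    simp only [Pi.add_apply, Pi.smul_apply, smul_eq_mul] at *
    set l := D n i (T n (1/2) N) x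
    set h := D n i H x
    have hb2 : (l + h) ^ 2 ≤ 1 := (sq_le_one_iff_abs_le_one _).2 hb
    nlinarith [sq_nonneg (l - h), sq_nonneg ((l + h) ^ 2 - 2 * l ^ 2), sq_nonneg h,
      mul_nonneg (sub_nonneg.2 hb2) (sq_nonneg h), mul_nonneg (sq_nonneg (l + h)) (sq_nonneg (l - h))]
  calc ∑ i, m4 (D n i (T n δ f))
      ≤ ∑ i, (4 * (4 ^ k * τ * m2 (D n i N)) + 4 * m2 (D n i H)) := by
        apply sum_le_sum
        intro i _
        refine (hpt i).trans ?_
        have a1 := D_m4_T i N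
        have a2 : m2 (D n i N) ≤ 4 ^ k * τ :=
          (D_m2_le i N).trans ((Mq_infl _ hNq i f).trans (by gcongr; exact hi i))
        have a3 := mul_le_mul_of_nonneg_right a2 (m2_nonneg (D n i N))
        nlinarith
    _ = 4 * (4 ^ k * τ * ∑ i, m2 (D n i N)) + 4 * ∑ i, m2 (D n i H) := by
        rw [sum_add_distrib, ← mul_sum, ← mul_sum, ← mul_sum]
    _ ≤ _ := by
        have b1 : ∑ i, m2 (D n i N) ≤ 4 ^ k :=
          (D_sum_le N).trans ((Mq_m2 _ hNq f).trans (mul_le_of_le_one_right (by positivity) hf2))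
        have b2 : ∑ i, m2 (D n i H) ≤ (δ ^ k) ^ 2 :=
          (D_sum_le H).trans ((Mq_m2 _ hHq f).trans (mul_le_of_le_one_right (by positivity) hf2))
        gcongr

end mart

/-- correlated expectation -/
noncomputable def EE (n : ℕ) (ρ : ℝ) (F : (Fin n → Bool) → (Fin n → Bool) → ℝ) : ℝ :=
  (∑ x : Fin n → Bool, ∑ y : Fin n → Bool,
    F x y * ∏ i : Fin n, (if x i = y i then (1 + ρ) / 2 else (1 - ρ) / 2)) / 2 ^ n

section corr
variable {n : ℕ} {ρ : ℝ}

lemma EE_zero (F : (Fin 0 → Bool) → (Fin 0 → Bool) → ℝ) (x : Fin 0 → Bool) : EE 0 ρ F = F x x := by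
  unfold EE
  rw [Fintype.sum_subsingleton _ x, Fintype.sum_subsingleton _ x]; simp

lemma EE_succ (F : (Fin (n + 1) → Bool) → (Fin (n + 1) → Bool) → ℝ) :
    EE (n + 1) ρ F =
      (1 + ρ) / 4 * (EE n ρ (fun x y => F (Fin.cons true x) (Fin.cons true y))
        + EE n ρ (fun x y => F (Fin.cons false x) (Fin.cons false y)))
      + (1 - ρ) / 4 * (EE n ρ (fun x y => F (Fin.cons true x) (Fin.cons false y))
        + EE n ρ (fun x y => F (Fin.cons false x) (Fin.cons true y))) := by
  unfold EE
  simp only [sum_cube_succ, Fin.prod_univ_succ, Fin.cons_zero, Fin.cons_succ, pow_succ]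
  simp only [← add_div, ← sum_add_distrib, mul_div_assoc', mul_sum]
  rw [div_eq_div_iff (by positivity) (by positivity)]
  simp only [mul_sum, sum_mul]
  rw [← sub_eq_zero, ← sum_sub_distrib]
  apply sum_eq_zero
  intro x _
  rw [← sum_sub_distrib]
  apply sum_eq_zero
  intro y _
  simp
  ring

lemma EE_lin (a b : ℝ) (F G H K : (Fin n → Bool) → (Fin n → Bool) → ℝ) :
    a * (EE n ρ F + EE n ρ G) + b * (EE n ρ H + EE n ρ K)
      = EE n ρ (fun x y => a * (F x y + G x y) + b * (H x y + K x y)) := by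
  unfold EE
  simp only [← add_div, ← sum_add_distrib, mul_div_assoc', mul_sum]
  congr 1
  refine sum_congr rfl fun x _ => sum_congr rfl fun y _ => ?_
  ring

lemma EE_smul (c : ℝ) (F : (Fin n → Bool) → (Fin n → Bool) → ℝ) :
    EE n ρ (fun x y => c * F x y) = c * EE n ρ F := by
  unfold EE
  rw [mul_div_assoc', mul_sum]
  simp only [mul_sum]
  congr 1
  refine sum_congr rfl fun x _ => sum_congr rfl fun y _ => ?_
  ring

lemma EE_add (F G : (Fin n → Bool) → (Fin n → Bool) → ℝ) :
    EE n ρ (fun x y => F x y + G x y) = EE n ρ F + EE n ρ G := by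
  unfold EE
  simp only [← add_div, ← sum_add_distrib, add_mul]

lemma EE_mono (h0 : 0 ≤ ρ) (h1 : ρ ≤ 1) {F G : (Fin n → Bool) → (Fin n → Bool) → ℝ}
    (h : ∀ x y, F x y ≤ G x y) : EE n ρ F ≤ EE n ρ G := by
  unfold EE
  gcongr with x _ y _
  all_goals first
    | exact h x y
    | (apply prod_nonneg
       intro i _
       split_ifs <;> linarith)

lemma EE_one : EE n ρ (fun _ _ => 1) = 1 := by
  induction n with
  | zero => rw [EE_zero _ Fin.elim0]
  | succ n ih => rw [EE_succ, ih]; ring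

lemma EE_mul_succ (f g : (Fin (n + 1) → Bool) → ℝ) :
    EE (n + 1) ρ (fun x y => f x * g y)
      = EE n ρ (fun x y => av f x * av g y) + ρ * EE n ρ (fun x y => df f x * df g y) := by
  rw [EE_succ, EE_lin, ← EE_smul, ← EE_add]
  congr 1; funext x y
  simp only [av, df]
  ring

lemma EE_T (δ : ℝ) (f g : (Fin n → Bool) → ℝ) :
    EE n ρ (fun x y => T n δ f x * T n δ g y) = EE n (ρ * δ ^ 2) (fun x y => f x * g y) := by
  induction n with
  | zero => rw [EE_zero _ Fin.elim0, EE_zero _ Fin.elim0, T_zero, T_zero]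
  | succ n ih =>
    rw [EE_mul_succ, EE_mul_succ, T_succ, T_succ, av_lf, av_lf, df_lf, df_lf, ih, ← ih (df f)]
    simp only [Pi.smul_apply, smul_eq_mul]
    rw [show (fun x y => δ * T n δ (df f) x * (δ * T n δ (df g) y))
      = (fun x y => δ ^ 2 * (T n δ (df f) x * T n δ (df g) y)) by funext x y; ring, EE_smul]
    ring

/-- accumulated error -/
noncomputable def Err (n : ℕ) (η C : ℝ) (f : (Fin n → Bool) → ℝ) : ℝ :=
  ∑ i, (η * m2 (D n i f) + C * m4 (D n i f))

lemma Err_succ (η C : ℝ) (f : (Fin (n + 1) → Bool) → ℝ) :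
    Err (n + 1) η C f = (η * cubeMean n (df f) ^ 2 + C * cubeMean n (df f) ^ 4)
      + (Err n η C (rs true f) + Err n η C (rs false f)) / 2 := by
  unfold Err
  rw [Fin.sum_univ_succ, D_zero, m2_const, m4_const, ← sum_add_distrib, sum_div]
  congr 1
  refine sum_congr rfl fun j _ => ?_
  rw [m2_rs, m4_rs, D_rs_true, D_rs_false]
  ring

lemma mean_mem {κ : ℝ} {f : (Fin n → Bool) → ℝ} (hf : ∀ x, f x ∈ Set.Icc (-κ) κ) :
    cubeMean n f ∈ Set.Icc (-κ) κ := by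
  constructor
  · have := mean_mono (f := fun _ => -κ) (g := f) (fun x => (hf x).1)
    simpa using this
  · have := mean_mono (f := f) (g := fun _ => κ) (fun x => (hf x).2)
    simpa using this

theorem tensor (h0 : 0 ≤ ρ) (h1 : ρ ≤ 1) {κ η C : ℝ} (B : ℝ → ℝ → ℝ)
    (hB : ∀ x y h k : ℝ, x + h ∈ Set.Icc (-κ) κ → x - h ∈ Set.Icc (-κ) κ →
      y + k ∈ Set.Icc (-κ) κ → y - k ∈ Set.Icc (-κ) κ →
      (1 + ρ) / 4 * (B (x + h) (y + k) + B (x - h) (y - k))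
        + (1 - ρ) / 4 * (B (x + h) (y - k) + B (x - h) (y + k))
      ≤ B x y + (η * h ^ 2 + C * h ^ 4) + (η * k ^ 2 + C * k ^ 4))
    (f g : (Fin n → Bool) → ℝ) (hf : ∀ x, f x ∈ Set.Icc (-κ) κ) (hg : ∀ x, g x ∈ Set.Icc (-κ) κ) :
    EE n ρ (fun x y => B (f x) (g y))
      ≤ B (cubeMean n f) (cubeMean n g) + Err n η C f + Err n η C g := by
  induction n with
  | zero =>
    rw [EE_zero _ Fin.elim0, mean_zero f Fin.elim0, mean_zero g Fin.elim0]
    simp [Err]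
  | succ n ih =>
    rw [EE_succ]
    have tt := ih (rs true f) (rs true g) (fun x => hf _) (fun x => hg _)
    have ff := ih (rs false f) (rs false g) (fun x => hf _) (fun x => hg _)
    have tf := ih (rs true f) (rs false g) (fun x => hf _) (fun x => hg _)
    have ft := ih (rs false f) (rs true g) (fun x => hf _) (fun x => hg _)
    have mt : ∀ f : (Fin (n + 1) → Bool) → ℝ, cubeMean n (rs true f) = cubeMean (n + 1) f + cubeMean n (df f) := by
      intro f; rw [rs_true_eq, mean_add, mean_av]
    have mf : ∀ f : (Fin (n + 1) → Bool) → ℝ, cubeMean n (rs false f) = cubeMean (n + 1) f - cubeMean n (df f) := by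
      intro f
      rw [rs_false_eq, sub_eq_add_neg, ← neg_one_smul ℝ (df f), mean_add, mean_smul, mean_av]; ring
    have a1 := mean_mem (f := rs true f) (κ := κ) (fun x => hf _)
    have a2 := mean_mem (f := rs false f) (κ := κ) (fun x => hf _)
    have a3 := mean_mem (f := rs true g) (κ := κ) (fun x => hg _)
    have a4 := mean_mem (f := rs false g) (κ := κ) (fun x => hg _)
    rw [mt] at a1 a3
    rw [mf] at a2 a4
    have key := hB _ _ _ _ a1 a2 a3 a4
    simp only [mt, mf] at tt ff tf ft
    rw [Err_succ, Err_succ]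
    have r1 := mul_le_mul_of_nonneg_left (add_le_add tt ff) (show 0 ≤ (1 + ρ) / 4 by linarith)
    have r2 := mul_le_mul_of_nonneg_left (add_le_add tf ft) (show 0 ≤ (1 - ρ) / 4 by linarith)
    simp only [rs] at r1 r2 ⊢
    linarith

lemma Err_bound {η C : ℝ} (hη : 0 ≤ η) (f : (Fin n → Bool) → ℝ) (hf : ∀ x, |f x| ≤ 1) :
    Err n η C f ≤ η + C * ∑ i, m4 (D n i f) := by
  unfold Err
  rw [sum_add_distrib, ← mul_sum, ← mul_sum]
  have hf2 : m2 f ≤ 1 := by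
    have := mean_mono (f := fun x => f x ^ 2) (g := fun _ => 1)
      (fun x => by simpa using sq_le_one_iff_abs_le_one _ |>.2 (hf x))
    simpa [m2] using this
  have := mul_le_mul_of_nonneg_left ((D_sum_le f).trans hf2) hη
  linarith

end corr

lemma choose_delta {ρ : ℝ} (hρ1 : ρ < 1) {ε : ℝ} (hε : 0 < ε) :
    ∃ δ : ℝ, 0 < δ ∧ δ < 1 ∧ ρ / δ ^ 2 < 1 ∧
      2 / Real.pi * Real.arcsin (ρ / δ ^ 2) < 2 / Real.pi * Real.arcsin ρ + ε := by
  have c0 : ContinuousAt (fun δ : ℝ => ρ / δ ^ 2) 1 := by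
    apply ContinuousAt.div <;> first | fun_prop | norm_num
  have c1 : ContinuousAt (fun δ : ℝ => 2 / Real.pi * Real.arcsin (ρ / δ ^ 2)) 1 :=
    continuousAt_const.mul (Real.continuous_arcsin.continuousAt.comp c0)
  have e0 := c0.eventually (gt_mem_nhds (show ρ / 1 ^ 2 < 1 by simpa using hρ1))
  have e1 := c1.eventually (gt_mem_nhds (show 2 / Real.pi * Real.arcsin (ρ / 1 ^ 2) <
    2 / Real.pi * Real.arcsin ρ + ε by simpa using hε))
  have e2 : ∀ᶠ δ : ℝ in nhds 1, 0 < δ := lt_mem_nhds one_pos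
  have h := ((e0.and (e1.and e2)).filter_mono nhdsWithin_le_nhds).and
    (self_mem_nhdsWithin : Set.Iio (1:ℝ) ∈ nhdsWithin 1 (Set.Iio 1))
  obtain ⟨δ, ⟨h0, h1, h2⟩, h3⟩ := h.exists
  exact ⟨δ, h2, h3, h0, h1⟩

theorem main (ρ : ℝ) (hρ0 : 0 ≤ ρ) (hρ1 : ρ < 1) (ε : ℝ) (hε : 0 < ε) :
    ∃ τ : ℝ, 0 < τ ∧
      ∀ (n : ℕ) (f : (Fin n → Bool) → ℝ),
        (∀ x, f x ∈ Set.Icc (-1 : ℝ) 1) →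
        cubeMean n f = 0 →
        (∀ i : Fin n, influence n i f ≤ τ) →
        noiseStability n ρ f ≤ 2 / Real.pi * Real.arcsin ρ + ε := by
  obtain ⟨δ, hδ0, hδ1, hρ', harc⟩ := choose_delta hρ1 (show 0 < ε / 8 by linarith)
  set r := ρ / δ ^ 2 with hr
  have hr0 : 0 ≤ r := by positivity
  have hrδ : r * δ ^ 2 = ρ := by rw [hr]; field_simp
  set θ := Real.arcsin r with hθ
  have hsin : Real.sin θ = r := Real.sin_arcsin (by linarith) hρ'.le
  have hθ0 : 0 ≤ θ := Real.arcsin_nonneg.2 hr0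
  have hθ1 : θ < Real.pi / 2 := Real.arcsin_lt_pi_div_two.2 hρ'
  -- the scale κ
  obtain ⟨κ, hκ0, hκ1, hκ2⟩ : ∃ κ : ℝ, 0 < κ ∧ κ < 1 ∧ 1 - κ ^ 2 ≤ ε / 8 := by
    refine ⟨max (1/2) (1 - ε / 16), by positivity, max_lt (by norm_num) (by linarith), ?_⟩
    have h1 := le_max_left (1/2) (1 - ε / 16)
    have h2 := le_max_right (1/2) (1 - ε / 16)
    have h3 : max (1/2) (1 - ε / 16) < 1 := max_lt (by norm_num) (by linarith)
    nlinarith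
  obtain ⟨C, hC0, hC⟩ := two_point hθ0 hθ1 hκ1 (show 0 < ε / 8 by linarith)
  rw [hsin] at hC
  -- truncation level
  obtain ⟨k, hk⟩ : ∃ k : ℕ, C * (4 * (δ ^ k) ^ 2) ≤ ε / 8 := by
    obtain ⟨k, hk⟩ := exists_pow_lt_of_lt_one (show 0 < ε / (32 * (C + 1)) by positivity) hδ1
    refine ⟨k, ?_⟩
    have h1 : δ ^ k ≤ 1 := pow_le_one₀ hδ0.le hδ1.le
    have h0 : 0 ≤ δ ^ k := by positivity
    have h2 : (δ ^ k) ^ 2 ≤ ε / (32 * (C + 1)) := by nlinarith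
    calc C * (4 * (δ ^ k) ^ 2) ≤ (C + 1) * (4 * (ε / (32 * (C + 1)))) := by gcongr; linarith
      _ = ε / 8 := by field_simp; norm_num
  set τ := ε / (32 * (C + 1) * (4 ^ k * 4 ^ k)) with hτ
  have hτ0 : 0 < τ := by positivity
  have hτC : C * (4 * (4 ^ k * τ * 4 ^ k)) ≤ ε / 8 := by
    calc C * (4 * (4 ^ k * τ * 4 ^ k)) ≤ (C + 1) * (4 * (4 ^ k * τ * 4 ^ k)) := by gcongr; linarith
      _ = ε / 8 := by rw [hτ]; field_simp; norm_num
  refine ⟨τ, hτ0, fun n f hf hm hi => ?_⟩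
  have hf1 : ∀ x, |f x| ≤ 1 := fun x => abs_le.2 (hf x)
  have hns : noiseStability n ρ f = EE n ρ (fun x y => f x * f y) := rfl
  rw [hns]
  have hS1 : EE n ρ (fun x y => f x * f y) ≤ 1 := by
    rw [← EE_one (n := n) (ρ := ρ)]
    apply EE_mono hρ0 hρ1.le
    intro x y
    have a := abs_le.1 (hf1 x)
    have b := abs_le.1 (hf1 y)
    nlinarith
  set g := κ • T n δ f with hg
  have hTb := T_bound hδ0.le hδ1.le f hf1
  have hgmem : ∀ x, g x ∈ Set.Icc (-κ) κ := by
    intro x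
    have := abs_le.1 (hTb x)
    simp only [hg, Pi.smul_apply, smul_eq_mul]
    constructor <;> nlinarith
  have hgm : cubeMean n g = 0 := by
    rw [hg, mean_smul, T, Mq_mean, hm]; simp
  have hgS : EE n r (fun x y => g x * g y) = κ ^ 2 * EE n ρ (fun x y => f x * f y) := by
    rw [← hrδ, ← EE_T, ← EE_smul]
    congr 1; funext x y
    simp only [hg, Pi.smul_apply, smul_eq_mul]; ring
  have hlt : ∀ x, |g x| < 1 := fun x =>
    abs_lt.2 ⟨by linarith [(hgmem x).1], by linarith [(hgmem x).2]⟩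
  have h1 : EE n r (fun x y => g x * g y) ≤ EE n r (fun x y => bB θ (g x) (g y)) :=
    EE_mono hr0 hρ'.le fun x y => (bB_bounds hθ0 hθ1 (hlt x) (hlt y)).1
  have h2 := tensor hr0 hρ'.le (bB θ) hC g g hgmem hgmem
  rw [hgm, bB_zero] at h2
  have h3 := Err_bound (C := C) (show 0 ≤ ε / 8 by linarith) g (fun x => (hlt x).le)
  have h4 : ∑ i, m4 (D n i g) ≤ 4 * (4 ^ k * τ * 4 ^ k) + 4 * (δ ^ k) ^ 2 := by
    refine le_trans (sum_le_sum fun i _ => ?_) (Q4_bound hδ0.le hδ1.le k f hf1 hi hτ0.le)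
    rw [hg, D_smul, m4_smul]
    exact mul_le_of_le_one_left (m4_nonneg _) (pow_le_one₀ hκ0.le hκ1.le)
  have h5 := mul_le_mul_of_nonneg_left h4 hC0
  have h6 : (1 - κ ^ 2) * EE n ρ (fun x y => f x * f y) ≤ ε / 8 := by
    have : 0 ≤ 1 - κ ^ 2 := by nlinarith
    nlinarith
  linarith

end MIS

/-- "Majority is Stablest" (Mossel–O'Donnell–Oleszkiewicz): for `0 ≤ ρ < 1` and `ε > 0`
there is an influence bound `τ > 0` such that every `[-1,1]`-valued balanced function on
the Boolean cube with all influences at most `τ` has noise stability at most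
`(2/π)·arcsin ρ + ε`. -/
theorem majority_is_stablest (ρ : ℝ) (hρ0 : 0 ≤ ρ) (hρ1 : ρ < 1) (ε : ℝ) (hε : 0 < ε) :
    ∃ τ : ℝ, 0 < τ ∧
      ∀ (n : ℕ) (f : (Fin n → Bool) → ℝ),
        (∀ x, f x ∈ Set.Icc (-1 : ℝ) 1) →
        cubeMean n f = 0 →
        (∀ i : Fin n, influence n i f ≤ τ) →
        noiseStability n ρ f ≤ 2 / Real.pi * Real.arcsin ρ + ε := by
  exact MIS.main ρ hρ0 hρ1 ε hε
end
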